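/- arXiv:math/0210367 — 5 statements merged into one kernel-verified Lean document; each statement's English description precedes it below -/
import Mathlib

section
/- Let 1 ≤ s ≤ n-1, let A ∈ M_{s+1,n-s}(ℝ), and let L be the s-dimensional affine subspace of ℝ^n parametrized by x ↦ (x, x̃A), x ∈ ℝ^s. Then the following are equivalent: (i) L is extremal; (ii) for every β > 0 there exists T > 0 such that for every t ≥ T, every j = 1,...,n and every w ∈ S_{n+1,j}, max( e^{((n+1-j)/n) t} · max_{I ∋ 0} ‖c_{I,w}^+ + A c_{I,w}^-‖ , e^{-(j/n) t} · max_{I ∌ 0, |I| = j} |w_I| ) ≥ e^{-β t}; (iii) for every j = 1,...,n and every v > (n+1-j)/j there exists N > 0 such that for every w ∈ S_{n+1,j} with max_{I ∌ 0, |I| = j} |w_I| > N one has max_{I ∋ 0} ‖c_{I,w}^+ + A c_{I,w}^-‖ > (max_{I ∌ 0, |I| = j} |w_I|)^{-v}. -/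
open MeasureTheory

/-- `y ∈ W_v(1,n)`: infinitely many `q ∈ ℤ^n` with `|y·q + p| ≤ ‖q‖^{-v}` for some `p ∈ ℤ`. -/
def InW {n : ℕ} (y : Fin n → ℝ) (v : ℝ) : Prop :=
  {q : Fin n → ℤ | ∃ p : ℤ,
    |(∑ i, y i * (q i : ℝ)) + (p : ℝ)| ≤
      ‖(fun i => (q i : ℝ) : Fin n → ℝ)‖ ^ (-v)}.Infinite

/-- `y` is very well approximable. -/
def IsVWA {n : ℕ} (y : Fin n → ℝ) : Prop :=
  ∃ v : ℝ, (n : ℝ) < v ∧ InW y v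

/-- `f` is extremal on `U`: `f x` is not VWA for a.e. `x ∈ U`. -/
def IsExtremal {α : Type*} [MeasureSpace α] {n : ℕ} (U : Set α) (f : α → Fin n → ℝ) : Prop :=
  volume {x ∈ U | IsVWA (f x)} = 0

/-- The `I`-th coordinate (in the basis `e_I`) of `v₁ ∧ … ∧ v_j`, i.e. the `j×j` minor
determinant of the matrix with rows `v₁,…,v_j` and columns indexed by `I`. -/
noncomputable def minorDet {k j : ℕ} (v : Fin j → Fin k → ℤ) (I : Finset (Fin k)) : ℤ :=
  if h : I.card = j then
    Matrix.det (Matrix.of fun a b : Fin j => v a ((I.orderIsoOfFin h) b : Fin k))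
  else 0

/-- `w` (given by its coordinates in the basis `(e_I)_{|I|=j}` of `Λ^j(ℝ^k)`) belongs to
`S_{k,j}`: it represents a rank-`j` subgroup of `ℤ^k`, i.e. `w = v₁ ∧ … ∧ v_j` for some
`ℤ`-basis `v₁,…,v_j` of such a subgroup (equivalently, a `ℤ`-linearly independent family). -/
def IsPrim {k : ℕ} (j : ℕ) (w : Finset (Fin k) → ℝ) : Prop :=
  ∃ v : Fin j → (Fin k → ℤ), LinearIndependent ℤ v ∧
    ∀ I : Finset (Fin k), w I = (minorDet v I : ℝ)

/-- `l(I,i)`: the number of elements of `I` strictly between `0` and `i`. -/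
def lIi {k : ℕ} (I : Finset (Fin (k + 1))) (i : Fin (k + 1)) : ℕ :=
  (I.filter fun a => 0 < a ∧ a < i).card

/-- For `I ∋ 0`, the vector `c_{I,w} = w_I e₀ + ∑_{i ∉ I} (-1)^{l(I,i)} w_{I∪{i}∖{0}} eᵢ`. -/
noncomputable def cIw {k : ℕ} (w : Finset (Fin (k + 1)) → ℝ) (I : Finset (Fin (k + 1))) :
    Fin (k + 1) → ℝ := fun i =>
  if i = 0 then w I
  else if i ∈ I then 0
  else (-1 : ℝ) ^ (lIi I i) * w ((insert i I).erase 0)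

/-- `max_{I ∋ 0, |I| = j} ‖P c_{I,w}‖` (sup norm on `ℝ^{s+1}`). -/
noncomputable def maxNormP {s n : ℕ} (P : Matrix (Fin (s + 1)) (Fin (n + 1)) ℝ) (j : ℕ)
    (w : Finset (Fin (n + 1)) → ℝ) : ℝ :=
  ⨆ I : {I : Finset (Fin (n + 1)) // 0 ∈ I ∧ I.card = j}, ‖P.mulVec (cIw w I.1)‖

/-- `max_{I ∌ 0, |I| = j} |w_I|`. -/
noncomputable def maxCoeff {n : ℕ} (j : ℕ) (w : Finset (Fin (n + 1)) → ℝ) : ℝ :=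
  ⨆ I : {I : Finset (Fin (n + 1)) // 0 ∉ I ∧ I.card = j}, |w I.1|

/-- Condition (3.6) for a matrix `P ∈ M_{s+1,n+1}(ℝ)`: for every `β > 0` there is `T > 0`
such that for all `t ≥ T`, `j = 1,…,n` and `w ∈ S_{n+1,j}`,
`max(e^{((n+1-j)/n)t} max_{I∋0} ‖P c_{I,w}‖, e^{-(j/n)t} max_{I∌0} |w_I|) ≥ e^{-βt}`. -/
def Cond36 {s n : ℕ} (P : Matrix (Fin (s + 1)) (Fin (n + 1)) ℝ) : Prop :=
  ∀ β : ℝ, 0 < β → ∃ T : ℝ, 0 < T ∧ ∀ t : ℝ, T ≤ t → ∀ j : ℕ, 1 ≤ j → j ≤ n →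
    ∀ w : Finset (Fin (n + 1)) → ℝ, IsPrim j w →
      Real.exp (-β * t) ≤
        max (Real.exp ((((n : ℝ) + 1 - (j : ℝ)) / (n : ℝ)) * t) * maxNormP P j w)
            (Real.exp (-((j : ℝ) / (n : ℝ)) * t) * maxCoeff j w)

/-- `max_{I ∋ 0, |I| = j} ‖c_{I,w}^+ + A c_{I,w}^-‖` (sup norm on `ℝ^{s+1}`), where
`c_{I,w}^+` and `c_{I,w}^-` are the vectors of the first `s+1` and last `m = n-s`
coordinates of `c_{I,w} ∈ ℝ^{n+1}`. -/
noncomputable def maxNormA {s m : ℕ} (A : Matrix (Fin (s + 1)) (Fin m) ℝ) (j : ℕ)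
    (w : Finset (Fin (s + m + 1)) → ℝ) : ℝ :=
  ⨆ I : {I : Finset (Fin (s + m + 1)) // 0 ∈ I ∧ I.card = j},
    ‖(fun i : Fin (s + 1) =>
        cIw w I.1 (Fin.castLE (by omega) i) +
        A.mulVec (fun r : Fin m => cIw w I.1 (Fin.cast (by omega) (Fin.natAdd (s + 1) r))) i
      : Fin (s + 1) → ℝ)‖

/-- The half-open dyadic cube of side `2⁻ˡ` containing `x`. -/
def dyadicCube {s : ℕ} (l : ℕ) (x : Fin s → ℝ) : Set (Fin s → ℝ) :=
  {y | ∀ i, ⌊2 ^ l * y i⌋ = ⌊2 ^ l * x i⌋}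

theorem mem_dyadicCube_self {s : ℕ} (l : ℕ) (x : Fin s → ℝ) : x ∈ dyadicCube l x := fun _ => rfl

theorem dyadicCube_eq_of_mem {s : ℕ} {l : ℕ} {x y : Fin s → ℝ} (h : y ∈ dyadicCube l x) :
    dyadicCube l y = dyadicCube l x := by
  ext z
  exact forall_congr' fun i => by rw [h i]

theorem dyadicCube_succ_subset {s : ℕ} (l : ℕ) (x : Fin s → ℝ) :
    dyadicCube (l + 1) x ⊆ dyadicCube l x := by
  intro y hy i
  have key : ∀ a : ℝ, ⌊2 ^ l * a⌋ = ⌊2 ^ (l + 1) * a⌋ / 2 := fun a => by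
    have := Int.floor_div_natCast (2 ^ (l + 1) * a) 2
    rw [← Nat.cast_ofNat (R := ℤ), ← this]
    congr 1
    push_cast
    ring
  rw [key, key, hy i]

theorem dyadicCube_antitone {s : ℕ} (x : Fin s → ℝ) : Antitone fun l => dyadicCube l x :=
  antitone_nat_of_succ_le fun l => dyadicCube_succ_subset l x

theorem dyadicCube_eq_pi {s : ℕ} (l : ℕ) (x : Fin s → ℝ) :
    dyadicCube l x = Set.pi Set.univ fun i =>
      Set.Ico ((⌊2 ^ l * x i⌋ : ℝ) / 2 ^ l) (((⌊2 ^ l * x i⌋ : ℝ) + 1) / 2 ^ l) := by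
  ext y
  simp only [dyadicCube, Set.mem_ofPred_eq, Set.mem_pi, Set.mem_univ, forall_true_left, Set.mem_Ico]
  refine forall_congr' fun i => ?_
  have h2 : (0 : ℝ) < 2 ^ l := by positivity
  rw [Int.floor_eq_iff, div_le_iff₀ h2, lt_div_iff₀ h2, mul_comm (y i)]

theorem measurableSet_dyadicCube {s : ℕ} (l : ℕ) (x : Fin s → ℝ) :
    MeasurableSet (dyadicCube l x) := by
  rw [dyadicCube_eq_pi]
  exact MeasurableSet.univ_pi fun i => measurableSet_Ico

theorem volume_dyadicCube {s : ℕ} (l : ℕ) (x : Fin s → ℝ) :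
    volume (dyadicCube l x) = ENNReal.ofReal (((2 : ℝ) ^ l)⁻¹ ^ s) := by
  rw [dyadicCube_eq_pi, Real.volume_pi_Ico]
  have : ∀ i : Fin s, ((⌊2 ^ l * x i⌋ : ℝ) + 1) / 2 ^ l - (⌊2 ^ l * x i⌋ : ℝ) / 2 ^ l
      = ((2 : ℝ) ^ l)⁻¹ := fun i => by ring
  simp only [this, Finset.prod_const, Finset.card_univ, Fintype.card_fin]
  rw [ENNReal.ofReal_pow (by positivity)]

theorem volume_dyadicCube_parent {s : ℕ} (l : ℕ) (x : Fin s → ℝ) :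
    volume (dyadicCube l x) = 2 ^ s * volume (dyadicCube (l + 1) x) := by
  rw [volume_dyadicCube, volume_dyadicCube]
  have : (2 : ENNReal) ^ s = ENNReal.ofReal (2 ^ s) := by
    rw [ENNReal.ofReal_pow (by positivity)]; simp
  rw [this, ← ENNReal.ofReal_mul (by positivity), ← mul_pow]
  congr 2
  rw [pow_succ]
  field_simp

theorem abs_sub_le_of_mem_dyadicCube {s : ℕ} {l : ℕ} {x y : Fin s → ℝ}
    (h : y ∈ dyadicCube l x) (i : Fin s) : |y i - x i| ≤ ((2 : ℝ) ^ l)⁻¹ := by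
  have h1 := Int.abs_sub_lt_one_of_floor_eq_floor (h i)
  have h2 : (0 : ℝ) < 2 ^ l := by positivity
  rw [← mul_sub, abs_mul, abs_of_pos h2] at h1
  rw [← one_div, le_div_iff₀ h2]
  linarith

theorem exists_dyadicCube_subset {s : ℕ} {U : Set (Fin s → ℝ)} (hU : IsOpen U)
    {x : Fin s → ℝ} (hx : x ∈ U) : ∃ l, dyadicCube l x ⊆ U := by
  obtain ⟨r, hr, hball⟩ := Metric.isOpen_iff.1 hU x hx
  obtain ⟨l, hl⟩ := exists_pow_lt_of_lt_one hr (by norm_num : (1 / 2 : ℝ) < 1)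
  refine ⟨l, fun y hy => hball ?_⟩
  rw [Metric.mem_ball, dist_eq_norm, pi_norm_lt_iff hr]
  intro i
  refine lt_of_le_of_lt (abs_sub_le_of_mem_dyadicCube hy i) ?_
  simpa using hl

theorem volume_le_of_dyadicCubes {s : ℕ} {E B : Set (Fin s → ℝ)} {c : ENNReal}
    (N : (Fin s → ℝ) → ℕ)
    (hN : ∀ y ∈ E, ∀ z ∈ dyadicCube (N y) y, N z = N y)
    (hB : ∀ y ∈ E, dyadicCube (N y) y ⊆ B)
    (hE : ∀ y ∈ E, volume (E ∩ dyadicCube (N y) y) ≤ c * volume (dyadicCube (N y) y)) :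
    volume E ≤ c * volume B := by
  set 𝒞 : Set (Set (Fin s → ℝ)) := {C | ∃ y ∈ E, C = dyadicCube (N y) y} with h𝒞
  have hcount : 𝒞.Countable := by
    refine (Set.countable_range
      (fun p : ℕ × (Fin s → ℤ) => {y : Fin s → ℝ | ∀ i, ⌊2 ^ p.1 * y i⌋ = p.2 i})).mono ?_
    rintro C ⟨y, -, rfl⟩
    exact ⟨(N y, fun i => ⌊2 ^ (N y) * y i⌋), rfl⟩
  have hdisj : 𝒞.PairwiseDisjoint id := by
    rintro C ⟨y, hy, rfl⟩ C' ⟨y', hy', rfl⟩ hne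
    refine Set.disjoint_left.2 fun z hz hz' => hne ?_
    change z ∈ dyadicCube (N y) y at hz
    change z ∈ dyadicCube (N y') y' at hz'
    have h1 := hN y hy z hz
    have h2 := hN y' hy' z hz'
    have h3 : N y = N y' := h1.symm.trans h2
    rw [← dyadicCube_eq_of_mem hz, ← dyadicCube_eq_of_mem hz', h3]
  have hsub : E ⊆ ⋃ C ∈ 𝒞, E ∩ C := fun y hy =>
    Set.mem_biUnion (⟨y, hy, rfl⟩ : dyadicCube (N y) y ∈ 𝒞) ⟨hy, mem_dyadicCube_self _ _⟩
  calc volume E ≤ volume (⋃ C ∈ 𝒞, E ∩ C) := measure_mono hsub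
    _ ≤ ∑' C : 𝒞, volume (E ∩ C) := measure_biUnion_le _ hcount _
    _ ≤ ∑' C : 𝒞, c * volume (C : Set (Fin s → ℝ)) := by
        refine ENNReal.tsum_le_tsum ?_
        rintro ⟨C, y, hy, rfl⟩
        exact hE y hy
    _ = c * ∑' C : 𝒞, volume (C : Set (Fin s → ℝ)) := ENNReal.tsum_mul_left
    _ = c * volume (⋃ C ∈ 𝒞, C) := by
        have hm : ∀ C ∈ 𝒞, MeasurableSet (id C) := by
          rintro C ⟨y, -, rfl⟩
          exact measurableSet_dyadicCube _ _
        exact congrArg (c * ·) (measure_biUnion hcount hdisj hm).symm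
    _ ≤ c * volume B := by
        gcongr
        refine Set.iUnion₂_subset ?_
        rintro C ⟨y, hy, rfl⟩
        exact hB y hy

/-- A point `x` is marked by a flag in `S`: `F ⊆ S` is a chain on which `ε ≤ ψ ≤ ρ`, while
`ρ ≤ ψ` on all further elements of `S` comparable to every element of `F`. -/
def IsMarked {P X : Type*} [PartialOrder P] (ψ : P → X → ℝ) (ε ρ : ℝ) (S : Set P) (x : X) : Prop :=
  ∃ F : Set P, F.Finite ∧ F ⊆ S ∧ IsChain (· ≤ ·) F ∧ (∀ U ∈ F, ε ≤ ψ U x ∧ ψ U x ≤ ρ) ∧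
    ∀ U ∈ S, U ∉ F → (∀ W ∈ F, U ≤ W ∨ W ≤ U) → ρ ≤ ψ U x

theorem isMarked_of_comparable {P X : Type*} [PartialOrder P] {ψ : P → X → ℝ} {ε ρ : ℝ} {S : Set P}
    {x : X} {U₀ : P} (hU₀ : U₀ ∈ S) (h1 : ε ≤ ψ U₀ x) (h2 : ψ U₀ x ≤ ρ)
    (h : IsMarked ψ ε ρ {U ∈ S | U ≠ U₀ ∧ (U ≤ U₀ ∨ U₀ ≤ U)} x) : IsMarked ψ ε ρ S x := by
  obtain ⟨F, hfin, hFS, hchain, hF, hcomp⟩ := h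
  refine ⟨insert U₀ F, hfin.insert _, ?_, ?_, ?_, ?_⟩
  · exact Set.insert_subset hU₀ fun U hU => (hFS hU).1
  · exact hchain.insert fun b hb _ => (hFS hb).2.2.symm
  · rintro U (rfl | hU)
    · exact ⟨h1, h2⟩
    · exact hF U hU
  · intro U hU hUF hUc
    rw [Set.mem_insert_iff, not_or] at hUF
    exact hcomp U ⟨hU, hUF.1, hUc U₀ (Set.mem_insert _ _)⟩ hUF.2
      fun W hW => hUc W (Set.mem_insert_of_mem _ hW)

/-- Constants in the quantitative nondivergence estimate. -/
noncomputable def nondivConst (s : ℕ) : ℕ → ENNReal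
  | 0 => 0
  | r + 1 => 2 ^ s * (1 + nondivConst s r)

theorem nondivConst_ne_top (s r : ℕ) : nondivConst s r ≠ ⊤ := by
  induction r with
  | zero => simp [nondivConst]
  | succ r ih =>
    exact ENNReal.mul_ne_top (by simp) (ENNReal.add_ne_top.2 ⟨by simp, ih⟩)

theorem volume_not_isMarked_le {s : ℕ} {P : Type*} [PartialOrder P] (rk : P → ℕ)
    (hrk : ∀ U W : P, U ≤ W → rk U = rk W → U = W)
    (ψ : P → (Fin s → ℝ) → ℝ) (hψ : ∀ U, Continuous (ψ U)) {ε ρ : ℝ} {D : ENNReal}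
    (hgood : ∀ (U : P) (l : ℕ) (x : Fin s → ℝ), (∃ y ∈ dyadicCube l x, ρ ≤ ψ U y) →
      volume {y ∈ dyadicCube l x | ψ U y < ε} ≤ D * volume (dyadicCube l x))
    (r : ℕ) : ∀ (R : Finset ℕ), R.card = r → ∀ S : Set P, (∀ U ∈ S, rk U ∈ R) →
    ∀ (l : ℕ) (x : Fin s → ℝ), (∀ U ∈ S, ∃ y ∈ dyadicCube l x, ρ ≤ ψ U y) →
      volume {y ∈ dyadicCube l x | ¬ IsMarked ψ ε ρ S y} ≤
        nondivConst s r * D * volume (dyadicCube l x) := by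
  induction r with
  | zero =>
    intro R hR S hS l x _
    rw [Finset.card_eq_zero] at hR
    have hSe : ∀ U, U ∉ S := fun U hU => by simpa [hR] using hS U hU
    have : {y ∈ dyadicCube l x | ¬ IsMarked ψ ε ρ S y} = ∅ := by
      refine Set.eq_empty_iff_forall_notMem.2 fun y hy => hy.2 ?_
      exact ⟨∅, Set.finite_empty, Set.empty_subset _, IsChain.empty, by simp,
        fun U hU => absurd hU (hSe U)⟩
    rw [this]
    simp
  | succ r ih =>
    intro R hR S hS l x hsup
    set p : ℕ → (Fin s → ℝ) → Prop := fun l' y => ∃ U ∈ S, ∀ z ∈ dyadicCube l' y, ψ U z < ρ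
      with hp
    set E := {y ∈ dyadicCube l x | ¬ IsMarked ψ ε ρ S y} with hEdef
    have hpex : ∀ y ∈ E, ∃ l', p l' y := by
      rintro y ⟨hyx, hy⟩
      have : ∃ U ∈ S, ψ U y < ρ := by
        by_contra! hcon
        exact hy ⟨∅, Set.finite_empty, Set.empty_subset _, IsChain.empty, by simp,
          fun U hU _ _ => hcon U hU⟩
      obtain ⟨U, hU, hUy⟩ := this
      obtain ⟨l', hl'⟩ := exists_dyadicCube_subset
        (isOpen_lt (hψ U) continuous_const : IsOpen {z | ψ U z < ρ}) hUy
      exact ⟨l', U, hU, fun z hz => hl' hz⟩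
    set N : (Fin s → ℝ) → ℕ := fun y => sInf {l' | p l' y} with hNdef
    have hNp : ∀ y ∈ E, p (N y) y := fun y hy => Nat.sInf_mem (hpex y hy)
    have hNmin : ∀ y, ∀ l' < N y, ¬ p l' y := fun y l' h => Nat.notMem_of_lt_sInf h
    have hNl : ∀ y ∈ E, l < N y := by
      intro y hy
      by_contra! hle
      obtain ⟨U, hU, hUlt⟩ := hNp y hy
      obtain ⟨z, hz, hzρ⟩ := hsup U hU
      rw [← dyadicCube_eq_of_mem hy.1] at hz
      exact absurd (hUlt z (dyadicCube_antitone y hle hz)) (not_lt.2 hzρ)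
    refine volume_le_of_dyadicCubes N ?_ ?_ ?_
    · intro y hy z hz
      have hcong : ∀ l' ≤ N y, (p l' z ↔ p l' y) := by
        intro l' hl'
        have : dyadicCube l' z = dyadicCube l' y :=
          dyadicCube_eq_of_mem (dyadicCube_antitone y hl' hz)
        simp only [hp, this]
      apply le_antisymm
      · exact Nat.sInf_le ((hcong _ le_rfl).2 (hNp y hy))
      · by_contra! hlt
        have hex : ∃ l', p l' z := ⟨N y, (hcong _ le_rfl).2 (hNp y hy)⟩
        have hmem : p (N z) z := Nat.sInf_mem hex
        exact hNmin y _ hlt ((hcong _ hlt.le).1 hmem)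
    · intro y hy
      rw [← dyadicCube_eq_of_mem hy.1]
      exact dyadicCube_antitone y (hNl y hy).le
    · intro y hy
      obtain ⟨U₀, hU₀, hlt⟩ := hNp y hy
      obtain ⟨q, hq⟩ : ∃ q, N y = q + 1 := Nat.exists_eq_succ_of_ne_zero
        (Nat.ne_of_gt (lt_of_le_of_lt (Nat.zero_le _) (hNl y hy)))
      have hpar : ∀ U ∈ S, ∃ z ∈ dyadicCube q y, ρ ≤ ψ U z := by
        have := hNmin y q (by omega)
        intro U hU
        by_contra! hcon
        exact this ⟨U, hU, hcon⟩
      set S' := {U ∈ S | U ≠ U₀ ∧ (U ≤ U₀ ∨ U₀ ≤ U)} with hS'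
      have hrec := ih (R.erase (rk U₀)) (by rw [Finset.card_erase_of_mem (hS U₀ hU₀), hR]; rfl) S'
        (by
          rintro U ⟨hU, hne, hcomp⟩
          refine Finset.mem_erase.2 ⟨fun heq => hne ?_, hS U hU⟩
          rcases hcomp with h | h
          · exact hrk _ _ h heq
          · exact (hrk _ _ h heq.symm).symm) q y (fun U hU => hpar U hU.1)
      have hsub : E ∩ dyadicCube (N y) y ⊆ {z ∈ dyadicCube q y | ψ U₀ z < ε} ∪
          {z ∈ dyadicCube q y | ¬ IsMarked ψ ε ρ S' z} := by
        rintro z ⟨hzE, hz⟩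
        have hzq : z ∈ dyadicCube q y := dyadicCube_antitone y (by omega : q ≤ N y) hz
        by_cases hε : ψ U₀ z < ε
        · exact Or.inl ⟨hzq, hε⟩
        · exact Or.inr ⟨hzq, fun hm => hzE.2 (isMarked_of_comparable hU₀ (not_lt.1 hε) (hlt z hz).le hm)⟩
      calc volume (E ∩ dyadicCube (N y) y)
          ≤ volume {z ∈ dyadicCube q y | ψ U₀ z < ε} +
            volume {z ∈ dyadicCube q y | ¬ IsMarked ψ ε ρ S' z} :=
            (measure_mono hsub).trans (measure_union_le _ _)
        _ ≤ D * volume (dyadicCube q y) + nondivConst s r * D * volume (dyadicCube q y) :=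
            add_le_add (hgood U₀ q y (hpar U₀ hU₀)) hrec
        _ = nondivConst s (r + 1) * D * volume (dyadicCube (N y) y) := by
            rw [hq, volume_dyadicCube_parent, nondivConst]
            ring

theorem volume_update_preimage_le {s : ℕ} (a : Fin s → ℝ) (i : Fin s) (ha : a i ≠ 0)
    (B : Set (Fin s → ℝ)) :
    volume {y : Fin s → ℝ | Function.update y i (∑ k, a k * y k) ∈ B} =
      ENNReal.ofReal |(a i)⁻¹| * volume B := by
  set M : Matrix (Fin s) (Fin s) ℝ := Matrix.updateRow 1 i a with hM
  have hdet : LinearMap.det (Matrix.toLin' M) = a i := by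
    rw [LinearMap.det_toLin', hM, ← Matrix.cramer_transpose_apply, Matrix.transpose_one,
      Matrix.cramer_one]
    rfl
  have := Measure.addHaar_preimage_linearMap volume (f := Matrix.toLin' M) (by rwa [hdet]) B
  rw [hdet] at this
  rw [← this]
  congr 1
  ext y
  simp only [Set.mem_ofPred_eq, Set.mem_preimage, Matrix.toLin'_apply]
  have : M.mulVec y = Function.update y i (∑ k, a k * y k) := by
    ext k
    by_cases hk : k = i
    · subst hk; simp [hM, Matrix.mulVec, dotProduct]
    · simp [hM, Matrix.mulVec, dotProduct, hk, Matrix.one_apply]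
  rw [this]

theorem volume_abs_affine_lt_le {s : ℕ} (c : Fin (s + 1) → ℝ) (l : ℕ) (x : Fin s → ℝ) {ε ρ : ℝ}
    (hε : 0 < ε) (hρ : 0 < ρ)
    (h : ∃ y ∈ dyadicCube l x, ρ ≤ |∑ i, (Fin.cons 1 y : Fin (s + 1) → ℝ) i * c i|) :
    volume {y ∈ dyadicCube l x | |∑ i, (Fin.cons 1 y : Fin (s + 1) → ℝ) i * c i| < ε} ≤
      ENNReal.ofReal ((4 * s + 2) * (ε / ρ)) * volume (dyadicCube l x) := by
  simp only [Fin.sum_univ_succ, Fin.cons_zero, Fin.cons_succ, one_mul] at h ⊢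
  obtain ⟨y₀, hy₀, hy₀ρ⟩ := h
  by_cases hcase : ρ ≤ 2 * ε
  · have h1 : (1 : ENNReal) ≤ ENNReal.ofReal ((4 * s + 2) * (ε / ρ)) := by
      rw [ENNReal.one_le_ofReal, ← mul_div_assoc, le_div_iff₀ hρ]
      have : (0 : ℝ) ≤ s * ε := by positivity
      linarith
    calc _ ≤ volume (dyadicCube l x) := measure_mono fun y hy => hy.1
      _ ≤ _ := le_mul_of_one_le_left zero_le h1
  push Not at hcase
  set E := {y ∈ dyadicCube l x | |c 0 + ∑ i : Fin s, y i * c i.succ| < ε} with hE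
  rcases E.eq_empty_or_nonempty with h0 | ⟨y₁, hy₁, hy₁ε⟩
  · rw [h0]; simp
  set r : ℝ := ((2 : ℝ) ^ l)⁻¹ with hr
  have hrpos : 0 < r := by positivity
  obtain ⟨i, hi⟩ : ∃ i : Fin s, ρ / 2 ≤ s * (|c i.succ| * r) := by
    by_contra! hcon
    have hd : ρ / 2 < |∑ i : Fin s, (y₀ i - y₁ i) * c i.succ| := by
      have e : ∑ i : Fin s, (y₀ i - y₁ i) * c i.succ =
          (c 0 + ∑ i : Fin s, y₀ i * c i.succ) - (c 0 + ∑ i : Fin s, y₁ i * c i.succ) := by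
        simp only [sub_mul, Finset.sum_sub_distrib]; ring
      rw [e]
      have := abs_sub_abs_le_abs_sub (c 0 + ∑ i : Fin s, y₀ i * c i.succ)
        (c 0 + ∑ i : Fin s, y₁ i * c i.succ)
      linarith
    have hle : |∑ i : Fin s, (y₀ i - y₁ i) * c i.succ| ≤ ∑ i : Fin s, |c i.succ| * r := by
      refine (Finset.abs_sum_le_sum_abs _ _).trans (Finset.sum_le_sum fun i _ => ?_)
      rw [abs_mul, mul_comm]
      gcongr
      rw [← dyadicCube_eq_of_mem hy₁] at hy₀
      exact abs_sub_le_of_mem_dyadicCube hy₀ i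
    rcases Nat.eq_zero_or_pos s with hs | hs
    · subst hs
      simp at hd
      linarith
    · have hs' : (0 : ℝ) < s := by exact_mod_cast hs
      have : ∑ i : Fin s, |c i.succ| * r ≤ ∑ i : Fin s, ρ / 2 / s :=
        Finset.sum_le_sum fun i _ => by
          rw [le_div_iff₀ hs', mul_comm]
          exact (hcon i).le
      rw [Finset.sum_const, Finset.card_univ, Fintype.card_fin, nsmul_eq_mul,
        mul_div_cancel₀ _ hs'.ne'] at this
      linarith
  have hcpos : 0 < |c i.succ| := by
    by_contra! h0
    have : |c i.succ| = 0 := le_antisymm h0 (abs_nonneg _)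
    rw [this] at hi
    simp at hi
    linarith
  set lo : Fin s → ℝ := Function.update (fun k => (⌊2 ^ l * x k⌋ : ℝ) / 2 ^ l) i (-ε - c 0)
  set hi' : Fin s → ℝ := Function.update (fun k => ((⌊2 ^ l * x k⌋ : ℝ) + 1) / 2 ^ l) i (ε - c 0)
  set B : Set (Fin s → ℝ) := Set.pi Set.univ fun k => Set.Ico (lo k) (hi' k) with hB
  have hsub : E ⊆ {y : Fin s → ℝ | Function.update y i (∑ k, c k.succ * y k) ∈ B} := by
    rintro y ⟨hy, hyε⟩ k -
    rw [dyadicCube_eq_pi] at hy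
    by_cases hk : k = i
    · subst hk
      simp only [lo, hi', Function.update_self]
      rw [abs_lt] at hyε
      simp only [mul_comm (c _)]
      constructor <;> linarith
    · simp only [lo, hi', Function.update_of_ne hk]
      exact hy k (Set.mem_univ _)
  have hBvol : volume B = ENNReal.ofReal (2 * ε * r ^ (s - 1)) := by
    rw [hB, Real.volume_pi_Ico]
    have : ∀ k, ENNReal.ofReal (hi' k - lo k) =
        Function.update (fun _ => ENNReal.ofReal r) i (ENNReal.ofReal (2 * ε)) k := by
      intro k
      by_cases hk : k = i
      · subst hk
        simp only [lo, hi', Function.update_self]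
        congr 1; ring
      · simp only [lo, hi', Function.update_of_ne hk]
        congr 1; rw [hr]; ring
    simp only [this]
    rw [Finset.prod_update_of_mem (Finset.mem_univ _), Finset.prod_const,
      ENNReal.ofReal_mul (p := 2 * ε) (by positivity), ENNReal.ofReal_pow hrpos.le]
    congr 2
    rw [Finset.card_sdiff_of_subset (Finset.subset_univ _)]
    simp
  have hs : s = (s - 1) + 1 := by have := i.pos; omega
  calc volume E ≤ _ := measure_mono hsub
    _ = ENNReal.ofReal |(c i.succ)⁻¹| * volume B :=
      volume_update_preimage_le (fun k => c k.succ) i (abs_pos.1 hcpos) B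
    _ ≤ _ := by
      rw [hBvol, volume_dyadicCube, ← ENNReal.ofReal_mul (by positivity),
        ← ENNReal.ofReal_mul (by positivity)]
      refine ENNReal.ofReal_le_ofReal ?_
      have e : r ^ s = r ^ (s - 1) * r := by rw [← pow_succ, ← hs]
      rw [← hr, e, abs_inv]
      have h1 : |c i.succ|⁻¹ ≤ 2 * s * r / ρ := by
        rw [inv_le_iff_one_le_mul₀ hcpos, div_mul_eq_mul_div, le_div_iff₀ hρ]
        linarith
      calc |c i.succ|⁻¹ * (2 * ε * r ^ (s - 1))
          ≤ 2 * s * r / ρ * (2 * ε * r ^ (s - 1)) := by gcongr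
        _ = 4 * s * (ε / ρ) * (r ^ (s - 1) * r) := by ring
        _ ≤ (4 * s + 2) * (ε / ρ) * (r ^ (s - 1) * r) := by gcongr; linarith

/-- The minor of the matrix with rows `v` on the columns `σ`. -/
def colMinor {R : Type*} [CommRing R] {j k : ℕ} (v : Fin j → Fin k → R) (σ : Fin j → Fin k) : R :=
  (Matrix.of fun a b => v a (σ b)).det

/-- The largest absolute value of a maximal minor. -/
noncomputable def minorNorm {j k : ℕ} (v : Fin j → Fin k → ℝ) : ℝ := ‖colMinor v‖

theorem abs_colMinor_le {j k : ℕ} (v : Fin j → Fin k → ℝ) (σ : Fin j → Fin k) :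
    |colMinor v σ| ≤ minorNorm v := norm_le_pi_norm (colMinor v) σ

theorem minorNorm_nonneg {j k : ℕ} (v : Fin j → Fin k → ℝ) : 0 ≤ minorNorm v := norm_nonneg _

theorem exists_abs_colMinor_eq {j k : ℕ} [NeZero k] (v : Fin j → Fin k → ℝ) :
    ∃ σ, |colMinor v σ| = minorNorm v := by
  obtain ⟨σ, -, hσ⟩ := Finset.exists_max_image Finset.univ (fun σ => |colMinor v σ|)
    Finset.univ_nonempty
  refine ⟨σ, le_antisymm (abs_colMinor_le v σ) ?_⟩
  exact (pi_norm_le_iff_of_nonneg (abs_nonneg _)).2 fun τ => hσ τ (Finset.mem_univ _)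

theorem minorNorm_linear_comb {j k : ℕ} (M : Matrix (Fin j) (Fin j) ℝ) (v : Fin j → Fin k → ℝ) :
    minorNorm (fun a => ∑ b, M a b • v b) = |M.det| * minorNorm v := by
  have : colMinor (fun a => ∑ b, M a b • v b) = M.det • colMinor v := by
    ext σ
    rw [Pi.smul_apply, smul_eq_mul, colMinor, colMinor, ← Matrix.det_mul]
    congr 1
    ext a b
    simp [Matrix.mul_apply]
  rw [minorNorm, this, norm_smul, Real.norm_eq_abs, minorNorm]

theorem minorNorm_cons_le {j k : ℕ} (u : Fin k → ℝ) (v : Fin j → Fin k → ℝ) :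
    minorNorm (Fin.cons u v : Fin (j + 1) → Fin k → ℝ) ≤ (j + 1) * ‖u‖ * minorNorm v := by
  have h0 : 0 ≤ (j + 1) * ‖u‖ * minorNorm v := by
    have := minorNorm_nonneg v
    positivity
  refine (pi_norm_le_iff_of_nonneg h0).2 fun σ => ?_
  rw [colMinor, Matrix.det_succ_row_zero, Real.norm_eq_abs]
  refine (Finset.abs_sum_le_sum_abs _ _).trans ?_
  have : ∀ b ∈ (Finset.univ : Finset (Fin (j + 1))),
      |(-1) ^ (b : ℕ) * (Matrix.of fun a b => (Fin.cons u v : Fin (j + 1) → Fin k → ℝ) a (σ b)) 0 b *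
        ((Matrix.of fun a b => (Fin.cons u v : Fin (j + 1) → Fin k → ℝ) a (σ b)).submatrix
          Fin.succ b.succAbove).det| ≤ ‖u‖ * minorNorm v := by
    intro b _
    rw [abs_mul, abs_mul, abs_pow, abs_neg, abs_one, one_pow, one_mul]
    refine mul_le_mul (norm_le_pi_norm u (σ b)) ?_ (abs_nonneg _) (norm_nonneg _)
    exact abs_colMinor_le v (σ ∘ b.succAbove)
  refine (Finset.sum_le_sum this).trans (le_of_eq ?_)
  simp
  ring

theorem exists_colMinor_ne_zero {K : Type*} [Field K] {j k : ℕ} {v : Fin j → Fin k → K}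
    (hv : LinearIndependent K v) : ∃ σ, colMinor v σ ≠ 0 := by
  set V : Matrix (Fin j) (Fin k) K := Matrix.of v
  obtain ⟨κ, a, ha, hspan, hli⟩ := exists_linearIndependent' K V.col
  have hrank : Module.finrank K (Submodule.span K (Set.range V.col)) = j := by
    rw [← Matrix.rank_eq_finrank_span_cols]
    simpa using LinearIndependent.rank_matrix (M := V) hv
  have : Finite κ := Finite.of_injective a ha
  have : Fintype κ := Fintype.ofFinite κ
  have hcard : Fintype.card κ = j := by
    rw [← hrank, ← hspan, finrank_span_eq_card hli]
  let e : Fin j ≃ κ := (Fintype.equivFinOfCardEq hcard).symm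
  refine ⟨a ∘ e, ?_⟩
  have h2 : LinearIndependent K (fun b => (Matrix.of fun c b => v c ((a ∘ e) b)).col b) :=
    hli.comp e e.injective
  have h3 := Matrix.linearIndependent_cols_iff_isUnit.1 h2
  exact ((Matrix.isUnit_iff_isUnit_det _).1 h3).ne_zero

theorem colMinor_intCast {R : Type*} [CommRing R] {j k : ℕ} (v : Fin j → Fin k → ℤ)
    (σ : Fin j → Fin k) : colMinor (fun a i => (v a i : R)) σ = ((colMinor v σ : ℤ) : R) :=
  (RingHom.map_det (Int.castRingHom R) _).symm

theorem exists_colMinor_intCast_ne_zero {j k : ℕ} {v : Fin j → Fin k → ℤ}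
    (hv : LinearIndependent ℤ v) : ∃ σ, colMinor v σ ≠ 0 := by
  have h1 : LinearIndependent ℤ (fun a i => (v a i : ℚ)) := by
    have hinj : Function.Injective ((Int.castAddHom ℚ).toIntLinearMap.compLeft (Fin k)) := by
      intro x y hxy
      ext i
      have := congrFun hxy i
      simpa using this
    exact hv.map_injOn _ hinj.injOn
  rw [LinearIndependent.iff_fractionRing ℤ ℚ] at h1
  obtain ⟨σ, hσ⟩ := exists_colMinor_ne_zero h1
  refine ⟨σ, fun h0 => hσ ?_⟩
  rw [colMinor_intCast, h0, Int.cast_zero]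

/-- Minkowski's theorem: a lattice spanned by vectors all of whose maximal minors are small
contains a short nonzero vector. -/
theorem exists_short_linear_comb {j k : ℕ} [NeZero k] (hj : 1 ≤ j) (v : Fin j → Fin k → ℝ)
    (hv : 0 < minorNorm v) :
    ∃ c : Fin j → ℤ, c ≠ 0 ∧
      ∀ i, |∑ a, (c a : ℝ) * v a i| ≤ j * (minorNorm v) ^ ((1 : ℝ) / j) := by
  obtain ⟨σ, hσ⟩ := exists_abs_colMinor_eq v
  set M : Matrix (Fin j) (Fin j) ℝ := Matrix.of fun a b => v a (σ b) with hM
  set δ := minorNorm v with hδ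
  have hMdet : |M.det| = δ := hσ
  have hdet : M.det ≠ 0 := by
    intro h0
    rw [h0, abs_zero] at hMdet
    exact hv.ne hMdet
  set R : ℝ := δ ^ ((1 : ℝ) / j) with hR
  have hRpos : 0 < R := Real.rpow_pos_of_pos hv _
  have hRpow : R ^ j = δ := by
    rw [hR, one_div, Real.rpow_inv_natCast_pow hv.le (by omega)]
  have hjne : Nonempty (Fin j) := ⟨⟨0, hj⟩⟩
  have hli : LinearIndependent ℝ (fun a => M a) :=
    Matrix.linearIndependent_rows_iff_isUnit.2
      ((Matrix.isUnit_iff_isUnit_det _).2 (isUnit_iff_ne_zero.2 hdet))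
  let b : Module.Basis (Fin j) ℝ (Fin j → ℝ) :=
    basisOfLinearIndependentOfCardEqFinrank hli (by simp)
  have hb : ∀ a, b a = M a := fun a => by simp [b]
  have hvol : volume (ZSpan.fundamentalDomain b) = ENNReal.ofReal δ := by
    rw [ZSpan.volume_fundamentalDomain, ← hMdet]
    congr 3
    ext a c
    simp [hb]
  have : Countable (Submodule.span ℤ (Set.range b)).toAddSubgroup :=
    inferInstanceAs (Countable (Submodule.span ℤ (Set.range b)))
  have : DiscreteTopology (Submodule.span ℤ (Set.range b)).toAddSubgroup :=
    inferInstanceAs (DiscreteTopology (Submodule.span ℤ (Set.range b)))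
  obtain ⟨⟨x, hx⟩, hx0, hxs⟩ := exists_ne_zero_mem_lattice_of_measure_mul_two_pow_le_measure
    (μ := volume) (ZSpan.isAddFundamentalDomain' b volume)
    (s := Metric.closedBall (0 : Fin j → ℝ) R)
    (fun x hx => by simpa using hx) (convex_closedBall _ _) (isCompact_closedBall _ _)
    (by
      rw [hvol, Real.volume_pi_closedBall _ hRpos.le, mul_pow, Fintype.card_fin, hRpow,
        Module.finrank_fin_fun, mul_comm, ENNReal.ofReal_mul (by positivity),
        ENNReal.ofReal_pow (by positivity)]
      simp)
  have hx' : x ∈ Submodule.span ℤ (Set.range b) := hx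
  obtain ⟨c, hc⟩ := (Submodule.mem_span_range_iff_exists_fun ℤ).1 hx'
  refine ⟨c, ?_, ?_⟩
  · rintro rfl
    apply hx0
    ext1
    simpa using hc.symm
  · have hcoord : ∀ d, |∑ a, (c a : ℝ) * M a d| ≤ R := by
      intro d
      have h1 : x d = ∑ a, (c a : ℝ) * M a d := by
        rw [← hc, Finset.sum_apply]
        exact Finset.sum_congr rfl fun a _ => by simp [hb]
      rw [← h1]
      have h2 := norm_le_pi_norm x d
      rw [mem_closedBall_zero_iff] at hxs
      exact h2.trans hxs
    intro i
    have hcram := Matrix.mulVec_cramer M (fun a => v a i)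
    have hle : ∀ d, |M.cramer (fun a => v a i) d| ≤ δ := by
      intro d
      rw [Matrix.cramer_apply]
      have : M.updateCol d (fun a => v a i) = Matrix.of fun a e => v a (Function.update σ d i e) := by
        ext a e
        by_cases he : e = d
        · subst he; simp
        · simp [he, hM]
      rw [this]
      exact abs_colMinor_le v _
    have hsum : M.det * ∑ a, (c a : ℝ) * v a i =
        ∑ d, (∑ a, (c a : ℝ) * M a d) * M.cramer (fun a => v a i) d := by
      rw [Finset.mul_sum]
      have : ∀ a, M.det * ((c a : ℝ) * v a i) =
          ∑ d, (c a : ℝ) * M a d * M.cramer (fun a => v a i) d := by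
        intro a
        have := congrFun hcram a
        simp only [Matrix.mulVec, dotProduct, Pi.smul_apply, smul_eq_mul] at this
        rw [mul_left_comm, ← this, Finset.mul_sum]
        exact Finset.sum_congr rfl fun d _ => by ring
      rw [Finset.sum_congr rfl fun a _ => this a, Finset.sum_comm]
      exact Finset.sum_congr rfl fun d _ => by rw [Finset.sum_mul]
    have hfin : δ * |∑ a, (c a : ℝ) * v a i| ≤ δ * (j * R) := by
      rw [← hMdet, ← abs_mul, hsum, hMdet]
      refine (Finset.abs_sum_le_sum_abs _ _).trans ?_
      have : ∀ d ∈ (Finset.univ : Finset (Fin j)),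
          |(∑ a, (c a : ℝ) * M a d) * M.cramer (fun a => v a i) d| ≤ R * δ := by
        intro d _
        rw [abs_mul]
        exact mul_le_mul (hcoord d) (hle d) (abs_nonneg _) hRpos.le
      refine (Finset.sum_le_sum this).trans (le_of_eq ?_)
      simp
      ring
    exact le_of_mul_le_mul_left hfin hv

theorem colMinor_eq_zero_of_not_injective {R : Type*} [CommRing R] {j k : ℕ}
    (v : Fin j → Fin k → R) {σ : Fin j → Fin k} (hσ : ¬ Function.Injective σ) :
    colMinor v σ = 0 := by
  simp only [Function.Injective, not_forall] at hσ
  obtain ⟨a, b, hab, hne⟩ := hσ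
  exact Matrix.det_zero_of_column_eq hne fun c => by simp [hab]

theorem colMinor_comp_perm {R : Type*} [CommRing R] {j k : ℕ} (v : Fin j → Fin k → R)
    (σ : Fin j → Fin k) (π : Equiv.Perm (Fin j)) :
    colMinor v (σ ∘ π) = (Equiv.Perm.sign π : ℤ) * colMinor v σ :=
  Matrix.det_permute' π (Matrix.of fun a b => v a (σ b))

theorem exists_abs_colMinor_eq_orderEmbOfFin {j k : ℕ} (v : Fin j → Fin k → ℝ)
    {σ : Fin j → Fin k} (hσ : Function.Injective σ) :
    ∃ (I : Finset (Fin k)) (h : I.card = j), |colMinor v σ| = |colMinor v (I.orderEmbOfFin h)| := by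
  have h : (Finset.univ.image σ).card = j := by
    rw [Finset.card_image_of_injective _ hσ, Finset.card_univ, Fintype.card_fin]
  refine ⟨Finset.univ.image σ, h, ?_⟩
  set g : Fin j → Fin j := fun b => ((Finset.univ.image σ).orderIsoOfFin h).symm
    ⟨σ b, Finset.mem_image_of_mem _ (Finset.mem_univ _)⟩
  have hg : Function.Injective g := by
    intro a b hab
    have := (OrderIso.injective _) hab
    exact hσ (by simpa using this)
  let π : Equiv.Perm (Fin j) := Equiv.ofBijective g (Finite.injective_iff_bijective.1 hg)
  have hcomp : σ = (Finset.univ.image σ).orderEmbOfFin h ∘ π := by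
    ext1 b
    simp [π, g, ← Finset.coe_orderIsoOfFin_apply]
  conv_lhs => rw [hcomp, colMinor_comp_perm]
  rw [abs_mul, ← Int.cast_abs]
  have : |((Equiv.Perm.sign π : ℤˣ) : ℤ)| = 1 := Int.isUnit_iff_abs_eq.1 (Units.isUnit _)
  rw [this, Int.cast_one, one_mul]

theorem minorDet_eq_colMinor {j k : ℕ} (v : Fin j → Fin k → ℤ) {I : Finset (Fin k)}
    (h : I.card = j) : minorDet v I = colMinor v (I.orderEmbOfFin h) := by
  rw [minorDet, dif_pos h]
  rfl

theorem orderEmbOfFin_zero_eq_zero {j k : ℕ} {I : Finset (Fin (k + 1))} (h : I.card = j + 1)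
    (h0 : 0 ∈ I) : I.orderEmbOfFin h 0 = 0 := by
  have := Finset.orderEmbOfFin_zero h (Nat.succ_pos j)
  refine this.trans (le_antisymm (Finset.min'_le _ _ h0) (Fin.zero_le _))

theorem colMinor_update_eq_cIw {j k : ℕ} (v : Fin (j + 1) → Fin (k + 1) → ℤ)
    {w : Finset (Fin (k + 1)) → ℝ} (hw : ∀ I, w I = (minorDet v I : ℝ))
    {I : Finset (Fin (k + 1))} (h : I.card = j + 1) (h0 : 0 ∈ I) (i : Fin (k + 1)) :
    ((colMinor v (Function.update (I.orderEmbOfFin h) 0 i) : ℤ) : ℝ) = cIw w I i := by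
  have hz := orderEmbOfFin_zero_eq_zero h h0
  rw [cIw]
  split_ifs with hi0 hiI
  · rw [hw, minorDet_eq_colMinor v h, hi0]
    congr 2
    rw [← hz, Function.update_eq_self]
  · obtain ⟨b, hb⟩ : ∃ b, I.orderEmbOfFin h b = i := by
      have : i ∈ Set.range (I.orderEmbOfFin h) := by rw [Finset.range_orderEmbOfFin]; exact hiI
      exact this
    have hb0 : b ≠ 0 := by rintro rfl; exact hi0 (hb.symm.trans hz)
    rw [colMinor_eq_zero_of_not_injective, Int.cast_zero]
    intro hinj
    refine hb0 (hinj ?_)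
    rw [Function.update_self, Function.update_of_ne hb0, hb]
  · set J := (insert i I).erase 0 with hJ
    have hJcard : J.card = j + 1 := by
      rw [hJ, Finset.card_erase_of_mem (Finset.mem_insert_of_mem h0),
        Finset.card_insert_of_notMem hiI, h]
      rfl
    have hiJ : i ∈ J := Finset.mem_erase.2 ⟨hi0, Finset.mem_insert_self _ _⟩
    obtain ⟨l, hl⟩ : ∃ l, J.orderEmbOfFin hJcard l = i := by
      have : i ∈ Set.range (J.orderEmbOfFin hJcard) := by
        rw [Finset.range_orderEmbOfFin]; exact hiJ
      exact this
    have hI0 : (I.erase 0).card = j := by rw [Finset.card_erase_of_mem h0, h]; rfl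
    have e1 : (fun b : Fin j => I.orderEmbOfFin h b.succ) = (I.erase 0).orderEmbOfFin hI0 := by
      refine Finset.orderEmbOfFin_unique hI0 (fun b => ?_) fun a b hab => ?_
      · refine Finset.mem_erase.2 ⟨fun hb => ?_, Finset.orderEmbOfFin_mem _ _ _⟩
        rw [← hz] at hb
        exact Fin.succ_ne_zero _ ((I.orderEmbOfFin h).injective hb)
      · exact (I.orderEmbOfFin h).strictMono (Fin.succ_lt_succ_iff.2 hab)
    have e2 : (fun b : Fin j => J.orderEmbOfFin hJcard (l.succAbove b)) =
        (I.erase 0).orderEmbOfFin hI0 := by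
      refine Finset.orderEmbOfFin_unique hI0 (fun b => ?_) fun a b hab => ?_
      · have hm := Finset.mem_erase.1 (Finset.orderEmbOfFin_mem J hJcard (l.succAbove b))
        refine Finset.mem_erase.2 ⟨hm.1, (Finset.mem_insert.1 hm.2).resolve_left fun hb => ?_⟩
        exact Fin.succAbove_ne l b ((J.orderEmbOfFin hJcard).injective (hb.trans hl.symm))
      · exact (J.orderEmbOfFin hJcard).strictMono (Fin.strictMono_succAbove l hab)
    have e3 : Function.update (I.orderEmbOfFin h) 0 i =
        J.orderEmbOfFin hJcard ∘ (Fin.cycleRange l).symm := by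
      ext1 b
      refine Fin.cases ?_ (fun b => ?_) b
      · rw [Function.update_self, Function.comp_apply, Fin.cycleRange_symm_zero, hl]
      · rw [Function.update_of_ne (Fin.succ_ne_zero b), Function.comp_apply,
          Fin.cycleRange_symm_succ]
        exact congrFun (e1.trans e2.symm) b
    have e4 : lIi I i = (l : ℕ) := by
      rw [lIi, ← Fin.card_Iio l, ← Finset.card_map (J.orderEmbOfFin hJcard).toEmbedding]
      congr 1
      ext a
      simp only [Finset.mem_filter, Finset.mem_map, Finset.mem_Iio, RelEmbedding.coe_toEmbedding]
      constructor
      · rintro ⟨haI, ha0, hai⟩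
        have haJ : a ∈ J := Finset.mem_erase.2 ⟨ha0.ne', Finset.mem_insert_of_mem haI⟩
        have : a ∈ Set.range (J.orderEmbOfFin hJcard) := by
          rw [Finset.range_orderEmbOfFin]; exact haJ
        obtain ⟨b, rfl⟩ := this
        rw [← hl] at hai
        exact ⟨b, (J.orderEmbOfFin hJcard).lt_iff_lt.1 hai, rfl⟩
      · rintro ⟨b, hb, rfl⟩
        have hm := Finset.mem_erase.1 (Finset.orderEmbOfFin_mem J hJcard b)
        have hlt : J.orderEmbOfFin hJcard b < i := hl ▸ (J.orderEmbOfFin hJcard).strictMono hb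
        exact ⟨(Finset.mem_insert.1 hm.2).resolve_left hlt.ne, Fin.pos_iff_ne_zero.2 hm.1, hlt⟩
    rw [e3, colMinor_comp_perm, Equiv.Perm.sign_symm, Fin.sign_cycleRange, e4, hw,
      minorDet_eq_colMinor v hJcard]
    simp

/-- The action of `g_t u_y` on `ℝ^{n+1}`. -/
noncomputable def flow {n : ℕ} (t : ℝ) (y : Fin n → ℝ) (u : Fin (n + 1) → ℝ) : Fin (n + 1) → ℝ :=
  Fin.cons (Real.exp t * ∑ i, (Fin.cons 1 y : Fin (n + 1) → ℝ) i * u i)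
    (fun i => Real.exp (-t / n) * u i.succ)

theorem flow_sum_smul {n j : ℕ} (t : ℝ) (y : Fin n → ℝ) (c : Fin j → ℝ)
    (v : Fin j → Fin (n + 1) → ℝ) :
    flow t y (∑ a, c a • v a) = ∑ a, c a • flow t y (v a) := by
  ext i
  refine Fin.cases ?_ (fun i => ?_) i
  · simp only [flow, Fin.cons_zero, Finset.sum_apply, Pi.smul_apply, smul_eq_mul]
    simp only [Finset.mul_sum]
    rw [Finset.sum_comm]
    exact Finset.sum_congr rfl fun a _ => Finset.sum_congr rfl fun b _ => by ring
  · simp only [flow, Fin.cons_succ, Finset.sum_apply, Pi.smul_apply, smul_eq_mul, Finset.mul_sum]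
    exact Finset.sum_congr rfl fun a _ => by ring

theorem colMinor_flow_of_ne_zero {n j : ℕ} (t : ℝ) (y : Fin n → ℝ)
    (v : Fin j → Fin (n + 1) → ℝ) {σ : Fin j → Fin (n + 1)} (hσ : ∀ b, σ b ≠ 0) :
    colMinor (fun a => flow t y (v a)) σ = Real.exp (-((j : ℝ) / n) * t) * colMinor v σ := by
  have : (Matrix.of fun a b => flow t y (v a) (σ b)) =
      Matrix.of fun a b => Real.exp (-t / n) * (Matrix.of fun a b => v a (σ b)) a b := by
    ext a b
    obtain ⟨i, hi⟩ := Fin.exists_succ_eq.2 (hσ b)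
    simp [← hi, flow]
  rw [colMinor, this, Matrix.det_mul_row (fun _ => Real.exp (-t / n)), colMinor, Finset.prod_const,
    Finset.card_univ, Fintype.card_fin, ← Real.exp_nat_mul]
  congr 2
  ring

theorem colMinor_flow_of_eq_zero {n j : ℕ} (hn : n ≠ 0) (t : ℝ) (y : Fin n → ℝ)
    (v : Fin j → Fin (n + 1) → ℝ) {σ : Fin j → Fin (n + 1)} {b₀ : Fin j} (h0 : σ b₀ = 0)
    (hσ : ∀ b ≠ b₀, σ b ≠ 0) :
    colMinor (fun a => flow t y (v a)) σ = Real.exp ((((n : ℝ) + 1 - j) / n) * t) *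
      ∑ i, (Fin.cons 1 y : Fin (n + 1) → ℝ) i * colMinor v (Function.update σ b₀ i) := by
  set M : Matrix (Fin j) (Fin j) ℝ := Matrix.of fun a b => v a (σ b) with hM
  set M' : Matrix (Fin j) (Fin j) ℝ :=
    M.updateCol b₀ (fun a => ∑ i, (Fin.cons 1 y : Fin (n + 1) → ℝ) i * v a i) with hM'
  set d : Fin j → ℝ := Function.update (fun _ => Real.exp (-t / n)) b₀ (Real.exp t) with hd
  have e1 : (Matrix.of fun a b => flow t y (v a) (σ b)) = Matrix.of fun a b => d b * M' a b := by
    ext a b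
    by_cases hb : b = b₀
    · subst hb
      simp [h0, flow, hM', hd]
    · obtain ⟨i, hi⟩ := Fin.exists_succ_eq.2 (hσ b hb)
      simp [← hi, flow, hM', hd, hb, hM]
  have e2 : M'.det = ∑ i, (Fin.cons 1 y : Fin (n + 1) → ℝ) i *
      colMinor v (Function.update σ b₀ i) := by
    rw [hM', ← Matrix.cramer_apply]
    rw [← Matrix.sum_cramer_apply M Finset.univ
      (fun a i => (Fin.cons 1 y : Fin (n + 1) → ℝ) i * v a i) b₀]
    refine Finset.sum_congr rfl fun i _ => ?_
    have : (fun a => (Fin.cons 1 y : Fin (n + 1) → ℝ) i * v a i) =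
        (Fin.cons 1 y : Fin (n + 1) → ℝ) i • fun a => v a i := rfl
    rw [this, map_smul, Pi.smul_apply, smul_eq_mul, Matrix.cramer_apply, colMinor]
    congr 2
    ext a b
    by_cases hb : b = b₀
    · subst hb; simp
    · simp [hb, hM]
  have e3 : ∏ b, d b = Real.exp ((((n : ℝ) + 1 - j) / n) * t) := by
    rw [hd, Finset.prod_update_of_mem (Finset.mem_univ _), Finset.prod_const,
      Finset.card_sdiff_of_subset (Finset.subset_univ _), Finset.card_univ, Fintype.card_fin,
      Finset.card_singleton, ← Real.exp_nat_mul, ← Real.exp_add]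
    congr 1
    have hj : 1 ≤ j := by have := b₀.pos; omega
    have : (n : ℝ) ≠ 0 := by exact_mod_cast hn
    push_cast [hj]
    field_simp
    ring
  rw [colMinor, e1, Matrix.det_mul_row, e2, e3]

/-- The affine parametrization `x ↦ (x, x̃A)`. -/
def affineParam {s m : ℕ} (A : Matrix (Fin (s + 1)) (Fin m) ℝ) (x : Fin s → ℝ) :
    Fin (s + m) → ℝ :=
  Fin.append x (Matrix.vecMul (Fin.cons 1 x) A)

/-- The vector `c⁺ + A c⁻` attached to `c ∈ ℝ^{n+1}`. -/
def reduceVec {s m : ℕ} (A : Matrix (Fin (s + 1)) (Fin m) ℝ) (c : Fin (s + m + 1) → ℝ) :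
    Fin (s + 1) → ℝ := fun i =>
  c (Fin.castLE (by omega) i) +
    A.mulVec (fun r : Fin m => c (Fin.cast (by omega) (Fin.natAdd (s + 1) r))) i

theorem sum_affineParam_mul {s m : ℕ} (A : Matrix (Fin (s + 1)) (Fin m) ℝ) (x : Fin s → ℝ)
    (c : Fin (s + m + 1) → ℝ) :
    ∑ i, (Fin.cons 1 (affineParam A x) : Fin (s + m + 1) → ℝ) i * c i =
      ∑ i, (Fin.cons 1 x : Fin (s + 1) → ℝ) i * reduceVec A c i := by
  have h1 : ∑ i, (Fin.cons 1 x : Fin (s + 1) → ℝ) i *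
      A.mulVec (fun r : Fin m => c (Fin.cast (by omega) (Fin.natAdd (s + 1) r))) i =
      ∑ r, Matrix.vecMul (Fin.cons 1 x) A r * c (Fin.cast (by omega) (Fin.natAdd (s + 1) r)) :=
    Matrix.dotProduct_mulVec _ _ _
  simp only [reduceVec, mul_add, Finset.sum_add_distrib]
  rw [h1, Fin.sum_univ_succ, Fin.sum_univ_add, ← add_assoc]
  congr 1
  · rw [Fin.sum_univ_succ]
    simp only [Fin.cons_zero, Fin.cons_succ, affineParam, Fin.append_left]
    rfl
  · simp only [Fin.cons_succ, affineParam, Fin.append_right]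
    refine Finset.sum_congr rfl fun r _ => ?_
    congr 2
    ext
    simp
    omega

/-- The maximum in the criterion, at time `t`. -/
noncomputable def criterionMax {s m : ℕ} (A : Matrix (Fin (s + 1)) (Fin m) ℝ) (t : ℝ) (j : ℕ)
    (w : Finset (Fin (s + m + 1)) → ℝ) : ℝ :=
  max (Real.exp ((((s : ℝ) + m + 1 - j) / ((s : ℝ) + m)) * t) * maxNormA A j w)
    (Real.exp (-((j : ℝ) / ((s : ℝ) + m)) * t) * maxCoeff j w)

theorem norm_reduceVec_le_maxNormA {s m : ℕ} (A : Matrix (Fin (s + 1)) (Fin m) ℝ) {j : ℕ}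
    (w : Finset (Fin (s + m + 1)) → ℝ) {I : Finset (Fin (s + m + 1))} (h0 : 0 ∈ I)
    (h : I.card = j) : ‖reduceVec A (cIw w I)‖ ≤ maxNormA A j w :=
  le_ciSup (f := fun I : {I : Finset (Fin (s + m + 1)) // 0 ∈ I ∧ I.card = j} =>
    ‖reduceVec A (cIw w I.1)‖) (Set.finite_range _).bddAbove ⟨I, h0, h⟩

theorem abs_le_maxCoeff {n j : ℕ} (w : Finset (Fin (n + 1)) → ℝ) {I : Finset (Fin (n + 1))}
    (h0 : 0 ∉ I) (h : I.card = j) : |w I| ≤ maxCoeff j w :=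
  le_ciSup (f := fun I : {I : Finset (Fin (n + 1)) // 0 ∉ I ∧ I.card = j} => |w I.1|)
    (Set.finite_range _).bddAbove ⟨I, h0, h⟩

theorem maxNormA_nonneg {s m : ℕ} (A : Matrix (Fin (s + 1)) (Fin m) ℝ) (j : ℕ)
    (w : Finset (Fin (s + m + 1)) → ℝ) : 0 ≤ maxNormA A j w :=
  Real.iSup_nonneg fun _ => norm_nonneg _

theorem maxCoeff_nonneg {n : ℕ} (j : ℕ) (w : Finset (Fin (n + 1)) → ℝ) : 0 ≤ maxCoeff j w :=
  Real.iSup_nonneg fun _ => abs_nonneg _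

theorem exists_norm_reduceVec_eq_maxNormA {s m : ℕ} (A : Matrix (Fin (s + 1)) (Fin m) ℝ) {j : ℕ}
    (hj : 1 ≤ j) (hjn : j ≤ s + m) (w : Finset (Fin (s + m + 1)) → ℝ) :
    ∃ I : Finset (Fin (s + m + 1)), 0 ∈ I ∧ I.card = j ∧
      ‖reduceVec A (cIw w I)‖ = maxNormA A j w := by
  have : Nonempty {I : Finset (Fin (s + m + 1)) // 0 ∈ I ∧ I.card = j} := by
    obtain ⟨I, hI, -, hc⟩ := Finset.exists_subsuperset_card_eq
      (Finset.subset_univ ({0} : Finset (Fin (s + m + 1)))) (n := j) (by simpa using hj)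
      (by simp; omega)
    exact ⟨⟨I, hI (Finset.mem_singleton_self _), hc⟩⟩
  obtain ⟨I, hI⟩ := exists_eq_ciSup_of_finite
    (f := fun I : {I : Finset (Fin (s + m + 1)) // 0 ∈ I ∧ I.card = j} =>
      ‖reduceVec A (cIw w I.1)‖)
  exact ⟨I.1, I.2.1, I.2.2, hI⟩

theorem exists_abs_eq_maxCoeff {n j : ℕ} (hjn : j ≤ n) (w : Finset (Fin (n + 1)) → ℝ) :
    ∃ I : Finset (Fin (n + 1)), 0 ∉ I ∧ I.card = j ∧ |w I| = maxCoeff j w := by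
  have : Nonempty {I : Finset (Fin (n + 1)) // 0 ∉ I ∧ I.card = j} := by
    obtain ⟨I, hI, hc⟩ := Finset.exists_subset_card_eq
      (s := Finset.univ.erase (0 : Fin (n + 1))) (n := j) (by simpa using hjn)
    exact ⟨⟨I, fun h => Finset.notMem_erase _ _ (hI h), hc⟩⟩
  obtain ⟨I, hI⟩ := exists_eq_ciSup_of_finite
    (f := fun I : {I : Finset (Fin (n + 1)) // 0 ∉ I ∧ I.card = j} => |w I.1|)
  exact ⟨I.1, I.2.1, I.2.2, hI⟩

/-- The family `v` moved by `g_t u_{(x, x̃A)}`. -/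
noncomputable def flowFamily {s m j : ℕ} (A : Matrix (Fin (s + 1)) (Fin m) ℝ) (t : ℝ)
    (v : Fin j → Fin (s + m + 1) → ℤ) (x : Fin s → ℝ) : Fin j → Fin (s + m + 1) → ℝ :=
  fun a => flow t (affineParam A x) fun i => (v a i : ℝ)

theorem colMinor_flowFamily_of_mem {s m j : ℕ} (hn : s + m ≠ 0)
    (A : Matrix (Fin (s + 1)) (Fin m) ℝ) (t : ℝ) (v : Fin (j + 1) → Fin (s + m + 1) → ℤ)
    (x : Fin s → ℝ) {w : Finset (Fin (s + m + 1)) → ℝ} (hw : ∀ I, w I = (minorDet v I : ℝ))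
    {I : Finset (Fin (s + m + 1))} (h : I.card = j + 1) (h0 : 0 ∈ I) :
    colMinor (flowFamily A t v x) (I.orderEmbOfFin h) =
      Real.exp ((((s : ℝ) + m + 1 - (j + 1 : ℕ)) / ((s : ℝ) + m)) * t) *
        ∑ i, (Fin.cons 1 x : Fin (s + 1) → ℝ) i * reduceVec A (cIw w I) i := by
  have hz := orderEmbOfFin_zero_eq_zero h h0
  have hne : ∀ b ≠ 0, I.orderEmbOfFin h b ≠ 0 := fun b hb hb' =>
    hb ((I.orderEmbOfFin h).injective (hb'.trans hz.symm))
  unfold flowFamily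
  rw [colMinor_flow_of_eq_zero hn t _ _ hz hne, ← sum_affineParam_mul]
  push_cast
  congr 1
  refine Finset.sum_congr rfl fun i _ => ?_
  rw [colMinor_intCast, colMinor_update_eq_cIw v hw h h0]

theorem colMinor_flowFamily_of_notMem {s m j : ℕ}
    (A : Matrix (Fin (s + 1)) (Fin m) ℝ) (t : ℝ) (v : Fin j → Fin (s + m + 1) → ℤ)
    (x : Fin s → ℝ) {w : Finset (Fin (s + m + 1)) → ℝ} (hw : ∀ I, w I = (minorDet v I : ℝ))
    {I : Finset (Fin (s + m + 1))} (h : I.card = j) (h0 : 0 ∉ I) :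
    colMinor (flowFamily A t v x) (I.orderEmbOfFin h) =
      Real.exp (-((j : ℝ) / ((s : ℝ) + m)) * t) * w I := by
  unfold flowFamily
  rw [colMinor_flow_of_ne_zero t, colMinor_intCast, hw, minorDet_eq_colMinor v h]
  · push_cast
    rfl
  · intro b hb
    exact h0 (hb ▸ Finset.orderEmbOfFin_mem I h b)

theorem abs_sum_mul_le_sum_abs_mul_norm {k : ℕ} (z g : Fin k → ℝ) :
    |∑ i, z i * g i| ≤ (∑ i, |z i|) * ‖g‖ := by
  refine (Finset.abs_sum_le_sum_abs _ _).trans ?_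
  rw [Finset.sum_mul]
  refine Finset.sum_le_sum fun i _ => ?_
  rw [abs_mul]
  exact mul_le_mul_of_nonneg_left (norm_le_pi_norm g i) (abs_nonneg _)

theorem criterionMax_nonneg {s m : ℕ} (A : Matrix (Fin (s + 1)) (Fin m) ℝ) (t : ℝ) (j : ℕ)
    (w : Finset (Fin (s + m + 1)) → ℝ) : 0 ≤ criterionMax A t j w :=
  le_max_of_le_right (mul_nonneg (Real.exp_pos _).le (maxCoeff_nonneg _ _))

theorem minorNorm_flowFamily_le {s m j : ℕ} (hn : s + m ≠ 0) (hj : 1 ≤ j)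
    (A : Matrix (Fin (s + 1)) (Fin m) ℝ) (t : ℝ) (v : Fin j → Fin (s + m + 1) → ℤ)
    (x : Fin s → ℝ) {w : Finset (Fin (s + m + 1)) → ℝ} (hw : ∀ I, w I = (minorDet v I : ℝ)) :
    minorNorm (flowFamily A t v x) ≤
      (1 + ∑ i, |(Fin.cons 1 x : Fin (s + 1) → ℝ) i|) * criterionMax A t j w := by
  obtain ⟨j, rfl⟩ : ∃ i, j = i + 1 := ⟨j - 1, by omega⟩
  have hc := criterionMax_nonneg A t (j + 1) w
  set C := ∑ i, |(Fin.cons 1 x : Fin (s + 1) → ℝ) i|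
  have hC : 0 ≤ C := Finset.sum_nonneg fun _ _ => abs_nonneg _
  have h0 : 0 ≤ (1 + C) * criterionMax A t (j + 1) w := by positivity
  refine (pi_norm_le_iff_of_nonneg h0).2 fun σ => ?_
  rw [Real.norm_eq_abs]
  by_cases hσ : Function.Injective σ
  · obtain ⟨I, h, hI⟩ := exists_abs_colMinor_eq_orderEmbOfFin (flowFamily A t v x) hσ
    rw [hI]
    by_cases hI0 : 0 ∈ I
    · rw [colMinor_flowFamily_of_mem hn A t v x hw h hI0, abs_mul, abs_of_pos (Real.exp_pos _)]
      calc _ ≤ Real.exp ((((s : ℝ) + m + 1 - (j + 1 : ℕ)) / ((s : ℝ) + m)) * t) *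
            (C * maxNormA A (j + 1) w) := by
            refine mul_le_mul_of_nonneg_left ?_ (Real.exp_pos _).le
            refine (abs_sum_mul_le_sum_abs_mul_norm _ _).trans ?_
            exact mul_le_mul_of_nonneg_left (norm_reduceVec_le_maxNormA A w hI0 h) hC
        _ = C * (Real.exp ((((s : ℝ) + m + 1 - (j + 1 : ℕ)) / ((s : ℝ) + m)) * t) *
            maxNormA A (j + 1) w) := by ring
        _ ≤ C * criterionMax A t (j + 1) w := mul_le_mul_of_nonneg_left (le_max_left _ _) hC
        _ ≤ _ := by nlinarith
    · rw [colMinor_flowFamily_of_notMem A t v x hw h hI0, abs_mul, abs_of_pos (Real.exp_pos _)]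
      calc _ ≤ Real.exp (-(((j + 1 : ℕ) : ℝ) / ((s : ℝ) + m)) * t) * maxCoeff (j + 1) w :=
            mul_le_mul_of_nonneg_left (abs_le_maxCoeff w hI0 h) (Real.exp_pos _).le
        _ ≤ criterionMax A t (j + 1) w := le_max_right _ _
        _ ≤ _ := by nlinarith
  · rw [colMinor_eq_zero_of_not_injective _ hσ, abs_zero]
    exact h0

theorem exists_mem_dyadicCube_norm_le {s : ℕ} (g : Fin (s + 1) → ℝ) (x : Fin s → ℝ) :
    ∃ y ∈ dyadicCube 0 x, ‖g‖ ≤ (6 + 4 * ∑ i, |(⌊x i⌋ : ℝ)|) *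
      |∑ i, (Fin.cons 1 y : Fin (s + 1) → ℝ) i * g i| := by
  set Z := ∑ i, |(⌊x i⌋ : ℝ)| with hZ
  have hZ0 : 0 ≤ Z := Finset.sum_nonneg fun _ _ => abs_nonneg _
  by_contra! H
  have hg : 0 < ‖g‖ := lt_of_le_of_lt (by positivity) (H x (mem_dyadicCube_self 0 x))
  set S := ‖g‖ / (6 + 4 * Z) with hS
  have hS0 : 0 < S := by positivity
  have H' : ∀ y ∈ dyadicCube 0 x, |g 0 + ∑ i, y i * g i.succ| ≤ S := by
    intro y hy
    have := H y hy
    rw [Fin.sum_univ_succ] at this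
    simp only [Fin.cons_zero, Fin.cons_succ, one_mul] at this
    rw [hS, le_div_iff₀ (by positivity), mul_comm]
    exact this.le
  set z : Fin s → ℝ := fun i => (⌊x i⌋ : ℝ) with hz
  have hzm : z ∈ dyadicCube 0 x := by
    simp [dyadicCube, hz]
  have h1 : ∀ i, |g (Fin.succ i)| ≤ 4 * S := by
    intro i
    have hm : Function.update z i (z i + 1 / 2) ∈ dyadicCube 0 x := by
      simp only [dyadicCube, Set.mem_ofPred_eq, pow_zero, one_mul]
      intro k
      by_cases hk : k = i
      · subst hk
        simp [hz]
        norm_num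
      · simp [hk, hz]
    have e : ∑ k, Function.update z i (z i + 1 / 2) k * g k.succ =
        ∑ k, z k * g k.succ + 1 / 2 * g i.succ := by
      rw [← sub_eq_iff_eq_add', ← Finset.sum_sub_distrib, Finset.sum_eq_single i]
      · simp; ring
      · intro b _ hb; simp [hb]
      · simp
    have a1 := abs_le.1 (H' _ hm)
    have a2 := abs_le.1 (H' _ hzm)
    rw [e] at a1
    rw [abs_le]
    constructor <;> linarith [a1.1, a1.2, a2.1, a2.2]
  have h2 : |g 0| ≤ S + 4 * S * Z := by
    have a2 := H' _ hzm
    have a3 : |∑ i, z i * g i.succ| ≤ 4 * S * Z := by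
      refine (abs_sum_mul_le_sum_abs_mul_norm z fun i => g i.succ).trans ?_
      rw [mul_comm]
      refine mul_le_mul_of_nonneg_right ?_ hZ0
      exact (pi_norm_le_iff_of_nonneg (by positivity)).2 h1
    have a4 := abs_le.1 a3
    have a5 := abs_le.1 a2
    rw [abs_le]
    constructor <;> linarith [a4.1, a4.2, a5.1, a5.2]
  have h3 : ‖g‖ ≤ 5 * S + 4 * S * Z := by
    refine (pi_norm_le_iff_of_nonneg (by positivity)).2 fun i => ?_
    refine Fin.cases ?_ (fun i => ?_) i
    · exact h2.trans (by linarith)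
    · refine (h1 i).trans ?_
      nlinarith
  have h4 : ‖g‖ = S * (6 + 4 * Z) := by rw [hS]; field_simp
  nlinarith

theorem exists_mem_dyadicCube_criterionMax_le {s m j : ℕ} (hn : s + m ≠ 0) (hj : 1 ≤ j)
    (hjn : j ≤ s + m) (A : Matrix (Fin (s + 1)) (Fin m) ℝ) (t : ℝ)
    (v : Fin j → Fin (s + m + 1) → ℤ) (x : Fin s → ℝ) {w : Finset (Fin (s + m + 1)) → ℝ}
    (hw : ∀ I, w I = (minorDet v I : ℝ)) :
    ∃ y ∈ dyadicCube 0 x, criterionMax A t j w ≤ (6 + 4 * ∑ i, |(⌊x i⌋ : ℝ)|) *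
      minorNorm (flowFamily A t v y) := by
  obtain ⟨j, rfl⟩ : ∃ i, j = i + 1 := ⟨j - 1, by omega⟩
  have hZ0 : 0 ≤ ∑ i, |(⌊x i⌋ : ℝ)| := Finset.sum_nonneg fun _ _ => abs_nonneg _
  rcases max_choice (Real.exp ((((s : ℝ) + m + 1 - (j + 1 : ℕ)) / ((s : ℝ) + m)) * t) *
    maxNormA A (j + 1) w) (Real.exp (-(((j + 1 : ℕ) : ℝ) / ((s : ℝ) + m)) * t) *
      maxCoeff (j + 1) w) with h | h
  · obtain ⟨I, hI0, hI, hmax⟩ := exists_norm_reduceVec_eq_maxNormA A hj hjn w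
    obtain ⟨y, hy, hle⟩ := exists_mem_dyadicCube_norm_le (reduceVec A (cIw w I)) x
    refine ⟨y, hy, ?_⟩
    rw [criterionMax, h, ← hmax]
    calc _ ≤ Real.exp ((((s : ℝ) + m + 1 - (j + 1 : ℕ)) / ((s : ℝ) + m)) * t) * _ :=
          mul_le_mul_of_nonneg_left hle (Real.exp_pos _).le
      _ = (6 + 4 * ∑ i, |(⌊x i⌋ : ℝ)|) * |colMinor (flowFamily A t v y) (I.orderEmbOfFin hI)| := by
          rw [colMinor_flowFamily_of_mem hn A t v y hw hI hI0, abs_mul,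
            abs_of_pos (Real.exp_pos _)]
          ring
      _ ≤ _ := mul_le_mul_of_nonneg_left (abs_colMinor_le _ _) (by positivity)
  · obtain ⟨I, hI0, hI, hmax⟩ := exists_abs_eq_maxCoeff hjn w
    refine ⟨x, mem_dyadicCube_self 0 x, ?_⟩
    rw [criterionMax, h, ← hmax, ← abs_of_pos (Real.exp_pos (-(((j + 1 : ℕ) : ℝ) / _) * t)),
      ← abs_mul, ← colMinor_flowFamily_of_notMem A t v x hw hI hI0]
    refine (abs_colMinor_le _ _).trans ?_
    nlinarith [minorNorm_nonneg (flowFamily A t v x)]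

theorem exists_colMinor_flowFamily_eq {s m j : ℕ} (hn : s + m ≠ 0)
    (A : Matrix (Fin (s + 1)) (Fin m) ℝ) (t : ℝ) (v : Fin j → Fin (s + m + 1) → ℤ)
    (σ : Fin j → Fin (s + m + 1)) :
    ∃ c : Fin (s + 1) → ℝ, ∀ x, colMinor (flowFamily A t v x) σ =
      ∑ i, (Fin.cons 1 x : Fin (s + 1) → ℝ) i * c i := by
  by_cases hσ : Function.Injective σ
  · by_cases h0 : ∃ b₀, σ b₀ = 0
    · obtain ⟨b₀, h0⟩ := h0
      refine ⟨fun i => Real.exp (((((s + m : ℕ) : ℝ) + 1 - j) / (s + m : ℕ)) * t) * reduceVec A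
        (fun i => colMinor (fun a i => (v a i : ℝ)) (Function.update σ b₀ i)) i, fun x => ?_⟩
      unfold flowFamily
      rw [colMinor_flow_of_eq_zero hn t _ _ h0 fun b hb hb' => hb (hσ (hb'.trans h0.symm)),
        sum_affineParam_mul, Finset.mul_sum]
      exact Finset.sum_congr rfl fun i _ => by ring
    · push Not at h0
      refine ⟨Fin.cons (Real.exp (-((j : ℝ) / (s + m : ℕ)) * t) *
        colMinor (fun a i => (v a i : ℝ)) σ) 0, fun x => ?_⟩
      unfold flowFamily
      rw [colMinor_flow_of_ne_zero t _ _ h0, Fin.sum_univ_succ]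
      simp
  · exact ⟨0, fun x => by simp [colMinor_eq_zero_of_not_injective _ hσ]⟩

/-- An integral basis of the rational subspace `U`. -/
def IsIntBasis {j k : ℕ} (v : Fin j → Fin k → ℤ) (U : Submodule ℚ (Fin k → ℚ)) : Prop :=
  LinearIndependent ℚ (fun a i => (v a i : ℚ)) ∧
    Submodule.span ℚ (Set.range fun a i => (v a i : ℚ)) = U

theorem IsIntBasis.finrank_eq {j k : ℕ} {v : Fin j → Fin k → ℤ} {U : Submodule ℚ (Fin k → ℚ)}
    (h : IsIntBasis v U) : Module.finrank ℚ U = j := by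
  rw [← h.2, finrank_span_eq_card h.1, Fintype.card_fin]

theorem linearIndependent_int_of_rat {j k : ℕ} {v : Fin j → Fin k → ℤ}
    (h : LinearIndependent ℚ (fun a i => (v a i : ℚ))) : LinearIndependent ℤ v := by
  have h1 : LinearIndependent ℤ (fun a i => (v a i : ℚ)) := h.restrict_scalars' ℤ
  exact LinearIndependent.of_comp ((Int.castAddHom ℚ).toIntLinearMap.compLeft (Fin k)) h1

theorem minorNorm_intCast_pos {j k : ℕ} {v : Fin j → Fin k → ℤ} (h : LinearIndependent ℤ v) :
    0 < minorNorm (fun a i => (v a i : ℝ)) := by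
  obtain ⟨σ, hσ⟩ := exists_colMinor_intCast_ne_zero h
  refine lt_of_lt_of_le ?_ (abs_colMinor_le _ σ)
  rw [colMinor_intCast, abs_pos]
  exact_mod_cast hσ

theorem exists_isIntBasis {k : ℕ} (U : Submodule ℚ (Fin k → ℚ)) :
    ∃ v : Fin (Module.finrank ℚ U) → Fin k → ℤ, IsIntBasis v U := by
  set b := Module.finBasis ℚ U
  obtain ⟨d, hd⟩ := IsLocalization.exist_integer_multiples_of_finite (nonZeroDivisors ℤ)
    (fun p : Fin (Module.finrank ℚ U) × Fin k => ((b p.1 : U) : Fin k → ℚ) p.2)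
  choose v hv using hd
  have hd0 : ((d : ℤ) : ℚ) ≠ 0 := by exact_mod_cast nonZeroDivisors.ne_zero d.2
  have e : (fun a i => (v (a, i) : ℚ)) = fun a => ((d : ℤ) : ℚ) • ((b a : U) : Fin k → ℚ) := by
    ext a i
    have := hv (a, i)
    simpa using this
  have hb : LinearIndependent ℚ fun a => ((b a : U) : Fin k → ℚ) :=
    b.linearIndependent.map' U.subtype U.ker_subtype
  have hli : LinearIndependent ℚ (fun a i => (v (a, i) : ℚ)) := by
    rw [e]
    exact hb.units_smul fun _ => Units.mk0 _ hd0
  refine ⟨fun a i => v (a, i), hli, ?_⟩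
  refine Submodule.eq_of_le_of_finrank_eq ?_ ?_
  · rw [Submodule.span_le]
    rintro _ ⟨a, rfl⟩
    have : (fun i => (v (a, i) : ℚ)) = ((d : ℤ) : ℚ) • ((b a : U) : Fin k → ℚ) := congrFun e a
    simp only [this]
    exact U.smul_mem _ (b a).2
  · rw [finrank_span_eq_card hli, Fintype.card_fin]

theorem exists_nat_eq_minorNorm {j k : ℕ} [NeZero k] (v : Fin j → Fin k → ℤ) :
    ∃ N : ℕ, (N : ℝ) = minorNorm (fun a i => (v a i : ℝ)) := by
  obtain ⟨σ, hσ⟩ := exists_abs_colMinor_eq (fun a i => (v a i : ℝ))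
  refine ⟨(colMinor v σ).natAbs, ?_⟩
  rw [← hσ, colMinor_intCast, Nat.cast_natAbs, Int.cast_abs]

theorem exists_minimal_isIntBasis {k : ℕ} [NeZero k] (U : Submodule ℚ (Fin k → ℚ)) :
    ∃ v : Fin (Module.finrank ℚ U) → Fin k → ℤ, IsIntBasis v U ∧
      ∀ v' : Fin (Module.finrank ℚ U) → Fin k → ℤ, IsIntBasis v' U →
        minorNorm (fun a i => (v a i : ℝ)) ≤ minorNorm (fun a i => (v' a i : ℝ)) := by
  classical
  have hex : ∃ N : ℕ, ∃ v : Fin (Module.finrank ℚ U) → Fin k → ℤ, IsIntBasis v U ∧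
      (N : ℝ) = minorNorm (fun a i => (v a i : ℝ)) := by
    obtain ⟨v, hv⟩ := exists_isIntBasis U
    obtain ⟨N, hN⟩ := exists_nat_eq_minorNorm v
    exact ⟨N, v, hv, hN⟩
  obtain ⟨v, hv, hN⟩ := Nat.find_spec hex
  refine ⟨v, hv, fun v' hv' => ?_⟩
  obtain ⟨N', hN'⟩ := exists_nat_eq_minorNorm v'
  rw [← hN, ← hN']
  exact_mod_cast Nat.find_min' hex ⟨v', hv', hN'⟩

/-- An integral basis of `U` of smallest covolume. -/
noncomputable def minBasis {k : ℕ} [NeZero k] (U : Submodule ℚ (Fin k → ℚ)) :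
    Fin (Module.finrank ℚ U) → Fin k → ℤ :=
  (exists_minimal_isIntBasis U).choose

theorem isIntBasis_minBasis {k : ℕ} [NeZero k] (U : Submodule ℚ (Fin k → ℚ)) :
    IsIntBasis (minBasis U) U :=
  (exists_minimal_isIntBasis U).choose_spec.1

theorem minorNorm_minBasis_le {k : ℕ} [NeZero k] {U : Submodule ℚ (Fin k → ℚ)}
    {v : Fin (Module.finrank ℚ U) → Fin k → ℤ} (hv : IsIntBasis v U) :
    minorNorm (fun a i => (minBasis U a i : ℝ)) ≤ minorNorm (fun a i => (v a i : ℝ)) :=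
  (exists_minimal_isIntBasis U).choose_spec.2 v hv

theorem flowFamily_linear_comb {s m j : ℕ} (A : Matrix (Fin (s + 1)) (Fin m) ℝ) (t : ℝ)
    {v v' : Fin j → Fin (s + m + 1) → ℤ} (M : Matrix (Fin j) (Fin j) ℝ)
    (h : ∀ a, (fun i => (v a i : ℝ)) = ∑ b, M a b • fun i => (v' b i : ℝ)) (x : Fin s → ℝ) :
    flowFamily A t v x = fun a => ∑ b, M a b • flowFamily A t v' x b := by
  ext1 a
  unfold flowFamily
  rw [← flow_sum_smul, h]

theorem minorNorm_flowFamily_minBasis_le {s m j : ℕ} (A : Matrix (Fin (s + 1)) (Fin m) ℝ) (t : ℝ)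
    {U : Submodule ℚ (Fin (s + m + 1) → ℚ)} {v : Fin j → Fin (s + m + 1) → ℤ}
    (hv : IsIntBasis v U) (x : Fin s → ℝ) :
    minorNorm (flowFamily A t (minBasis U) x) ≤ minorNorm (flowFamily A t v x) := by
  obtain rfl := hv.finrank_eq
  have hmem : ∀ a, ∃ c : Fin (Module.finrank ℚ U) → ℚ,
      ∑ b, c b • (fun i => (v b i : ℚ)) = fun i => (minBasis U a i : ℚ) := by
    intro a
    rw [← Submodule.mem_span_range_iff_exists_fun, hv.2]
    have : (fun i => (minBasis U a i : ℚ)) ∈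
        Submodule.span ℚ (Set.range fun a i => (minBasis U a i : ℚ)) :=
      Submodule.subset_span ⟨a, rfl⟩
    rwa [(isIntBasis_minBasis U).2] at this
  choose c hc using hmem
  set M : Matrix (Fin (Module.finrank ℚ U)) (Fin (Module.finrank ℚ U)) ℝ :=
    Matrix.of fun a b => (c a b : ℝ) with hM
  have h : ∀ a, (fun i => (minBasis U a i : ℝ)) = ∑ b, M a b • fun i => (v b i : ℝ) := by
    intro a
    ext i
    have := congrArg (fun q : ℚ => (q : ℝ)) (congrFun (hc a) i)
    simp only [Finset.sum_apply, Pi.smul_apply, smul_eq_mul] at this ⊢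
    push_cast at this
    exact this.symm
  have h1 : minorNorm (fun a i => (minBasis U a i : ℝ)) =
      |M.det| * minorNorm (fun a i => (v a i : ℝ)) := by
    rw [← minorNorm_linear_comb]
    congr 1
    exact funext h
  have hpos := minorNorm_intCast_pos (linearIndependent_int_of_rat hv.1)
  have hdet : |M.det| ≤ 1 := by
    have := minorNorm_minBasis_le hv
    rw [h1] at this
    nlinarith
  rw [flowFamily_linear_comb A t M h x, minorNorm_linear_comb]
  exact mul_le_of_le_one_left (minorNorm_nonneg _) hdet

theorem minorNorm_eq_one_of_eq_zero {j k : ℕ} (hj : j = 0) (v : Fin j → Fin k → ℝ) :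
    minorNorm v = 1 := by
  subst hj
  have : colMinor v = fun _ => 1 := by
    ext σ
    simp [colMinor]
  rw [minorNorm, this]
  simp

theorem one_le_minorNorm_flowFamily {s m j : ℕ} (hn : s + m ≠ 0) (hj : j = s + m + 1)
    (A : Matrix (Fin (s + 1)) (Fin m) ℝ) (t : ℝ) {v : Fin j → Fin (s + m + 1) → ℤ}
    (hv : LinearIndependent ℤ v) (x : Fin s → ℝ) : 1 ≤ minorNorm (flowFamily A t v x) := by
  subst hj
  obtain ⟨σ, hσ⟩ := exists_colMinor_intCast_ne_zero hv
  have hinj : Function.Injective σ := by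
    by_contra h
    exact hσ (colMinor_eq_zero_of_not_injective v h)
  obtain ⟨b₀, hb₀⟩ := (Finite.injective_iff_surjective.1 hinj) 0
  refine le_trans ?_ (abs_colMinor_le _ σ)
  unfold flowFamily
  rw [colMinor_flow_of_eq_zero hn t _ _ hb₀ fun b hb hb' => hb (hinj (hb'.trans hb₀.symm)),
    Finset.sum_eq_single 0]
  · have : ((((s + m : ℕ) : ℝ) + 1 - (s + m + 1 : ℕ)) / (s + m : ℕ)) * t = 0 := by
      push_cast
      simp
    rw [this, Real.exp_zero, one_mul, Fin.cons_zero, one_mul, ← hb₀, Function.update_eq_self,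
      colMinor_intCast]
    exact_mod_cast Int.one_le_abs hσ
  · intro i _ hi
    rw [colMinor_eq_zero_of_not_injective, mul_zero]
    obtain ⟨b, rfl⟩ := (Finite.injective_iff_surjective.1 hinj) i
    intro h
    have hb : b ≠ b₀ := fun hb => hi (by rw [hb, hb₀])
    exact hb (h (by rw [Function.update_self, Function.update_of_ne hb]))
  · simp

theorem isIntBasis_cons {j k : ℕ} {v : Fin j → Fin k → ℤ} {U : Submodule ℚ (Fin k → ℚ)}
    (hv : IsIntBasis v U) {u : Fin k → ℤ} (hu : (fun i => (u i : ℚ)) ∉ U) :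
    IsIntBasis (Fin.cons u v : Fin (j + 1) → Fin k → ℤ)
      (Submodule.span ℚ {fun i => (u i : ℚ)} ⊔ U) := by
  have e : (fun (a : Fin (j + 1)) (i : Fin k) =>
      (((Fin.cons u v : Fin (j + 1) → Fin k → ℤ) a i : ℤ) : ℚ)) =
      Fin.cons (fun i => (u i : ℚ)) (fun a i => (v a i : ℚ)) := by
    ext a i
    refine Fin.cases ?_ (fun a => ?_) a <;> simp
  rw [IsIntBasis, e]
  refine ⟨hv.1.finCons (by rwa [hv.2]), ?_⟩
  rw [Fin.range_cons, Submodule.span_insert, hv.2]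

theorem minorNorm_flowFamily_cons_le {s m j : ℕ} (A : Matrix (Fin (s + 1)) (Fin m) ℝ) (t : ℝ)
    (u : Fin (s + m + 1) → ℤ) (v : Fin j → Fin (s + m + 1) → ℤ) (x : Fin s → ℝ) :
    minorNorm (flowFamily A t (Fin.cons u v : Fin (j + 1) → Fin (s + m + 1) → ℤ) x) ≤
      (j + 1) * ‖flow t (affineParam A x) fun i => (u i : ℝ)‖ * minorNorm (flowFamily A t v x) := by
  have : flowFamily A t (Fin.cons u v : Fin (j + 1) → Fin (s + m + 1) → ℤ) x =
      Fin.cons (flow t (affineParam A x) fun i => (u i : ℝ)) (flowFamily A t v x) := by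
    ext1 a
    refine Fin.cases ?_ (fun a => ?_) a <;> simp [flowFamily]
  rw [this]
  exact minorNorm_cons_le _ _

theorem exists_maximal_not_mem {V : Type*} [AddCommGroup V] [Module ℚ V]
    {F : Set (Submodule ℚ V)} (hfin : F.Finite) (hF : IsChain (· ≤ ·) F) {u : V} (hu : u ≠ 0) :
    ∃ U ∈ insert ⊥ F, u ∉ U ∧ ∀ W ∈ F, W ≤ U ∨ (U ≤ W ∧ u ∈ W) := by
  have hF' : IsChain (· ≤ ·) (insert ⊥ F) := hF.insert fun b _ _ => Or.inl bot_le
  obtain ⟨U, hU⟩ := ((hfin.insert ⊥).subset (Set.sep_subset (insert ⊥ F) (u ∉ ·))).exists_maximal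
    ⟨⊥, Set.mem_insert _ _, by simpa using hu⟩
  refine ⟨U, hU.1.1, hU.1.2, fun W hW => ?_⟩
  have hWm : W ∈ insert ⊥ F := Set.mem_insert_of_mem _ hW
  by_cases huW : u ∈ W
  · rcases hF'.total hU.1.1 hWm with h | h
    · exact Or.inr ⟨h, huW⟩
    · exact absurd (h huW) hU.1.2
  · rcases hF'.total hU.1.1 hWm with h | h
    · exact Or.inl (hU.2 ⟨hWm, huW⟩ h)
    · exact Or.inl h

theorem le_norm_flow_of_isMarked {s m : ℕ} (A : Matrix (Fin (s + 1)) (Fin m) ℝ) {t ε ρ : ℝ}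
    (hερ : ε ≤ ρ) (hρ : ρ ≤ 1) {x : Fin s → ℝ}
    (h : IsMarked (fun (U : Submodule ℚ (Fin (s + m + 1) → ℚ)) x =>
      minorNorm (flowFamily A t (minBasis U) x)) ε ρ {U | U ≠ ⊥} x)
    {u : Fin (s + m + 1) → ℤ} (hu : u ≠ 0) :
    ε ≤ (s + m + 2) * ‖flow t (affineParam A x) fun i => (u i : ℝ)‖ := by
  obtain ⟨F, hfin, -, hchain, hF, hcomp⟩ := h
  have hu' : (fun i => (u i : ℚ)) ≠ 0 := by
    contrapose! hu
    ext i
    simpa using congrFun hu i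
  obtain ⟨U, hUF, huU, hmax⟩ := exists_maximal_not_mem hfin hchain hu'
  have hψU : minorNorm (flowFamily A t (minBasis U) x) ≤ 1 := by
    rcases hUF with rfl | hUF
    · exact (minorNorm_eq_one_of_eq_zero (finrank_bot _ _) _).le
    · exact (hF U hUF).2.trans hρ
  set U' := Submodule.span ℚ {fun i => (u i : ℚ)} ⊔ U with hU'
  have huU' : (fun i => (u i : ℚ)) ∈ U' :=
    Submodule.mem_sup_left (Submodule.mem_span_singleton_self _)
  have hψU' : ε ≤ minorNorm (flowFamily A t (minBasis U') x) := by
    by_cases hU'F : U' ∈ F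
    · exact (hF U' hU'F).1
    · refine hερ.trans (hcomp U' ?_ hU'F fun W hW => ?_)
      · rintro h
        rw [h] at huU'
        exact hu' (by simpa using huU')
      · rcases hmax W hW with h | ⟨h1, h2⟩
        · exact Or.inr (h.trans le_sup_right)
        · exact Or.inl (sup_le (by simpa using h2) h1)
  have h1 := minorNorm_flowFamily_minBasis_le A t (isIntBasis_cons (isIntBasis_minBasis U) huU) x
  have h2 := minorNorm_flowFamily_cons_le A t u (minBasis U) x
  refine hψU'.trans (h1.trans (h2.trans ?_))
  have h3 : (Module.finrank ℚ U : ℝ) ≤ s + m + 1 := by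
    have := Submodule.finrank_le U
    rw [Module.finrank_fin_fun] at this
    exact_mod_cast this
  have h4 := norm_nonneg (flow t (affineParam A x) fun i => (u i : ℝ))
  have h5 := minorNorm_nonneg (flowFamily A t (minBasis U) x)
  calc _ ≤ (Module.finrank ℚ U + 1) * ‖flow t (affineParam A x) fun i => (u i : ℝ)‖ * 1 := by
        gcongr
    _ ≤ _ := by nlinarith

theorem continuous_minorNorm_flowFamily {s m j : ℕ} (hn : s + m ≠ 0)
    (A : Matrix (Fin (s + 1)) (Fin m) ℝ) (t : ℝ) (v : Fin j → Fin (s + m + 1) → ℤ) :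
    Continuous fun x => minorNorm (flowFamily A t v x) := by
  refine Continuous.norm (continuous_pi fun σ => ?_)
  obtain ⟨c, hc⟩ := exists_colMinor_flowFamily_eq hn A t v σ
  simp only [hc, Fin.sum_univ_succ, Fin.cons_zero, Fin.cons_succ]
  fun_prop

theorem volume_minorNorm_flowFamily_lt_le {s m j : ℕ} (hn : s + m ≠ 0)
    (A : Matrix (Fin (s + 1)) (Fin m) ℝ) (t : ℝ) (v : Fin j → Fin (s + m + 1) → ℤ) {ε ρ : ℝ}
    (hε : 0 < ε) (hρ : 0 < ρ) (l : ℕ) (x : Fin s → ℝ)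
    (h : ∃ y ∈ dyadicCube l x, ρ ≤ minorNorm (flowFamily A t v y)) :
    volume {y ∈ dyadicCube l x | minorNorm (flowFamily A t v y) < ε} ≤
      ENNReal.ofReal ((4 * s + 2) * (ε / ρ)) * volume (dyadicCube l x) := by
  obtain ⟨y, hy, hρy⟩ := h
  obtain ⟨σ, hσ⟩ := exists_abs_colMinor_eq (flowFamily A t v y)
  obtain ⟨c, hc⟩ := exists_colMinor_flowFamily_eq hn A t v σ
  refine le_trans (measure_mono ?_) (volume_abs_affine_lt_le c l x hε hρ ⟨y, hy, ?_⟩)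
  · rintro z ⟨hz, hz'⟩
    refine ⟨hz, ?_⟩
    rw [← hc]
    exact (abs_colMinor_le _ _).trans_lt hz'
  · rwa [← hc, hσ]

theorem volume_exists_norm_flow_lt_le {s m : ℕ} (hn : s + m ≠ 0)
    (A : Matrix (Fin (s + 1)) (Fin m) ℝ) {t δ ε : ℝ} (x : Fin s → ℝ)
    (hδ : ∀ j, 1 ≤ j → j ≤ s + m → ∀ w : Finset (Fin (s + m + 1)) → ℝ, IsPrim j w →
      δ ≤ criterionMax A t j w) (hδ0 : 0 < δ) (hδ1 : δ ≤ 1) (hε0 : 0 < ε)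
    (hε : (6 + 4 * ∑ i, |(⌊x i⌋ : ℝ)|) * ε ≤ δ) :
    volume {y ∈ dyadicCube 0 x | ∃ u : Fin (s + m + 1) → ℤ, u ≠ 0 ∧
      (s + m + 2) * ‖flow t (affineParam A y) fun i => (u i : ℝ)‖ < ε} ≤
      nondivConst s (s + m + 1) * ENNReal.ofReal ((4 * s + 2) *
        (ε / (δ / (6 + 4 * ∑ i, |(⌊x i⌋ : ℝ)|)))) * volume (dyadicCube 0 x) := by
  set C := 6 + 4 * ∑ i, |(⌊x i⌋ : ℝ)| with hC
  have hC6 : 6 ≤ C := by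
    have : 0 ≤ ∑ i, |(⌊x i⌋ : ℝ)| := Finset.sum_nonneg fun _ _ => abs_nonneg _
    linarith
  set ρ := δ / C with hρdef
  have hρ0 : 0 < ρ := by positivity
  have hερ : ε ≤ ρ := by rw [hρdef, le_div_iff₀ (by positivity)]; linarith
  have hρ1 : ρ ≤ 1 := by rw [hρdef, div_le_one (by positivity)]; linarith
  have hrk : ∀ U W : Submodule ℚ (Fin (s + m + 1) → ℚ), U ≤ W →
      Module.finrank ℚ U = Module.finrank ℚ W → U = W :=
    fun U W h h' => Submodule.eq_of_le_of_finrank_eq h h'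
  refine le_trans (measure_mono ?_)
    (volume_not_isMarked_le (fun U : Submodule ℚ (Fin (s + m + 1) → ℚ) => Module.finrank ℚ U) hrk
      (fun U x => minorNorm (flowFamily A t (minBasis U) x))
      (fun U => continuous_minorNorm_flowFamily hn A t _)
      (fun U l x h => volume_minorNorm_flowFamily_lt_le hn A t _ hε0 hρ0 l x h)
      (s + m + 1) (Finset.Icc 1 (s + m + 1)) (by simp) {U | U ≠ ⊥} (fun U hU => ?_) 0 x
      fun U hU => ?_)
  · rintro y ⟨hy, u, hu, hlt⟩
    refine ⟨hy, fun hmark => ?_⟩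
    exact absurd (le_norm_flow_of_isMarked A hερ hρ1 hmark hu) (not_le.2 hlt)
  · rw [Finset.mem_Icc]
    refine ⟨Submodule.one_le_finrank_iff.2 hU, ?_⟩
    simpa using Submodule.finrank_le U
  · have hli := linearIndependent_int_of_rat (isIntBasis_minBasis U).1
    have hle : Module.finrank ℚ U ≤ s + m + 1 := by simpa using Submodule.finrank_le U
    rcases hle.lt_or_eq with hlt | heq
    · obtain ⟨y, hy, hle⟩ := exists_mem_dyadicCube_criterionMax_le hn
        (Submodule.one_le_finrank_iff.2 hU) (Nat.lt_succ_iff.1 hlt) A t (minBasis U) x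
        (w := fun I => (minorDet (minBasis U) I : ℝ)) fun _ => rfl
      refine ⟨y, hy, ?_⟩
      have := hδ _ (Submodule.one_le_finrank_iff.2 hU) (Nat.lt_succ_iff.1 hlt)
        (fun I => (minorDet (minBasis U) I : ℝ)) ⟨_, hli, fun _ => rfl⟩
      rw [hρdef, div_le_iff₀ (by positivity), mul_comm]
      exact this.trans hle
    · exact ⟨x, mem_dyadicCube_self 0 x,
        hρ1.trans (one_le_minorNorm_flowFamily hn heq A t hli x)⟩

theorem exists_time_of_le_rpow {a b v : ℝ} (ha : 0 < a) (hb : 0 < b) (hv : b / a < v) :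
    ∃ β : ℝ, 0 < β ∧ ∀ K : ℝ, 0 < K → ∀ T : ℝ, ∃ N : ℝ, 1 ≤ N ∧ ∀ C : ℝ, N < C → ∀ M : ℝ,
      M ≤ C ^ (-v) → ∃ t : ℕ, T ≤ t ∧ Real.exp (b * t) * M < K * Real.exp (-β * t) ∧
        Real.exp (-a * t) * C < K * Real.exp (-β * t) := by
  have hv0 : 0 < v := lt_trans (by positivity) hv
  rw [div_lt_iff₀ ha] at hv
  set β := (v * a - b) / (2 * (v + 1)) with hβ
  have hβ0 : 0 < β := div_pos (by linarith) (by positivity)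
  have hβeq : β * (2 * (v + 1)) = v * a - b := by rw [hβ]; field_simp
  have hβa : 0 < a - β := by nlinarith
  have hgap : 0 < v * (a - β) - (b + β) := by nlinarith
  refine ⟨β, hβ0, fun K hK T => ?_⟩
  set L := Real.log K with hL
  have hKL : K = Real.exp L := (Real.exp_log hK).symm
  set X := max (max 0 L) (max (T * (a - β) + L)
    (((b + β) * (2 * (a - β) - L) - L * (a - β)) / (v * (a - β) - (b + β)))) with hX
  have hX0 : 0 ≤ X := (le_max_left _ _).trans (le_max_left _ _)
  refine ⟨Real.exp X, Real.one_le_exp hX0, fun C hC M hM => ?_⟩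
  have hC0 : 0 < C := (Real.exp_pos X).trans hC
  have hXC : X < Real.log C := (Real.lt_log_iff_exp_lt hC0).2 hC
  have hCe : C = Real.exp (Real.log C) := (Real.exp_log hC0).symm
  set c := Real.log C with hc
  have hX1 : T * (a - β) + L ≤ X := (le_max_left _ _).trans (le_max_right _ _)
  have hX2 : (b + β) * (2 * (a - β) - L) - L * (a - β) ≤ X * (v * (a - β) - (b + β)) := by
    rw [← div_le_iff₀ hgap]
    exact (le_max_right _ _).trans (le_max_right _ _)
  have hLc : 0 ≤ c - L := by linarith [(le_max_right 0 L).trans (le_max_left _ _ : max 0 L ≤ X)]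
  set t := ⌈(c - L) / (a - β)⌉₊ + 1 with ht
  have ht1 : c - L < t * (a - β) := by
    rw [← div_lt_iff₀ hβa, ht]
    push_cast
    linarith [Nat.le_ceil ((c - L) / (a - β))]
  have ht2 : t * (a - β) < c - L + 2 * (a - β) := by
    have : (⌈(c - L) / (a - β)⌉₊ : ℝ) < (c - L) / (a - β) + 1 :=
      Nat.ceil_lt_add_one (div_nonneg hLc hβa.le)
    have h' : (t : ℝ) < (c - L) / (a - β) + 2 := by rw [ht]; push_cast; linarith
    have := mul_lt_mul_of_pos_right h' hβa
    rw [add_mul, div_mul_cancel₀ _ hβa.ne'] at this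
    exact this
  refine ⟨t, ?_, ?_, ?_⟩
  · have : T * (a - β) ≤ t * (a - β) := by linarith
    exact le_of_mul_le_mul_right this hβa
  · refine (mul_le_mul_of_nonneg_left hM (Real.exp_pos _).le).trans_lt ?_
    rw [Real.rpow_def_of_pos hC0, ← hc, hKL, ← Real.exp_add, ← Real.exp_add, Real.exp_lt_exp]
    have e1 : (b + β) * (t * (a - β)) < (b + β) * (c - L + 2 * (a - β)) :=
      mul_lt_mul_of_pos_left ht2 (by linarith)
    have e2 : X * (v * (a - β) - (b + β)) < c * (v * (a - β) - (b + β)) :=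
      mul_lt_mul_of_pos_right hXC hgap
    have : ((b + β) * t) * (a - β) < (L + v * c) * (a - β) := by nlinarith
    have := lt_of_mul_lt_mul_right this hβa.le
    nlinarith
  · rw [hCe, hKL, ← Real.exp_add, ← Real.exp_add, Real.exp_lt_exp]
    nlinarith

theorem lt_rpow_of_exp_mul_lt {a b β t C M : ℝ} (ha : 0 < a) (hb : 0 < b) (hβ : 0 < β)
    (ht : 0 ≤ t) (hC : 1 ≤ C) (hM : Real.exp (b * t) * M < Real.exp (-β * t))
    (hCt : Real.exp (-a * t) * C < Real.exp (-β * t)) : M < C ^ (-((b + β) / a)) := by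
  have hC0 : 0 < C := by linarith
  have h1 : Real.log C < (a - β) * t := by
    rw [Real.log_lt_iff_lt_exp hC0]
    have := mul_lt_mul_of_pos_left hCt (Real.exp_pos (a * t))
    rwa [← mul_assoc, ← Real.exp_add, ← Real.exp_add, show a * t + -a * t = 0 by ring,
      Real.exp_zero, one_mul, show a * t + -β * t = (a - β) * t by ring] at this
  have h2 : M < Real.exp (-((b + β) * t)) := by
    have := mul_lt_mul_of_pos_left hM (Real.exp_pos (-(b * t)))
    rwa [← mul_assoc, ← Real.exp_add, ← Real.exp_add, show -(b * t) + b * t = 0 by ring,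
      Real.exp_zero, one_mul, show -(b * t) + -β * t = -((b + β) * t) by ring] at this
  refine h2.trans_le ?_
  rw [Real.rpow_def_of_pos hC0, Real.exp_le_exp]
  have h3 : Real.log C * ((b + β) / a) ≤ (b + β) * t := by
    rw [← mul_div_assoc, div_le_iff₀ ha]
    have : Real.log C ≤ t * a := by nlinarith
    nlinarith
  linarith

theorem ae_eventually_le_norm_flow {s m : ℕ} (hn : s + m ≠ 0)
    (A : Matrix (Fin (s + 1)) (Fin m) ℝ) {β : ℝ} (hβ : 0 < β)
    (h : ∃ T : ℝ, 0 < T ∧ ∀ t : ℝ, T ≤ t → ∀ j : ℕ, 1 ≤ j → j ≤ s + m →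
      ∀ w : Finset (Fin (s + m + 1)) → ℝ, IsPrim j w →
        Real.exp (-β * t) ≤ criterionMax A t j w) :
    volume {y : Fin s → ℝ | ¬ ∃ K : ℝ, 0 < K ∧ ∃ T : ℕ, ∀ t : ℕ, T ≤ t →
      ∀ u : Fin (s + m + 1) → ℤ, u ≠ 0 →
        K * Real.exp (-(2 * β) * t) ≤ ‖flow t (affineParam A y) fun i => (u i : ℝ)‖} = 0 := by
  obtain ⟨T, hT0, hT⟩ := h
  set E := {y : Fin s → ℝ | ¬ ∃ K : ℝ, 0 < K ∧ ∃ T : ℕ, ∀ t : ℕ, T ≤ t →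
      ∀ u : Fin (s + m + 1) → ℤ, u ≠ 0 →
        K * Real.exp (-(2 * β) * t) ≤ ‖flow t (affineParam A y) fun i => (u i : ℝ)‖} with hE
  have hcover : E ⊆ ⋃ z : Fin s → ℤ, E ∩ dyadicCube 0 (fun i => (z i : ℝ)) := fun y hy =>
    Set.mem_iUnion.2 ⟨fun i => ⌊y i⌋, hy, fun i => by simp⟩
  refine measure_mono_null hcover (measure_iUnion_null fun z => ?_)
  set x : Fin s → ℝ := fun i => (z i : ℝ) with hx
  set C := 6 + 4 * ∑ i, |(⌊x i⌋ : ℝ)| with hC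
  have hC6 : 6 ≤ C := by
    have : 0 ≤ ∑ i, |(⌊x i⌋ : ℝ)| := Finset.sum_nonneg fun _ _ => abs_nonneg _
    linarith
  have hC0 : 0 < C := by linarith
  set B : ℕ → Set (Fin s → ℝ) := fun r => {y ∈ dyadicCube 0 x | ∃ u : Fin (s + m + 1) → ℤ, u ≠ 0 ∧
      (s + m + 2) * ‖flow ((r + ⌈T⌉₊ : ℕ) : ℝ) (affineParam A y) fun i => (u i : ℝ)‖ <
        Real.exp (-(2 * β) * ((r + ⌈T⌉₊ : ℕ) : ℝ)) / C} with hB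
  have hvol : ∀ r, volume (B r) ≤ nondivConst s (s + m + 1) *
      ENNReal.ofReal ((4 * s + 2) * Real.exp (-β * ((r + ⌈T⌉₊ : ℕ) : ℝ))) *
        volume (dyadicCube 0 x) := by
    intro r
    set t : ℝ := ((r + ⌈T⌉₊ : ℕ) : ℝ) with ht
    have htT : T ≤ t := by
      rw [ht]; push_cast
      linarith [Nat.le_ceil T, (Nat.cast_nonneg r : (0 : ℝ) ≤ r)]
    have ht0 : 0 ≤ t := hT0.le.trans htT
    have hexp : Real.exp (-(2 * β) * t) = Real.exp (-β * t) * Real.exp (-β * t) := by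
      rw [← Real.exp_add]; congr 1; ring
    have hle1 : Real.exp (-β * t) ≤ 1 := Real.exp_le_one_iff.2 (by nlinarith)
    have hpos := Real.exp_pos (-β * t)
    have key := volume_exists_norm_flow_lt_le hn A (t := t) (δ := Real.exp (-β * t))
      (ε := Real.exp (-(2 * β) * t) / C) x (hT t htT) hpos hle1
      (div_pos (Real.exp_pos _) hC0) (by
        rw [mul_div_cancel₀ _ hC0.ne', hexp]
        nlinarith)
    rw [← hC] at key
    have e : Real.exp (-(2 * β) * t) / C / (Real.exp (-β * t) / C) = Real.exp (-β * t) := by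
      rw [hexp]; field_simp
    rwa [e] at key
  have hsum : Summable fun r : ℕ => (4 * s + 2) * Real.exp (-β * ((r + ⌈T⌉₊ : ℕ) : ℝ)) := by
    refine Summable.mul_left _ ?_
    have h1 : Summable fun r : ℕ => Real.exp ((r : ℝ) * -β) :=
      Real.summable_exp_nat_mul_iff.2 (by linarith)
    refine ((summable_nat_add_iff ⌈T⌉₊).2 h1).congr fun r => ?_
    rw [mul_comm]
  have hne : ∑' r, volume (B r) ≠ ⊤ := by
    refine ne_top_of_le_ne_top ?_ (ENNReal.tsum_le_tsum hvol)
    rw [ENNReal.tsum_mul_right, ENNReal.tsum_mul_left]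
    refine ENNReal.mul_ne_top (ENNReal.mul_ne_top (nondivConst_ne_top _ _) hsum.tsum_ofReal_ne_top) ?_
    rw [volume_dyadicCube]
    exact ENNReal.ofReal_ne_top
  refine measure_mono_null ?_ (measure_setOfPred_frequently_eq_zero hne)
  rintro y ⟨hyE, hyc⟩
  by_contra hfreq
  refine hyE ?_
  have hev : ∀ᶠ r in Filter.atTop, y ∉ B r := Filter.not_frequently.1 hfreq
  obtain ⟨R, hR⟩ := Filter.eventually_atTop.1 hev
  refine ⟨1 / (C * (s + m + 2)), by positivity, R + ⌈T⌉₊, fun t ht u hu => ?_⟩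
  obtain ⟨r, rfl⟩ : ∃ r, t = r + ⌈T⌉₊ := ⟨t - ⌈T⌉₊, by omega⟩
  by_contra! hlt
  refine hR r (by omega) ⟨hyc, u, hu, ?_⟩
  rw [one_div_mul_eq_div, lt_div_iff₀ (by positivity)] at hlt
  rw [lt_div_iff₀ hC0]
  linarith

theorem norm_flow_cons_lt {n : ℕ} {t c : ℝ} {y : Fin n → ℝ} {p : ℤ} {q : Fin n → ℤ} (hc : 0 < c)
    (h1 : Real.exp (1 * t) * |∑ i, y i * (q i : ℝ) + p| < c)
    (h2 : Real.exp (-(1 / n) * t) * ‖fun i => (q i : ℝ)‖ < c) :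
    ‖flow t y fun i => (((Fin.cons p q : Fin (n + 1) → ℤ) i : ℤ) : ℝ)‖ < c := by
  refine (pi_norm_lt_iff hc).2 fun i => ?_
  refine Fin.cases ?_ (fun i => ?_) i
  · rw [flow, Fin.cons_zero, Fin.sum_univ_succ, Real.norm_eq_abs, abs_mul,
      abs_of_pos (Real.exp_pos _)]
    simp only [Fin.cons_zero, Fin.cons_succ, one_mul] at h1 ⊢
    rwa [add_comm]
  · rw [flow, Fin.cons_succ, Fin.cons_succ, Real.norm_eq_abs, abs_mul,
      abs_of_pos (Real.exp_pos _)]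
    refine lt_of_le_of_lt ?_ h2
    rw [show -(1 / (n : ℝ)) * t = -t / n by ring]
    exact mul_le_mul_of_nonneg_left (norm_le_pi_norm (fun i => (q i : ℝ)) i) (Real.exp_pos _).le

theorem finite_setOf_norm_intCast_le {n : ℕ} (N : ℝ) :
    {q : Fin n → ℤ | ‖(fun i => (q i : ℝ) : Fin n → ℝ)‖ ≤ N}.Finite := by
  refine (Set.Finite.pi' fun _ : Fin n => Set.finite_Icc (-⌈N⌉) ⌈N⌉).subset fun q hq i => ?_
  have h1 : |(q i : ℝ)| ≤ N := (norm_le_pi_norm (fun i => (q i : ℝ)) i).trans hq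
  have h2 : |(q i : ℝ)| ≤ ⌈N⌉ := h1.trans (Int.le_ceil N)
  rw [abs_le] at h2
  exact ⟨by exact_mod_cast h2.1, by exact_mod_cast h2.2⟩

theorem not_isVWA_of_eventually {n : ℕ} (hn : n ≠ 0) {y : Fin n → ℝ}
    (h : ∀ N : ℕ, ∃ K : ℝ, 0 < K ∧ ∃ T : ℕ, ∀ t : ℕ, T ≤ t → ∀ u : Fin (n + 1) → ℤ, u ≠ 0 →
      K * Real.exp (-(2 * (1 / ((N : ℝ) + 1))) * t) ≤ ‖flow t y fun i => (u i : ℝ)‖) :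
    ¬ IsVWA y := by
  rintro ⟨v, hv, hinf⟩
  have hn0 : (0 : ℝ) < n := by exact_mod_cast Nat.pos_of_ne_zero hn
  obtain ⟨β, hβ, H⟩ := exists_time_of_le_rpow (a := 1 / (n : ℝ)) (b := 1) (v := v) (by positivity)
    one_pos (by simpa using hv)
  obtain ⟨N, hN⟩ := exists_nat_one_div_lt (half_pos hβ)
  obtain ⟨K, hK, T, hT⟩ := h N
  obtain ⟨X, hX1, hX⟩ := H K hK T
  obtain ⟨q, hq, hqX⟩ := (hinf.sdiff (finite_setOf_norm_intCast_le (n := n) X)).nonempty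
  obtain ⟨p, hp⟩ := hq
  have hqX' : X < ‖(fun i => (q i : ℝ) : Fin n → ℝ)‖ := not_le.1 hqX
  obtain ⟨t, htT, h1, h2⟩ := hX _ hqX' _ hp
  have hu : (Fin.cons p q : Fin (n + 1) → ℤ) ≠ 0 := by
    intro h0
    have hq0 : (fun i => (q i : ℝ) : Fin n → ℝ) = 0 := by
      ext i
      have := congrFun h0 i.succ
      simpa using this
    rw [hq0, norm_zero] at hqX'
    linarith
  have h3 := hT t (by exact_mod_cast htT) _ hu
  have h4 := norm_flow_cons_lt (mul_pos hK (Real.exp_pos _)) h1 h2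
  refine absurd (h3.trans_lt h4) (not_lt.2 ?_)
  refine mul_le_mul_of_nonneg_left (Real.exp_le_exp.2 ?_) hK.le
  have : (0 : ℝ) ≤ t := Nat.cast_nonneg t
  nlinarith

theorem isExtremal_of_criterion {s m : ℕ} (hn : s + m ≠ 0)
    (A : Matrix (Fin (s + 1)) (Fin m) ℝ)
    (h : ∀ β : ℝ, 0 < β → ∃ T : ℝ, 0 < T ∧ ∀ t : ℝ, T ≤ t → ∀ j : ℕ, 1 ≤ j → j ≤ s + m →
      ∀ w : Finset (Fin (s + m + 1)) → ℝ, IsPrim j w →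
        Real.exp (-β * t) ≤ criterionMax A t j w) :
    IsExtremal (Set.univ : Set (Fin s → ℝ)) (affineParam A) := by
  have hnull := fun N : ℕ => ae_eventually_le_norm_flow hn A (β := 1 / ((N : ℝ) + 1))
    (by positivity) (h _ (by positivity))
  refine measure_mono_null (fun y hy => ?_) (measure_iUnion_null hnull)
  by_contra hmem
  rw [Set.mem_iUnion, not_exists] at hmem
  exact not_isVWA_of_eventually hn (fun N => not_not.1 (hmem N)) hy.2

theorem inW_of_exists_integer_relation {n : ℕ} {y : Fin n → ℝ} (v : ℝ) {q : Fin n → ℤ}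
    (hq : q ≠ 0) {p : ℤ} (h : ∑ i, y i * (q i : ℝ) + p = 0) : InW y v := by
  have hinj : Function.Injective fun k : ℤ => k • q := fun k l hkl => by
    obtain ⟨i, hi⟩ := Function.ne_iff.1 hq
    exact mul_right_cancel₀ hi (by simpa using congrFun hkl i)
  refine (Set.infinite_range_of_injective hinj).mono ?_
  rintro _ ⟨k, rfl⟩
  refine ⟨k * p, ?_⟩
  have : ∑ i, y i * (((k • q) i : ℤ) : ℝ) + ((k * p : ℤ) : ℝ) = k * (∑ i, y i * (q i : ℝ) + p) := by
    rw [mul_add, Finset.mul_sum]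
    push_cast
    congr 1
    refine Finset.sum_congr rfl fun i _ => ?_
    simp
    ring
  rw [this, h, mul_zero, abs_zero]
  exact Real.rpow_nonneg (norm_nonneg _) _

theorem inW_of_forall_exists {n : ℕ} {y : Fin n → ℝ} {v : ℝ}
    (h : ∀ δ : ℝ, 0 < δ → ∃ q : Fin n → ℤ, q ≠ 0 ∧ ∃ p : ℤ,
      |∑ i, y i * (q i : ℝ) + p| ≤ ‖(fun i => (q i : ℝ) : Fin n → ℝ)‖ ^ (-v) ∧
      |∑ i, y i * (q i : ℝ) + p| < δ) : InW y v := by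
  by_cases hrel : ∃ q : Fin n → ℤ, q ≠ 0 ∧ ∃ p : ℤ, ∑ i, y i * (q i : ℝ) + p = 0
  · obtain ⟨q, hq, p, hp⟩ := hrel
    exact inW_of_exists_integer_relation v hq hp
  push Not at hrel
  intro hfin
  set d : (Fin n → ℤ) → ℝ := fun q =>
    |∑ i, y i * (q i : ℝ) - round (∑ i, y i * (q i : ℝ))| with hd
  have hdpos : ∀ q, q ≠ 0 → 0 < d q := fun q hq => by
    rw [hd, abs_pos]
    have := hrel q hq (-round (∑ i, y i * (q i : ℝ)))
    push_cast at this
    rwa [← sub_eq_add_neg] at this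
  have hdle : ∀ (q : Fin n → ℤ) (p : ℤ), d q ≤ |∑ i, y i * (q i : ℝ) + p| := fun q p => by
    have := round_le (∑ i, y i * (q i : ℝ)) (-p)
    push_cast at this
    rwa [sub_neg_eq_add] at this
  have hev : ∀ᶠ δ : ℝ in nhdsWithin 0 (Set.Ioi 0), ∀ q ∈ {q : Fin n → ℤ | ∃ p : ℤ,
      |(∑ i, y i * (q i : ℝ)) + (p : ℝ)| ≤ ‖(fun i => (q i : ℝ) : Fin n → ℝ)‖ ^ (-v)},
      q ≠ 0 → δ < d q := by
    refine (Filter.eventually_all_finite (Set.not_infinite.1 (not_not.2 hfin))).2 fun q _ => ?_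
    by_cases hq : q = 0
    · exact Filter.Eventually.of_forall fun δ h => absurd hq h
    · filter_upwards [Ioo_mem_nhdsGT (hdpos q hq)] with δ hδ _ using hδ.2
  obtain ⟨δ, hδ, hδ0⟩ := (hev.and self_mem_nhdsWithin).exists
  obtain ⟨q, hq, p, h1, h2⟩ := h δ hδ0
  exact absurd (hdle q p) (not_le.2 (h2.trans (hδ q ⟨p, h1⟩ hq)))

theorem isVWA_of_exists_norm_flow_lt {n : ℕ} (hn : n ≠ 0) {y : Fin n → ℝ} {β : ℝ} (hβ : 0 < β)
    (h : ∀ T : ℝ, 0 < T → ∃ t : ℝ, T ≤ t ∧ ∃ u : Fin (n + 1) → ℤ, u ≠ 0 ∧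
      ‖flow t y fun i => (u i : ℝ)‖ < Real.exp (-β * t)) : IsVWA y := by
  have hn0 : (0 : ℝ) < n := by exact_mod_cast Nat.pos_of_ne_zero hn
  refine ⟨(1 + β) / (1 / n), ?_, inW_of_forall_exists fun δ hδ => ?_⟩
  · rw [lt_div_iff₀ (by positivity)]
    field_simp
    linarith
  obtain ⟨t, ht, u, hu, hlt⟩ := h (max 1 (-Real.log δ)) (by positivity)
  have ht1 : 1 ≤ t := (le_max_left _ _).trans ht
  have hle1 : Real.exp (-β * t) ≤ 1 := Real.exp_le_one_iff.2 (by nlinarith)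
  have h0 : Real.exp (1 * t) * |∑ i, y i * (u i.succ : ℝ) + u 0| < Real.exp (-β * t) := by
    have := (norm_le_pi_norm _ 0).trans_lt hlt
    rw [flow, Fin.cons_zero, Fin.sum_univ_succ, Real.norm_eq_abs, abs_mul,
      abs_of_pos (Real.exp_pos _)] at this
    simp only [Fin.cons_zero, Fin.cons_succ, one_mul] at this ⊢
    rwa [add_comm] at this
  have h1 : Real.exp (-(1 / (n : ℝ)) * t) * ‖(fun i => (u (Fin.succ i) : ℝ) : Fin n → ℝ)‖ <
      Real.exp (-β * t) := by
    rw [← abs_of_pos (Real.exp_pos (-(1 / (n : ℝ)) * t)), ← Real.norm_eq_abs, ← norm_smul]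
    refine (pi_norm_lt_iff (Real.exp_pos _)).2 fun i => ?_
    have := (norm_le_pi_norm _ i.succ).trans_lt hlt
    rw [flow, Fin.cons_succ] at this
    rw [Pi.smul_apply, smul_eq_mul]
    rwa [show -(1 / (n : ℝ)) * t = -t / n by ring]
  have hexp1 : 1 ≤ Real.exp (1 * t) := Real.one_le_exp (by linarith)
  have hq : (fun i => u (Fin.succ i)) ≠ 0 := by
    intro hq
    have hq' : ∀ i, u (Fin.succ i) = 0 := fun i => congrFun hq i
    have hp : u 0 ≠ 0 := by
      intro hp
      refine hu (funext fun i => ?_)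
      refine Fin.cases hp hq' i
    simp only [hq', Int.cast_zero, mul_zero, Finset.sum_const_zero, zero_add] at h0
    have : (1 : ℝ) ≤ |(u 0 : ℝ)| := by exact_mod_cast Int.one_le_abs hp
    nlinarith
  have hC : 1 ≤ ‖(fun i => (u (Fin.succ i) : ℝ) : Fin n → ℝ)‖ := by
    obtain ⟨i, hi⟩ := Function.ne_iff.1 hq
    refine le_trans ?_ (norm_le_pi_norm _ i)
    rw [Real.norm_eq_abs]
    exact_mod_cast Int.one_le_abs hi
  refine ⟨_, hq, u 0,
    (lt_rpow_of_exp_mul_lt (by positivity) one_pos hβ (by linarith) hC h0 h1).le, ?_⟩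
  have h3 : Real.exp (-Real.log δ) ≤ Real.exp (1 * t) :=
    Real.exp_le_exp.2 (by rw [one_mul]; exact (le_max_right _ _).trans ht)
  rw [Real.exp_neg, Real.exp_log hδ] at h3
  have h4 : δ⁻¹ * |∑ i, y i * (u i.succ : ℝ) + u 0| < 1 :=
    (mul_le_mul_of_nonneg_right h3 (abs_nonneg _)).trans_lt (h0.trans_le hle1)
  rwa [inv_mul_lt_iff₀ hδ, mul_one] at h4

theorem minorNorm_flowFamily_pos {s m j : ℕ} (hn : s + m ≠ 0)
    (A : Matrix (Fin (s + 1)) (Fin m) ℝ) (t : ℝ) {v : Fin j → Fin (s + m + 1) → ℤ}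
    (hv : LinearIndependent ℤ v) (x : Fin s → ℝ) : 0 < minorNorm (flowFamily A t v x) := by
  by_cases hex : ∃ σ : Fin j → Fin (s + m + 1), (∀ b, σ b ≠ 0) ∧ colMinor v σ ≠ 0
  · obtain ⟨σ, h0, hσ⟩ := hex
    refine lt_of_lt_of_le ?_ (abs_colMinor_le _ σ)
    unfold flowFamily
    rw [colMinor_flow_of_ne_zero t _ _ h0, abs_pos, colMinor_intCast]
    exact mul_ne_zero (Real.exp_pos _).ne' (by exact_mod_cast hσ)
  push Not at hex
  obtain ⟨σ, hσ⟩ := exists_colMinor_intCast_ne_zero hv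
  have hinj : Function.Injective σ := by
    by_contra h
    exact hσ (colMinor_eq_zero_of_not_injective v h)
  obtain ⟨b₀, hb₀⟩ : ∃ b₀, σ b₀ = 0 := by
    by_contra! h
    exact hσ (hex σ h)
  have hne : ∀ b ≠ b₀, σ b ≠ 0 := fun b hb hb' => hb (hinj (hb'.trans hb₀.symm))
  refine lt_of_lt_of_le ?_ (abs_colMinor_le _ σ)
  unfold flowFamily
  rw [colMinor_flow_of_eq_zero hn t _ _ hb₀ hne, abs_pos, Finset.sum_eq_single 0]
  · rw [Fin.cons_zero, one_mul, ← hb₀, Function.update_eq_self, colMinor_intCast]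
    exact mul_ne_zero (Real.exp_pos _).ne' (by exact_mod_cast hσ)
  · intro i _ hi
    rw [colMinor_intCast, hex, Int.cast_zero, mul_zero]
    intro b
    by_cases hb : b = b₀
    · rwa [hb, Function.update_self]
    · rw [Function.update_of_ne hb]
      exact hne b hb
  · simp

theorem exists_norm_flow_le {s m j : ℕ} (hn : s + m ≠ 0) (hj : 1 ≤ j) (hjn : j ≤ s + m)
    (A : Matrix (Fin (s + 1)) (Fin m) ℝ) {t β : ℝ} (hβt : 0 ≤ β * t)
    {w : Finset (Fin (s + m + 1)) → ℝ} (hw : IsPrim j w)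
    (h : criterionMax A t j w < Real.exp (-β * t)) (x : Fin s → ℝ) :
    ∃ u : Fin (s + m + 1) → ℤ, u ≠ 0 ∧ ‖flow t (affineParam A x) fun i => (u i : ℝ)‖ ≤
      (s + m) * (1 + ∑ i, |(Fin.cons 1 x : Fin (s + 1) → ℝ) i|) *
        Real.exp (-(β / (s + m)) * t) := by
  obtain ⟨v, hv, hw⟩ := hw
  obtain ⟨c, hc, hle⟩ := exists_short_linear_comb hj _ (minorNorm_flowFamily_pos hn A t hv x)
  set C := 1 + ∑ i, |(Fin.cons 1 x : Fin (s + 1) → ℝ) i| with hC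
  have hC1 : 1 ≤ C := by
    have : 0 ≤ ∑ i, |(Fin.cons 1 x : Fin (s + 1) → ℝ) i| :=
      Finset.sum_nonneg fun _ _ => abs_nonneg _
    linarith
  have hj0 : (0 : ℝ) < j := by exact_mod_cast hj
  have hjn' : (j : ℝ) ≤ s + m := by exact_mod_cast hjn
  have hflow : flow t (affineParam A x) (fun i => ((∑ a, c a • v a) i : ℝ)) =
      ∑ a, (c a : ℝ) • flowFamily A t v x a := by
    unfold flowFamily
    rw [← flow_sum_smul]
    congr 1
    ext i
    simp
  refine ⟨∑ a, c a • v a, fun h0 => hc (funext (Fintype.linearIndependent_iff.1 hv c h0)), ?_⟩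
  rw [hflow]
  have hδ : minorNorm (flowFamily A t v x) ≤ C * Real.exp (-β * t) :=
    (minorNorm_flowFamily_le hn hj A t v x hw).trans
      (mul_le_mul_of_nonneg_left h.le (by linarith))
  have hroot : minorNorm (flowFamily A t v x) ^ ((1 : ℝ) / j) ≤
      C * Real.exp (-(β / (s + m)) * t) := by
    refine (Real.rpow_le_rpow (minorNorm_nonneg _) hδ (by positivity)).trans ?_
    rw [Real.mul_rpow (by linarith) (Real.exp_pos _).le, ← Real.exp_mul]
    refine mul_le_mul ?_ (Real.exp_le_exp.2 ?_) (Real.exp_pos _).le (by linarith)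
    · refine (Real.rpow_le_rpow_of_exponent_le hC1 (y := (1 : ℝ) / j) (z := 1) ?_).trans
        (Real.rpow_one C).le
      rw [div_le_one hj0]
      exact_mod_cast hj
    · have : β * t / (s + m) ≤ β * t / j := div_le_div_of_nonneg_left hβt hj0 hjn'
      calc -β * t * (1 / j) = -(β * t / j) := by ring
        _ ≤ -(β * t / (s + m)) := neg_le_neg this
        _ = _ := by ring
  have hE : 0 ≤ C * Real.exp (-(β / (s + m)) * t) := mul_nonneg (by linarith) (Real.exp_pos _).le
  refine (pi_norm_le_iff_of_nonneg (by positivity)).2 fun i => ?_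
  rw [Finset.sum_apply, Real.norm_eq_abs]
  refine (hle i).trans ?_
  rw [mul_assoc]
  exact mul_le_mul hjn' hroot (Real.rpow_nonneg (minorNorm_nonneg _) _) (by positivity)

theorem criterion_of_isExtremal {s m : ℕ} (hn : s + m ≠ 0)
    (A : Matrix (Fin (s + 1)) (Fin m) ℝ)
    (h : IsExtremal (Set.univ : Set (Fin s → ℝ)) (affineParam A)) :
    ∀ β : ℝ, 0 < β → ∃ T : ℝ, 0 < T ∧ ∀ t : ℝ, T ≤ t → ∀ j : ℕ, 1 ≤ j → j ≤ s + m →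
      ∀ w : Finset (Fin (s + m + 1)) → ℝ, IsPrim j w →
        Real.exp (-β * t) ≤ criterionMax A t j w := by
  by_contra! hcon
  obtain ⟨β, hβ, H⟩ := hcon
  have hn0 : (0 : ℝ) < s + m := by exact_mod_cast Nat.pos_of_ne_zero hn
  have hall : ∀ x, IsVWA (affineParam A x) := by
    intro x
    set β' := β / (s + m) / 2 with hβ'
    have hβ'0 : 0 < β' := by positivity
    refine isVWA_of_exists_norm_flow_lt hn hβ'0 fun T hT => ?_
    set C := (s + m) * (1 + ∑ i, |(Fin.cons 1 x : Fin (s + 1) → ℝ) i|) with hC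
    have hC0 : 0 < C := by
      have : 0 ≤ ∑ i, |(Fin.cons 1 x : Fin (s + 1) → ℝ) i| :=
        Finset.sum_nonneg fun _ _ => abs_nonneg _
      positivity
    obtain ⟨t, ht, j, hj, hjn, w, hw, hlt⟩ := H (max T (Real.log C / β' + 1))
      (lt_max_of_lt_left hT)
    have htT : T ≤ t := (le_max_left _ _).trans ht
    obtain ⟨u, hu, hle⟩ := exists_norm_flow_le hn hj hjn A (mul_nonneg hβ.le (hT.le.trans htT))
      hw hlt x
    refine ⟨t, htT, u, hu, hle.trans_lt ?_⟩
    have h1 : Real.log C < t * β' := by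
      rw [← div_lt_iff₀ hβ'0]
      linarith [(le_max_right _ _).trans ht]
    rw [← hC]
    nth_rewrite 1 [← Real.exp_log hC0]
    rw [← Real.exp_add, Real.exp_lt_exp, show β / (s + m) = 2 * β' by rw [hβ']; ring]
    linarith
  have : {x ∈ (Set.univ : Set (Fin s → ℝ)) | IsVWA (affineParam A x)} = Set.univ :=
    Set.eq_univ_of_forall fun x => ⟨Set.mem_univ x, hall x⟩
  rw [IsExtremal, this] at h
  exact (isOpen_univ.measure_pos volume Set.univ_nonempty).ne' h

theorem lt_maxNormA_of_criterion {s m : ℕ} (hn : s + m ≠ 0)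
    (A : Matrix (Fin (s + 1)) (Fin m) ℝ)
    (h : ∀ β : ℝ, 0 < β → ∃ T : ℝ, 0 < T ∧ ∀ t : ℝ, T ≤ t → ∀ j : ℕ, 1 ≤ j → j ≤ s + m →
      ∀ w : Finset (Fin (s + m + 1)) → ℝ, IsPrim j w →
        Real.exp (-β * t) ≤ criterionMax A t j w) :
    ∀ j : ℕ, 1 ≤ j → j ≤ s + m → ∀ v : ℝ, ((s : ℝ) + m + 1 - j) / j < v →
      ∃ N : ℝ, 0 < N ∧ ∀ w : Finset (Fin (s + m + 1)) → ℝ, IsPrim j w →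
        N < maxCoeff j w → (maxCoeff j w) ^ (-v) < maxNormA A j w := by
  intro j hj hjn v hv
  have hn0 : (0 : ℝ) < s + m := by exact_mod_cast Nat.pos_of_ne_zero hn
  have hj0 : (0 : ℝ) < j := by exact_mod_cast hj
  have hjn' : (j : ℝ) ≤ s + m := by exact_mod_cast hjn
  obtain ⟨β, hβ, H⟩ := exists_time_of_le_rpow (a := (j : ℝ) / (s + m))
    (b := ((s : ℝ) + m + 1 - j) / (s + m)) (v := v) (by positivity)
    (div_pos (by linarith) hn0) (by rwa [div_div_div_cancel_right₀ hn0.ne'])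
  obtain ⟨T, -, hT⟩ := h β hβ
  obtain ⟨N, hN1, hN⟩ := H 1 one_pos T
  refine ⟨N, by linarith, fun w hw hwN => ?_⟩
  by_contra! hle
  obtain ⟨t, htT, h1, h2⟩ := hN _ hwN _ hle
  rw [one_mul] at h1 h2
  exact absurd (hT t htT j hj hjn w hw) (not_le.2 (max_lt h1 h2))

theorem cIw_mul {k : ℕ} (a : ℝ) (w : Finset (Fin (k + 1)) → ℝ) (I : Finset (Fin (k + 1))) :
    cIw (fun J => a * w J) I = a • cIw w I := by
  ext i
  simp only [cIw, Pi.smul_apply, smul_eq_mul]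
  split_ifs
  · rfl
  · simp
  · ring

theorem reduceVec_smul {s m : ℕ} (A : Matrix (Fin (s + 1)) (Fin m) ℝ) (a : ℝ)
    (c : Fin (s + m + 1) → ℝ) : reduceVec A (a • c) = a • reduceVec A c := by
  ext i
  have h := congrFun (Matrix.mulVec_smul A a
    fun r : Fin m => c (Fin.cast (by omega) (Fin.natAdd (s + 1) r))) i
  rw [Pi.smul_apply, smul_eq_mul] at h
  simp only [Pi.smul_apply, smul_eq_mul, reduceVec, mul_add]
  rw [← h]
  rfl

theorem maxNormA_mul {s m j : ℕ} (A : Matrix (Fin (s + 1)) (Fin m) ℝ) {a : ℝ} (ha : 0 ≤ a)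
    (w : Finset (Fin (s + m + 1)) → ℝ) :
    maxNormA A j (fun J => a * w J) = a * maxNormA A j w := by
  have h : ∀ I : {I : Finset (Fin (s + m + 1)) // 0 ∈ I ∧ I.card = j},
      ‖reduceVec A (cIw (fun J => a * w J) I.1)‖ = a * ‖reduceVec A (cIw w I.1)‖ := fun I => by
    rw [cIw_mul, reduceVec_smul, norm_smul, Real.norm_of_nonneg ha]
  exact (iSup_congr h).trans (Real.mul_iSup_of_nonneg ha _).symm

theorem maxCoeff_mul {n j : ℕ} {a : ℝ} (ha : 0 ≤ a) (w : Finset (Fin (n + 1)) → ℝ) :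
    maxCoeff j (fun J => a * w J) = a * maxCoeff j w := by
  have h : ∀ I : {I : Finset (Fin (n + 1)) // 0 ∉ I ∧ I.card = j},
      |a * w I.1| = a * |w I.1| := fun I => by rw [abs_mul, abs_of_nonneg ha]
  exact (iSup_congr h).trans (Real.mul_iSup_of_nonneg ha _).symm

theorem IsPrim.pow_mul {k j : ℕ} {w : Finset (Fin k) → ℝ} (hw : IsPrim j w) {a : ℤ} (ha : a ≠ 0) :
    IsPrim j (fun J => (a : ℝ) ^ j * w J) := by
  obtain ⟨v, hv, hw⟩ := hw
  refine ⟨fun i => a • v i, ?_, fun I => ?_⟩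
  · exact hv.map_injOn (LinearMap.lsmul ℤ (Fin k → ℤ) a)
      (fun x _ y _ hxy => smul_right_injective _ ha hxy)
  · simp only [hw, minorDet]
    split_ifs with h
    · have : (Matrix.of fun i b : Fin j => (a • v i) ((I.orderIsoOfFin h) b : Fin k)) =
          a • Matrix.of fun i b : Fin j => v i ((I.orderIsoOfFin h) b : Fin k) := by
        ext i b
        simp
      rw [this, Matrix.det_smul, Fintype.card_fin]
      push_cast
      rfl
    · simp

theorem abs_coeff_le {s m j : ℕ} (A : Matrix (Fin (s + 1)) (Fin m) ℝ)
    (w : Finset (Fin (s + m + 1)) → ℝ) {I : Finset (Fin (s + m + 1))} (hI : I.card = j) :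
    |w I| ≤ maxNormA A j w + (1 + ∑ r, |A 0 r|) * maxCoeff j w := by
  have hM := maxNormA_nonneg A j w
  have hC := maxCoeff_nonneg j w
  have hA : 0 ≤ ∑ r, |A 0 r| := Finset.sum_nonneg fun _ _ => abs_nonneg _
  by_cases h0 : 0 ∈ I
  · have h1 := (norm_le_pi_norm (reduceVec A (cIw w I)) 0).trans (norm_reduceVec_le_maxNormA A w h0 hI)
    have h2 : cIw w I (Fin.castLE (by omega : s + 1 ≤ s + m + 1) 0) = w I := if_pos rfl
    rw [reduceVec, h2, Real.norm_eq_abs] at h1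
    set c : Fin m → ℝ := fun r => cIw w I (Fin.cast (by omega) (Fin.natAdd (s + 1) r)) with hc
    have h3 : ‖c‖ ≤ maxCoeff j w := by
      refine (pi_norm_le_iff_of_nonneg hC).2 fun r => ?_
      simp only [hc, cIw]
      split_ifs with h4 h5
      · exact absurd (congrArg Fin.val h4) (by simp)
      · rwa [norm_zero]
      · rw [norm_mul, norm_pow, norm_neg, norm_one, one_pow, one_mul]
        refine abs_le_maxCoeff w (Finset.notMem_erase _ _) ?_
        rw [Finset.card_erase_of_mem (Finset.mem_insert_of_mem h0),
          Finset.card_insert_of_notMem h5, hI]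
        rfl
    have h4 : |A.mulVec c 0| ≤ (∑ r, |A 0 r|) * maxCoeff j w :=
      (abs_sum_mul_le_sum_abs_mul_norm (A 0) c).trans (mul_le_mul_of_nonneg_left h3 hA)
    have h5 : |w I| ≤ |w I + A.mulVec c 0| + |A.mulVec c 0| := by
      have := abs_sub (w I + A.mulVec c 0) (A.mulVec c 0)
      rwa [add_sub_cancel_right] at this
    nlinarith
  · have := abs_le_maxCoeff w h0 hI
    nlinarith

theorem maxCoeff_pos_of_maxNormA_eq_zero {s m j : ℕ} (A : Matrix (Fin (s + 1)) (Fin m) ℝ)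
    {w : Finset (Fin (s + m + 1)) → ℝ} (hw : IsPrim j w) (h : maxNormA A j w = 0) :
    0 < maxCoeff j w := by
  refine lt_of_le_of_ne (maxCoeff_nonneg j w) fun hC => ?_
  obtain ⟨v, hv, hw⟩ := hw
  obtain ⟨σ, hσ⟩ := exists_colMinor_intCast_ne_zero hv
  have hinj : Function.Injective σ := by
    by_contra hinj
    exact hσ (colMinor_eq_zero_of_not_injective v hinj)
  obtain ⟨I, hI, heq⟩ := exists_abs_colMinor_eq_orderEmbOfFin (fun a i => (v a i : ℝ)) hinj
  rw [colMinor_intCast, colMinor_intCast, ← minorDet_eq_colMinor v hI, ← hw] at heq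
  have := abs_coeff_le A w hI
  rw [h, ← hC, mul_zero, add_zero, ← heq] at this
  exact hσ (by exact_mod_cast abs_nonpos_iff.1 this)

theorem finite_setOf_isPrim_le {s m : ℕ} (A : Matrix (Fin (s + 1)) (Fin m) ℝ) (j : ℕ) (N : ℝ) :
    {w : Finset (Fin (s + m + 1)) → ℝ | IsPrim j w ∧ maxNormA A j w ≤ 1 ∧
      maxCoeff j w ≤ N}.Finite := by
  set R := ⌈1 + (1 + ∑ r, |A 0 r|) * |N|⌉ with hR
  have hR0 : 0 ≤ R := Int.ceil_nonneg (by
    have : 0 ≤ ∑ r, |A 0 r| := Finset.sum_nonneg fun _ _ => abs_nonneg _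
    positivity)
  refine ((Set.Finite.pi' fun _ : Finset (Fin (s + m + 1)) => Set.finite_Icc (-R) R).image
    fun f I => (f I : ℝ)).subset ?_
  rintro w ⟨⟨v, hv, hw⟩, hM, hC⟩
  refine ⟨fun I => minorDet v I, fun I => ?_, funext fun I => (hw I).symm⟩
  by_cases hI : I.card = j
  · have h1 := abs_coeff_le A w hI
    have hA : 0 ≤ ∑ r, |A 0 r| := Finset.sum_nonneg fun _ _ => abs_nonneg _
    have h2 : |w I| ≤ R := by
      refine h1.trans (le_trans ?_ (Int.le_ceil _))
      have := hC.trans (le_abs_self N)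
      gcongr
    rw [hw, abs_le] at h2
    exact ⟨by exact_mod_cast h2.1, by exact_mod_cast h2.2⟩
  · have : minorDet v I = 0 := dif_neg hI
    simp only [this, Set.mem_Icc]
    omega

theorem criterion_of_lt_maxNormA {s m : ℕ} (hn : s + m ≠ 0)
    (A : Matrix (Fin (s + 1)) (Fin m) ℝ)
    (h : ∀ j : ℕ, 1 ≤ j → j ≤ s + m → ∀ v : ℝ, ((s : ℝ) + m + 1 - j) / j < v →
      ∃ N : ℝ, 0 < N ∧ ∀ w : Finset (Fin (s + m + 1)) → ℝ, IsPrim j w →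
        N < maxCoeff j w → (maxCoeff j w) ^ (-v) < maxNormA A j w) :
    ∀ β : ℝ, 0 < β → ∃ T : ℝ, 0 < T ∧ ∀ t : ℝ, T ≤ t → ∀ j : ℕ, 1 ≤ j → j ≤ s + m →
      ∀ w : Finset (Fin (s + m + 1)) → ℝ, IsPrim j w →
        Real.exp (-β * t) ≤ criterionMax A t j w := by
  intro β hβ
  have hn0 : (0 : ℝ) < s + m := by exact_mod_cast Nat.pos_of_ne_zero hn
  have hne : ∀ j : ℕ, 1 ≤ j → j ≤ s + m → ∀ w : Finset (Fin (s + m + 1)) → ℝ, IsPrim j w →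
      0 < maxNormA A j w := by
    intro j hj hjn w hw
    refine lt_of_le_of_ne (maxNormA_nonneg A j w) fun h0 => ?_
    have hC := maxCoeff_pos_of_maxNormA_eq_zero A hw h0.symm
    obtain ⟨N, hN, hNw⟩ := h j hj hjn _ (lt_add_one _)
    obtain ⟨a, ha⟩ := exists_nat_gt (N / maxCoeff j w)
    have ha0 : (0 : ℝ) < a := lt_trans (by positivity) ha
    have ha1 : (1 : ℝ) ≤ a := by exact_mod_cast (Nat.cast_pos.1 ha0 : 0 < a)
    have hw' := hw.pow_mul (a := (a : ℤ)) (by exact_mod_cast ha0.ne')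
    rw [Int.cast_natCast] at hw'
    have hlt := hNw _ hw' (by
      rw [maxCoeff_mul (by positivity)]
      rw [div_lt_iff₀ hC] at ha
      refine ha.trans_le (mul_le_mul_of_nonneg_right ?_ hC.le)
      exact le_self_pow₀ ha1 (by omega))
    rw [maxNormA_mul A (by positivity), ← h0, mul_zero] at hlt
    exact absurd hlt (not_lt.2 (Real.rpow_nonneg (maxCoeff_nonneg _ _) _))
  have hT : ∀ j : ℕ, 1 ≤ j → j ≤ s + m → ∀ᶠ t : ℝ in Filter.atTop,
      ∀ w : Finset (Fin (s + m + 1)) → ℝ, IsPrim j w →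
        Real.exp (-β * t) ≤ criterionMax A t j w := by
    intro j hj hjn
    have hj0 : (0 : ℝ) < j := by exact_mod_cast hj
    have hjn' : (j : ℝ) ≤ s + m := by exact_mod_cast hjn
    set a : ℝ := (j : ℝ) / (s + m) with ha
    set b : ℝ := ((s : ℝ) + m + 1 - j) / (s + m) with hb
    have ha0 : 0 < a := by positivity
    have hb0 : 0 < b := div_pos (by linarith) hn0
    obtain ⟨N, hN, hNw⟩ := h j hj hjn ((b + β) / a) (by
      rw [← div_div_div_cancel_right₀ hn0.ne' _ (j : ℝ)]
      exact div_lt_div_of_pos_right (by linarith) ha0)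
    have hfin := finite_setOf_isPrim_le A j (max N 1)
    have hlim : Filter.Tendsto (fun t => Real.exp (-β * t)) Filter.atTop (nhds 0) :=
      Real.tendsto_exp_atBot.comp (Filter.tendsto_id.const_mul_atTop_of_neg (by linarith))
    have hev := (Filter.eventually_all_finite hfin).2 fun w hw =>
      hlim.eventually (gt_mem_nhds (hne j hj hjn w hw.1))
    filter_upwards [hev, Filter.eventually_ge_atTop 0] with t ht ht0 w hw
    by_contra! hlt
    have hM : Real.exp (b * t) * maxNormA A j w < Real.exp (-β * t) :=
      (le_max_left _ _).trans_lt hlt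
    have hC : Real.exp (-a * t) * maxCoeff j w < Real.exp (-β * t) :=
      (le_max_right _ _).trans_lt hlt
    have hle1 : Real.exp (-β * t) ≤ 1 := Real.exp_le_one_iff.2 (by nlinarith)
    have hM' : maxNormA A j w < Real.exp (-β * t) := by
      refine lt_of_le_of_lt ?_ hM
      exact le_mul_of_one_le_left (maxNormA_nonneg A j w) (Real.one_le_exp (by positivity))
    by_cases hCN : maxCoeff j w ≤ max N 1
    · exact absurd (ht w ⟨hw, (hM'.trans_le hle1).le, hCN⟩) (not_lt.2 hM'.le)
    · rw [not_le, max_lt_iff] at hCN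
      have h1 := lt_rpow_of_exp_mul_lt ha0 hb0 hβ ht0 hCN.2.le hM hC
      exact absurd (hNw w hw hCN.1) (not_lt.2 h1.le)
  have hall : ∀ᶠ t : ℝ in Filter.atTop, ∀ j ∈ Finset.Icc 1 (s + m),
      ∀ w : Finset (Fin (s + m + 1)) → ℝ, IsPrim j w →
        Real.exp (-β * t) ≤ criterionMax A t j w :=
    (Filter.eventually_all_finset _).2 fun j hj =>
      hT j (Finset.mem_Icc.1 hj).1 (Finset.mem_Icc.1 hj).2
  obtain ⟨T, hT⟩ := Filter.eventually_atTop.1 hall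
  exact ⟨max T 1, by positivity, fun t ht j hj hjn =>
    hT t ((le_max_left _ _).trans ht) j (Finset.mem_Icc.2 ⟨hj, hjn⟩)⟩

/-- **Theorem 4.3.** Let `L` be the `s`-dimensional affine subspace of `ℝ^n` (`n = s + m`,
`1 ≤ s`, `1 ≤ m`) parametrized by `x ↦ (x, x̃A)`, `A ∈ M_{s+1,n-s}(ℝ)`. Then the following
are equivalent: (i) `L` is extremal; (ii) for every `β > 0` there is `T > 0` such that for
all `t ≥ T`, `j = 1,…,n`, `w ∈ S_{n+1,j}`,
`max(e^{((n+1-j)/n)t} max_{I∋0} ‖c_{I,w}^+ + A c_{I,w}^-‖, e^{-(j/n)t} max_{I∌0} |w_I|) ≥ e^{-βt}`;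
(iii) for every `j = 1,…,n` and `v > (n+1-j)/j` there is `N > 0` such that every
`w ∈ S_{n+1,j}` with `max_{I∌0} |w_I| > N` satisfies
`max_{I∋0} ‖c_{I,w}^+ + A c_{I,w}^-‖ > (max_{I∌0} |w_I|)^{-v}`. -/
theorem extremality_criterion_matrix_A (s m : ℕ) (hs : 1 ≤ s) (hm : 1 ≤ m)
    (A : Matrix (Fin (s + 1)) (Fin m) ℝ) :
    (IsExtremal (Set.univ : Set (Fin s → ℝ))
        (fun x => Fin.append x (Matrix.vecMul (Fin.cons 1 x) A)) ↔
      (∀ β : ℝ, 0 < β → ∃ T : ℝ, 0 < T ∧ ∀ t : ℝ, T ≤ t →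
        ∀ j : ℕ, 1 ≤ j → j ≤ s + m → ∀ w : Finset (Fin (s + m + 1)) → ℝ, IsPrim j w →
          Real.exp (-β * t) ≤
            max (Real.exp ((((s : ℝ) + m + 1 - j) / ((s : ℝ) + m)) * t) * maxNormA A j w)
                (Real.exp (-((j : ℝ) / ((s : ℝ) + m)) * t) * maxCoeff j w))) ∧
    ((∀ β : ℝ, 0 < β → ∃ T : ℝ, 0 < T ∧ ∀ t : ℝ, T ≤ t →
        ∀ j : ℕ, 1 ≤ j → j ≤ s + m → ∀ w : Finset (Fin (s + m + 1)) → ℝ, IsPrim j w →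
          Real.exp (-β * t) ≤
            max (Real.exp ((((s : ℝ) + m + 1 - j) / ((s : ℝ) + m)) * t) * maxNormA A j w)
                (Real.exp (-((j : ℝ) / ((s : ℝ) + m)) * t) * maxCoeff j w)) ↔
      (∀ j : ℕ, 1 ≤ j → j ≤ s + m → ∀ v : ℝ, ((s : ℝ) + m + 1 - j) / j < v →
        ∃ N : ℝ, 0 < N ∧ ∀ w : Finset (Fin (s + m + 1)) → ℝ, IsPrim j w →
          N < maxCoeff j w → (maxCoeff j w) ^ (-v) < maxNormA A j w)) := by
  have hn : s + m ≠ 0 := by omega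
  refine ⟨⟨fun h => ?_, fun h => ?_⟩, ⟨fun h => ?_, fun h => ?_⟩⟩
  · exact criterion_of_isExtremal hn A h
  · exact isExtremal_of_criterion hn A h
  · exact lt_maxNormA_of_criterion hn A h
  · exact criterion_of_lt_maxNormA hn A h
end

section
/- For any n ≥ 2, any 1 ≤ s ≤ n-1, any A ∈ M_{s+1,n-s}(ℝ), and any w ∈ S_{n+1,n}, one has max over all I ⊂ {0,...,n} with 0 ∈ I and |I| = n of ‖c_{I,w}^+ + A c_{I,w}^-‖ ≥ 1. -/
open MeasureTheory

theorem minorDet_compl_singleton {n : ℕ} (v : Fin n → Fin (n + 1) → ℤ) (k : Fin (n + 1)) :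
    minorDet v {k}ᶜ = ((Matrix.of v).submatrix id k.succAbove).det := by
  have h : ({k}ᶜ : Finset (Fin (n + 1))).card = n := by simp [Finset.card_compl]
  rw [minorDet, dif_pos h]
  congr 1
  ext a b
  simp [Finset.coe_orderIsoOfFin_apply]

theorem exists_minorDet_compl_singleton_ne_zero {n : ℕ} {v : Fin n → Fin (n + 1) → ℤ}
    (hv : LinearIndependent ℤ v) : ∃ k, minorDet v {k}ᶜ ≠ 0 := by
  by_contra! h
  obtain ⟨x, hx⟩ := exists_linearIndependent_cons_of_lt_rank hv (by simp)
  have hdet : (Matrix.of (Fin.cons x v : Fin (n + 1) → Fin (n + 1) → ℤ)).det = 0 := by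
    rw [Matrix.det_succ_row_zero]
    refine Finset.sum_eq_zero fun k _ => ?_
    have hk := h k
    rw [minorDet_compl_singleton] at hk
    exact mul_eq_zero_of_right _ hk
  obtain ⟨c, hc, hc0⟩ := Matrix.exists_vecMul_eq_zero_iff.mpr hdet
  refine hc (funext <| Fintype.linearIndependent_iff.mp hx c ?_)
  rw [← hc0, Matrix.vecMul_eq_sum]
  rfl

theorem cIw_compl_singleton_self {n : ℕ} (w : Finset (Fin (n + 1)) → ℝ) {k : Fin (n + 1)}
    (hk : k ≠ 0) : cIw w {k}ᶜ k = (-1) ^ lIi {k}ᶜ k * w {0}ᶜ := by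
  have h : (insert k ({k}ᶜ : Finset (Fin (n + 1)))).erase 0 = {0}ᶜ := by
    ext a; by_cases ha : a = k <;> simp [ha, hk]
  rw [cIw, if_neg hk, if_neg (by simp), h]

theorem cIw_compl_singleton_of_ne {n : ℕ} (w : Finset (Fin (n + 1)) → ℝ) {k i : Fin (n + 1)}
    (hi : i ≠ 0) (hik : i ≠ k) : cIw w {k}ᶜ i = 0 := by
  simp [cIw, hi, hik]

/-- If the tail of `c_{I,w}` vanishes, every head coordinate bounds `maxNormA` from below. -/
theorem abs_cIw_le_maxNormA {s m j : ℕ} (A : Matrix (Fin (s + 1)) (Fin m) ℝ)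
    (w : Finset (Fin (s + m + 1)) → ℝ) {I : Finset (Fin (s + m + 1))} (h0 : 0 ∈ I)
    (hI : I.card = j) (htail : ∀ i : Fin (s + m + 1), s < i.val → cIw w I i = 0)
    (i : Fin (s + 1)) : |cIw w I (Fin.castLE (by omega) i)| ≤ maxNormA A j w := by
  refine le_trans ?_ (le_ciSup (Set.finite_range _).bddAbove ⟨I, h0, hI⟩)
  refine le_trans (le_of_eq ?_) (norm_le_pi_norm _ i)
  have hz : (fun r : Fin m => cIw w I (Fin.cast (by omega) (Fin.natAdd (s + 1) r))) = 0 :=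
    funext fun r => htail _ (by simp; omega)
  simp only [hz, Matrix.mulVec_zero, Pi.zero_apply, add_zero, Real.norm_eq_abs]

/-- **Lemma 4.5.** For any `s = 1,…,n-1` (here `n = s + m` with `s, m ≥ 1`), any
`A ∈ M_{s+1,n-s}(ℝ)` and any `w ∈ S_{n+1,n}`, one has
`max_{I ∋ 0, |I| = n} ‖c_{I,w}^+ + A c_{I,w}^-‖ ≥ 1`. -/
theorem maxNormA_ge_one_top_rank (s m : ℕ) (hs : 1 ≤ s) (hm : 1 ≤ m)
    (A : Matrix (Fin (s + 1)) (Fin m) ℝ)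
    (w : Finset (Fin (s + m + 1)) → ℝ) (hw : IsPrim (s + m) w) :
    1 ≤ maxNormA A (s + m) w := by
  obtain ⟨v, hv, hwv⟩ := hw
  have one_le : ∀ I, minorDet v I ≠ 0 → 1 ≤ |w I| := fun I hI => by
    rw [hwv]
    exact_mod_cast Int.one_le_abs hI
  have hcard (k : Fin (s + m + 1)) : ({k}ᶜ : Finset (Fin (s + m + 1))).card = s + m := by
    simp [Finset.card_compl]
  by_cases h0 : minorDet v {0}ᶜ = 0
  · obtain ⟨k, hk⟩ := exists_minorDet_compl_singleton_ne_zero hv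
    have hk0 : k ≠ 0 := by rintro rfl; exact hk h0
    refine (one_le _ hk).trans (le_trans (le_of_eq ?_)
      (abs_cIw_le_maxNormA A w (I := {k}ᶜ) (by simpa using hk0.symm) (hcard k) ?_ 0))
    · simp [cIw]
    · intro i hi
      have hi0 : i ≠ 0 := by rintro rfl; simp at hi
      by_cases hik : i = k
      · subst hik
        simp [cIw_compl_singleton_self w hi0, hwv, h0]
      · exact cIw_compl_singleton_of_ne w hi0 hik
  · let k : Fin (s + m + 1) := ⟨1, by omega⟩
    have hk0 : k ≠ 0 := by simp [k, Fin.ext_iff]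
    refine (one_le _ h0).trans (le_trans (le_of_eq ?_)
      (abs_cIw_le_maxNormA A w (I := {k}ᶜ) (by simpa using hk0.symm) (hcard k) ?_
        ⟨1, by omega⟩))
    · change _ = |cIw w {k}ᶜ k|
      simp [cIw_compl_singleton_self w hk0, abs_mul]
    · intro i hi
      refine cIw_compl_singleton_of_ne w ?_ ?_
      · rintro rfl; simp at hi
      · rintro rfl; simp [k] at hi; omega
end

section
/- Let n ≥ 2, s = n-1, and let A ∈ M_{n,1}(ℝ) be given by a column vector a ∈ ℝ^n. Then for every j with 1 < j ≤ n and every w ∈ S_{n+1,j}, one has max over all I ⊂ {0,...,n} with 0 ∈ I and |I| = j of ‖c_{I,w}^+ + a c_{I,w}^-‖ ≥ 1 (here c_{I,w}^- is a single real number). -/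
open MeasureTheory

/-- A linearly independent family of integer vectors has a nonzero maximal minor. -/
lemma exists_minorDet_ne_zero {k j : ℕ} {v : Fin j → Fin k → ℤ} (hv : LinearIndependent ℤ v) :
    ∃ I : Finset (Fin k), I.card = j ∧ minorDet v I ≠ 0 := by
  classical
  let M : Matrix (Fin j) (Fin k) ℚ := Matrix.of fun a b => (v a b : ℚ)
  have hM : LinearIndependent ℚ M.row := by
    rw [← LinearIndependent.iff_fractionRing (R := ℤ)]
    let f : (Fin k → ℤ) →ₗ[ℤ] (Fin k → ℚ) := (Algebra.linearMap ℤ ℚ).compLeft (Fin k)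
    have hf : LinearMap.ker f = ⊥ := by
      rw [LinearMap.ker_eq_bot]
      intro x y hxy
      ext b
      exact Int.cast_injective (congrFun hxy b)
    exact hv.map' f hf
  have hrank : Module.finrank ℚ (Submodule.span ℚ (Set.range M.col)) = j := by
    rw [← Matrix.rank_eq_finrank_span_cols, hM.rank_matrix, Fintype.card_fin]
  obtain ⟨κ, c, hc, hspan, hli⟩ := exists_linearIndependent' ℚ M.col
  have : Finite κ := Finite.of_injective c hc
  have := Fintype.ofFinite κ
  rw [← hspan, finrank_span_eq_card hli] at hrank
  let I : Finset (Fin k) := Finset.univ.image c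
  have hI : I.card = j := by
    rw [Finset.card_image_of_injective _ hc, Finset.card_univ, hrank]
  have hcols : LinearIndependent ℚ fun x : I => M.col x := by
    have h := (linearIndepOn_range_iff hc M.col).2 hli
    have hsub : ∀ x : I, (x : Fin k) ∈ Set.range c := fun x => by
      obtain ⟨y, -, hy⟩ := Finset.mem_image.1 x.2
      exact ⟨y, hy⟩
    exact h.comp (fun x : I => ⟨x, hsub x⟩) fun x y hxy => Subtype.ext (Subtype.mk.inj hxy)
  refine ⟨I, hI, fun h => ?_⟩
  rw [minorDet, dif_pos hI] at h
  have hunit := Matrix.linearIndependent_cols_iff_isUnit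
    (A := (Matrix.of fun a b : Fin j => v a (I.orderIsoOfFin hI b : Fin k)).map
      (Int.castRingHom ℚ)) |>.1 (hcols.comp _ (I.orderIsoOfFin hI).injective)
  rw [Matrix.isUnit_iff_isUnit_det, ← RingHom.mapMatrix_apply, ← RingHom.map_det, h] at hunit
  simp at hunit

lemma one_le_abs_of_isPrim {k j : ℕ} {w : Finset (Fin k) → ℝ} (hw : IsPrim j w)
    {I : Finset (Fin k)} (hI : w I ≠ 0) : 1 ≤ |w I| := by
  obtain ⟨v, -, hv⟩ := hw
  rw [hv] at hI ⊢
  exact_mod_cast Int.one_le_abs (Int.cast_ne_zero.1 hI)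

lemma one_le_maxNormA_of_cIw_last_eq_zero {s j : ℕ} (a : Fin (s + 1) → ℝ)
    {w : Finset (Fin (s + 1 + 1)) → ℝ} {I : Finset (Fin (s + 1 + 1))} (h0 : 0 ∈ I)
    (hI : I.card = j) (hlast : cIw w I (Fin.last (s + 1)) = 0) {i : Fin (s + 1)}
    (hi : 1 ≤ |cIw w I i.castSucc|) :
    1 ≤ maxNormA (Matrix.of fun i (_ : Fin 1) => a i) j w := by
  refine le_trans ?_ (le_ciSup (Set.finite_range _).bddAbove ⟨I, h0, hI⟩)
  refine le_trans ?_ (norm_le_pi_norm _ i)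
  have hr : ∀ h : s + 1 + 1 = s + 1 + 1, Fin.cast h (Fin.natAdd (s + 1) (0 : Fin 1)) =
      Fin.last (s + 1) := fun _ => rfl
  simp only [Matrix.mulVec, dotProduct, Finset.univ_unique, Fin.default_eq_zero,
    Finset.sum_singleton]
  rw [hr, hlast, mul_zero, add_zero]
  exact hi

/-- Exchanging `i ∈ J` for `0 ∉ J` gives an index set `I` for which the `i`-th coordinate of
`c_{I,w}` is `±w_J`. -/
lemma abs_cIw_insert_zero_erase {k : ℕ} (w : Finset (Fin (k + 1)) → ℝ)
    {J : Finset (Fin (k + 1))} (h0 : 0 ∉ J) {i : Fin (k + 1)} (hi : i ∈ J) :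
    |cIw w (insert 0 (J.erase i)) i| = |w J| := by
  have hi0 : i ≠ 0 := fun h => h0 (h ▸ hi)
  have hset : (insert i (insert 0 (J.erase i))).erase 0 = J := by
    rw [Finset.insert_comm, Finset.insert_erase hi, Finset.erase_insert h0]
  rw [cIw, if_neg hi0, if_neg (by simp [hi0]), hset, abs_mul, abs_pow, abs_neg, abs_one,
    one_pow, one_mul]

lemma cIw_last_eq_zero {s : ℕ} {w : Finset (Fin (s + 1 + 1)) → ℝ}
    {I : Finset (Fin (s + 1 + 1))}
    (h : Fin.last (s + 1) ∈ I ∨ ∀ J, Fin.last (s + 1) ∈ J → w J = 0) :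
    cIw w I (Fin.last (s + 1)) = 0 := by
  have hne : Fin.last (s + 1) ≠ 0 := Fin.last_pos.ne'
  rw [cIw, if_neg hne]
  split_ifs with hmem
  · rfl
  · rw [h.resolve_left hmem _ (by simp [hne]), mul_zero]

/-- **Lemma 4.6.** Let `s = n - 1` (here `n = s + 1`, `s ≥ 1`, so `n ≥ 2`) and let
`A ∈ M_{n,1}(ℝ)` be given by the column vector `a ∈ ℝ^n`. Then for every `j` with
`1 < j ≤ n` and every `w ∈ S_{n+1,j}`,
`max_{I ∋ 0, |I| = j} ‖c_{I,w}^+ + a c_{I,w}^-‖ ≥ 1`. -/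
theorem maxNormA_ge_one_hyperplane (s : ℕ) (hs : 1 ≤ s) (a : Fin (s + 1) → ℝ)
    (j : ℕ) (hj1 : 1 < j) (hj2 : j ≤ s + 1)
    (w : Finset (Fin (s + 1 + 1)) → ℝ) (hw : IsPrim j w) :
    1 ≤ maxNormA (Matrix.of fun i (_ : Fin 1) => a i) j w := by
  have hcard : ∀ J, w J ≠ 0 → J.card = j := by
    obtain ⟨v, -, hv⟩ := hw
    intro J hJ
    by_contra h
    exact hJ (by rw [hv, minorDet, dif_neg h, Int.cast_zero])
  obtain ⟨J, hJ, hlast⟩ : ∃ J, w J ≠ 0 ∧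
      (Fin.last (s + 1) ∈ J ∨ ∀ K, Fin.last (s + 1) ∈ K → w K = 0) := by
    by_cases h : ∃ J, Fin.last (s + 1) ∈ J ∧ w J ≠ 0
    · obtain ⟨J, hJ, hwJ⟩ := h
      exact ⟨J, hwJ, Or.inl hJ⟩
    · push Not at h
      obtain ⟨v, hli, hv⟩ := hw
      obtain ⟨J, -, hJ⟩ := exists_minorDet_ne_zero hli
      exact ⟨J, by rw [hv]; exact_mod_cast hJ, Or.inr h⟩
  have hone := one_le_abs_of_isPrim hw hJ
  by_cases h0 : 0 ∈ J
  · exact one_le_maxNormA_of_cIw_last_eq_zero a h0 (hcard J hJ) (cIw_last_eq_zero hlast)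
      (i := 0) (by simpa [cIw] using hone)
  · obtain ⟨i, hi, hne⟩ := Finset.exists_mem_ne (by rwa [hcard J hJ]) (Fin.last (s + 1))
    have h0' : 0 ∉ J.erase i := fun h => h0 (Finset.mem_of_mem_erase h)
    refine one_le_maxNormA_of_cIw_last_eq_zero a (Finset.mem_insert_self 0 (J.erase i)) ?_
      (cIw_last_eq_zero (hlast.imp_left fun h =>
        Finset.mem_insert_of_mem (Finset.mem_erase.2 ⟨hne.symm, h⟩)))
      (i := i.castPred hne) ?_
    · rw [Finset.card_insert_of_notMem h0', Finset.card_erase_add_one hi, hcard J hJ]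
    · rwa [Fin.castSucc_castPred, abs_cIw_insert_zero_erase w h0 hi]
end

section
/- Let n ≥ 2 and let b = (b_1,...,b_{n-1}) ∈ ℝ^{n-1}, regarded as a 1×(n-1) matrix, satisfy b ∉ W_n^+(1,n-1). Then the map ℝ → ℝ^n given by x ↦ (x, b_1 x, ..., b_{n-1} x) (parametrizing a line through the origin of ℝ^n) is extremal. -/
open MeasureTheory

/-- The sup norm of an integer vector is not affected by the coercion to `ℝ`. -/
lemma norm_intCast_pi {n : ℕ} (q : Fin n → ℤ) :
    ‖(fun i => (q i : ℝ) : Fin n → ℝ)‖ = ‖q‖ := by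
  simp [Pi.norm_def, nnnorm, ← Int.norm_cast_real]

lemma one_le_norm_int_pi {n : ℕ} {q : Fin n → ℤ} (hq : q ≠ 0) : 1 ≤ ‖q‖ := by
  obtain ⟨i, hi⟩ := Function.ne_iff.mp hq
  refine le_trans ?_ (norm_le_pi_norm q i)
  rw [Int.norm_eq_abs]
  exact_mod_cast Int.one_le_abs hi

lemma norm_int_pi_rpow_neg_le_rpow_neg {n : ℕ} (q : Fin n → ℤ) {v w : ℝ} (hw : 0 < w)
    (hwv : w ≤ v) : ‖q‖ ^ (-v) ≤ ‖q‖ ^ (-w) := by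
  rcases eq_or_ne q 0 with rfl | hq
  · rw [norm_zero, Real.zero_rpow (by linarith), Real.zero_rpow (by linarith)]
  · exact Real.rpow_le_rpow_of_exponent_le (one_le_norm_int_pi hq) (by linarith)

lemma norm_int_pi_rpow_neg_le_one {n : ℕ} (q : Fin n → ℤ) {v : ℝ} (hv : 0 < v) :
    ‖q‖ ^ (-v) ≤ 1 := by
  rcases eq_or_ne q 0 with rfl | hq
  · rw [norm_zero, Real.zero_rpow (by linarith)]
    exact zero_le_one
  · exact Real.rpow_le_one_of_one_le_of_nonpos (one_le_norm_int_pi hq) (by linarith)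

lemma finite_setOf_norm_int_pi_le {n : ℕ} (R : ℝ) : {q : Fin n → ℤ | ‖q‖ ≤ R}.Finite := by
  refine (Set.finite_Icc (fun _ => -⌈R⌉ : Fin n → ℤ) (fun _ => ⌈R⌉)).subset fun q hq => ?_
  have h : ∀ i, |q i| ≤ ⌈R⌉ := fun i => by
    have := (norm_le_pi_norm q i).trans hq
    rw [Int.norm_eq_abs] at this
    exact_mod_cast this.trans (Int.le_ceil R)
  exact ⟨fun i => (abs_le.mp (h i)).1, fun i => (abs_le.mp (h i)).2⟩

lemma summable_norm_int_pi_rpow_neg {n : ℕ} {v : ℝ} (hv : (n : ℝ) < v) :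
    Summable fun q : Fin n → ℤ => ‖q‖ ^ (-v) := by
  let L : Submodule ℤ (Fin n → ℝ) := Submodule.span ℤ (Set.range (Pi.basisFun ℝ (Fin n)))
  have hrank : Module.finrank ℤ L = n := by
    rw [ZLattice.rank ℝ L]
    simp
  have hmem : ∀ q : Fin n → ℤ, (fun i => (q i : ℝ)) ∈ L := fun q => by
    rw [Module.Basis.mem_span_iff_repr_mem]
    intro i
    exact ⟨q i, by simp⟩
  have hs := ZLattice.summable_norm_rpow L (-v) (by rw [hrank]; linarith)
  have hinj : Function.Injective fun q : Fin n → ℤ => (⟨fun i => (q i : ℝ), hmem q⟩ : L) := by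
    intro q r h
    funext i
    have hi : (q i : ℝ) = r i := congrFun (congrArg Subtype.val h) i
    exact_mod_cast hi
  refine (hs.comp_injective hinj).congr fun q => ?_
  rw [← norm_intCast_pi]
  rfl

/-- The points `x` of `[-M, M]` such that `x * l` is within `δ ≤ 1` of an integer have measure
`O(δ)`, uniformly for `l` bounded away from `0`. -/
lemma volume_setOf_abs_mul_add_int_le {M l δ : ℝ} (hM : 0 < M) (hl : 1 ≤ 2 * M * |l|)
    (hδ0 : 0 ≤ δ) (hδ : δ ≤ 1) :
    volume {x : ℝ | |x| ≤ M ∧ ∃ p : ℤ, |x * l + p| ≤ δ} ≤ ENNReal.ofReal (24 * M * δ) := by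
  have hl0 : 0 < |l| := by
    by_contra h
    have : |l| = 0 := le_antisymm (not_lt.mp h) (abs_nonneg l)
    rw [this] at hl
    linarith
  have hl' : l ≠ 0 := abs_pos.mp hl0
  set K : ℕ := ⌊M * |l| + 1⌋₊
  have hKle : (K : ℝ) ≤ M * |l| + 1 := Nat.floor_le (by positivity)
  have hsub : {x : ℝ | |x| ≤ M ∧ ∃ p : ℤ, |x * l + p| ≤ δ} ⊆
      ⋃ p ∈ Finset.Icc (-(K : ℤ)) K, Metric.closedBall (-(p : ℝ) / l) (δ / |l|) := by
    rintro x ⟨hx, p, hp⟩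
    have hp' : (p.natAbs : ℝ) ≤ M * |l| + 1 := by
      rw [Nat.cast_natAbs, Int.cast_abs]
      calc |(p : ℝ)| = |(x * l + p) - x * l| := by ring_nf
        _ ≤ |x * l + p| + |x * l| := abs_sub _ _
        _ ≤ 1 + M * |l| := by rw [abs_mul x l]; gcongr; exact hp.trans hδ
        _ = _ := by ring
    have hpK : p.natAbs ≤ K := Nat.le_floor hp'
    refine Set.mem_biUnion (x := p) (by simp only [SetLike.mem_coe, Finset.mem_Icc]; omega) ?_
    rw [Metric.mem_closedBall, Real.dist_eq, le_div_iff₀ hl0, ← abs_mul]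
    rw [show (x - -(p : ℝ) / l) * l = x * l + p by field_simp; ring]
    exact hp
  calc volume {x : ℝ | |x| ≤ M ∧ ∃ p : ℤ, |x * l + p| ≤ δ}
      ≤ ∑ p ∈ Finset.Icc (-(K : ℤ)) K,
          volume (Metric.closedBall (-(p : ℝ) / l) (δ / |l|)) :=
        (measure_mono hsub).trans (measure_biUnion_finset_le _ _)
    _ = ENNReal.ofReal ((2 * K + 1) * (2 * (δ / |l|))) := by
        simp only [Real.volume_closedBall, Finset.sum_const, Int.card_Icc, nsmul_eq_mul]
        rw [ENNReal.ofReal_mul (p := 2 * (K : ℝ) + 1) (by positivity),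
          show ((K : ℤ) + 1 - -(K : ℤ)).toNat = 2 * K + 1 by omega,
          ← ENNReal.ofReal_natCast]
        push_cast
        rfl
    _ ≤ ENNReal.ofReal (24 * M * δ) := by
        apply ENNReal.ofReal_le_ofReal
        have h : 2 * (K : ℝ) + 1 ≤ 12 * M * |l| := by linarith
        calc (2 * (K : ℝ) + 1) * (2 * (δ / |l|)) ≤ (12 * M * |l|) * (2 * (δ / |l|)) := by gcongr
          _ = 24 * M * δ := by field_simp; ring

/-- If `b` is not `w`-approximable, only finitely many integer vectors `(q₀, q')` make the linear
form `q₀ + b · q'` at most `‖(q₀, q')‖ ^ (-w)`. -/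
lemma finite_setOf_abs_linear_form_le {m : ℕ} {b : Fin m → ℝ} {w : ℝ} (hw : 0 < w)
    (hb : {q : Fin m → ℤ | ∃ p : ℤ, |(∑ i, b i * (q i : ℝ)) + (p : ℝ)| ≤
      ‖(fun i => (q i : ℝ) : Fin m → ℝ)‖ ^ (-w)}.Finite) :
    {q : Fin (m + 1) → ℤ | |(q 0 : ℝ) + ∑ i : Fin m, b i * (q i.succ : ℝ)| ≤
      ‖q‖ ^ (-w)}.Finite := by
  obtain ⟨C, hC⟩ := ((hb.insert 0).image fun t : Fin m → ℤ =>
    ‖t‖ + 1 + |∑ i, b i * (t i : ℝ)|).bddAbove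
  refine (finite_setOf_norm_int_pi_le C).subset fun q hq => ?_
  have htail : Fin.tail q ∈ insert 0 {q : Fin m → ℤ | ∃ p : ℤ,
      |(∑ i, b i * (q i : ℝ)) + (p : ℝ)| ≤ ‖(fun i => (q i : ℝ) : Fin m → ℝ)‖ ^ (-w)} := by
    by_cases ht : Fin.tail q = 0
    · exact Or.inl ht
    · refine Or.inr ⟨q 0, ?_⟩
      rw [norm_intCast_pi, add_comm]
      refine hq.out.trans (Real.rpow_le_rpow_of_nonpos ?_ ?_ (by linarith))
      · exact zero_lt_one.trans_le (one_le_norm_int_pi ht)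
      · exact (pi_norm_le_iff_of_nonneg (norm_nonneg _)).mpr fun i => norm_le_pi_norm q i.succ
  have hqC : ‖Fin.tail q‖ + 1 + |∑ i : Fin m, b i * (q i.succ : ℝ)| ≤ C :=
    hC ⟨Fin.tail q, htail, rfl⟩
  have hq0 : |(q 0 : ℝ)| ≤ 1 + |∑ i : Fin m, b i * (q i.succ : ℝ)| :=
    calc |(q 0 : ℝ)| = |((q 0 : ℝ) + ∑ i : Fin m, b i * (q i.succ : ℝ)) -
          ∑ i : Fin m, b i * (q i.succ : ℝ)| := by rw [add_sub_cancel_right]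
      _ ≤ |(q 0 : ℝ) + ∑ i : Fin m, b i * (q i.succ : ℝ)| +
          |∑ i : Fin m, b i * (q i.succ : ℝ)| := abs_sub _ _
      _ ≤ _ := by gcongr; exact hq.out.trans (norm_int_pi_rpow_neg_le_one q hw)
  have hnn := norm_nonneg (Fin.tail q)
  have habs := abs_nonneg (∑ i : Fin m, b i * (q i.succ : ℝ))
  refine (pi_norm_le_iff_of_nonneg (by linarith)).mpr fun i => ?_
  refine Fin.cases ?_ (fun j => ?_) i
  · rw [Int.norm_eq_abs]
    linarith
  · have := norm_le_pi_norm (Fin.tail q) j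
    change ‖Fin.tail q j‖ ≤ C
    linarith

/-- Borel–Cantelli for the integer vectors at which the linear form is not small. -/
lemma ae_finite_setOf_approx_of_large {m : ℕ} (l : (Fin (m + 1) → ℤ) → ℝ) {v M : ℝ}
    (hv : (m : ℝ) + 1 < v) (hM : 0 < M) :
    ∀ᵐ x : ℝ, {q : Fin (m + 1) → ℤ | 1 ≤ 2 * M * |l q| ∧ |x| ≤ M ∧
      ∃ p : ℤ, |x * l q + p| ≤ ‖q‖ ^ (-v)}.Finite := by
  have hv0 : 0 < v := by linarith [(Nat.cast_nonneg m : (0 : ℝ) ≤ m)]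
  refine ae_finite_setOfPred_mem (s := fun q : Fin (m + 1) → ℤ => {x : ℝ | 1 ≤ 2 * M * |l q| ∧
    |x| ≤ M ∧ ∃ p : ℤ, |x * l q + p| ≤ ‖q‖ ^ (-v)}) (ne_top_of_le_ne_top ?_
    (ENNReal.tsum_le_tsum (g := fun q => ENNReal.ofReal (24 * M * ‖q‖ ^ (-v))) fun q => ?_))
  · exact ((summable_norm_int_pi_rpow_neg (by exact_mod_cast hv)).mul_left
      (24 * M)).tsum_ofReal_ne_top
  · by_cases hl : 1 ≤ 2 * M * |l q|
    · simpa only [hl, true_and] using volume_setOf_abs_mul_add_int_le hM hl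
        (by positivity) (norm_int_pi_rpow_neg_le_one q hv0)
    · simp [hl]

/-- Outside a finite set, a good approximation `x * l q` with `l q` small has to be an
approximation of `0`, so that `l q` itself is very small. -/
lemma finite_setOf_approx_of_small {n : ℕ} (l : (Fin n → ℤ) → ℝ) {v w M x : ℝ}
    (hw : 0 < w) (hwv : w < v) (hx : |x| ≤ M) (hx' : 1 ≤ M * |x|)
    (hfin : {q : Fin n → ℤ | |l q| ≤ ‖q‖ ^ (-w)}.Finite) :
    {q : Fin n → ℤ | 2 * M * |l q| < 1 ∧ ∃ p : ℤ, |x * l q + p| ≤ ‖q‖ ^ (-v)}.Finite := by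
  obtain ⟨R, hR⟩ := Filter.eventually_atTop.mp
    (((tendsto_rpow_neg_atTop (hw.trans hwv)).eventually_lt_const
      (by norm_num : (0 : ℝ) < 1 / 2)).and
      (((tendsto_rpow_atTop (sub_pos.mpr hwv)).eventually_ge_atTop M).and
        (Filter.eventually_gt_atTop 0)))
  refine ((finite_setOf_norm_int_pi_le R).union hfin).subset ?_
  rintro q ⟨hl, p, hp⟩
  rcases le_total ‖q‖ R with hq | hq
  · exact Or.inl hq
  refine Or.inr ?_
  obtain ⟨h1, h2, h3⟩ := hR _ hq
  have hxl : |x * l q| < 1 / 2 := by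
    rw [abs_mul]
    have := mul_le_mul_of_nonneg_right hx (abs_nonneg (l q))
    linarith
  have hp0 : p = 0 := by
    have : |(p : ℝ)| < 1 :=
      calc |(p : ℝ)| = |(x * l q + p) - x * l q| := by rw [add_sub_cancel_left]
        _ ≤ |x * l q + p| + |x * l q| := abs_sub _ _
        _ < 1 := by linarith
    exact Int.abs_lt_one_iff.mp (by exact_mod_cast this)
  rw [hp0, Int.cast_zero, add_zero, abs_mul] at hp
  calc |l q| ≤ (M * |x|) * |l q| := le_mul_of_one_le_left (abs_nonneg _) hx'
    _ = M * (|x| * |l q|) := by ring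
    _ ≤ ‖q‖ ^ (v - w) * ‖q‖ ^ (-v) := by gcongr
    _ = ‖q‖ ^ (-w) := by rw [← Real.rpow_add h3]; ring_nf

/-- **Proposition 4.7.** A line through the origin of `ℝ^n` (`n = m + 1 ≥ 2`) parametrized
by `x ↦ (x, b₁x, …, b_{n-1}x)` is extremal whenever `b ∉ W_n^+(1,n-1)`, i.e. whenever for
every `v > n` there are only finitely many `q ∈ ℤ^{n-1}` with `|b·q + p| ≤ ‖q‖^{-v}` for
some `p ∈ ℤ`. -/
theorem line_extremal_of_not_Wplus (m : ℕ) (hm : 1 ≤ m) (b : Fin m → ℝ)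
    (hb : ∀ v : ℝ, ((m : ℝ) + 1) < v →
      {q : Fin m → ℤ | ∃ p : ℤ,
        |(∑ i, b i * (q i : ℝ)) + (p : ℝ)| ≤
          ‖(fun i => (q i : ℝ) : Fin m → ℝ)‖ ^ (-v)}.Finite) :
    IsExtremal (Set.univ : Set ℝ) (fun x => Fin.cons x (fun i => b i * x)) := by
  have hsum : ∀ (x : ℝ) (q : Fin (m + 1) → ℤ),
      ∑ i, (Fin.cons x (fun i => b i * x) : Fin (m + 1) → ℝ) i * (q i : ℝ) =
        x * ((q 0 : ℝ) + ∑ i : Fin m, b i * (q i.succ : ℝ)) := fun x q => by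
    rw [Fin.sum_univ_succ, mul_add, Finset.mul_sum]
    simp only [Fin.cons_zero, Fin.cons_succ]
    congr 1
    exact Finset.sum_congr rfl fun i _ => by ring
  have hm0 : (0 : ℝ) < (m : ℝ) + 1 := by positivity
  have hfin : ∀ᵐ x : ℝ, ∀ k M : ℕ, {q : Fin (m + 1) → ℤ |
      1 ≤ 2 * ((M : ℝ) + 1) * |(q 0 : ℝ) + ∑ i : Fin m, b i * (q i.succ : ℝ)| ∧
      |x| ≤ (M : ℝ) + 1 ∧ ∃ p : ℤ, |x * ((q 0 : ℝ) + ∑ i : Fin m, b i * (q i.succ : ℝ)) + p| ≤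
        ‖q‖ ^ (-((m : ℝ) + 1 + 1 / ((k : ℝ) + 1)))}.Finite :=
    ae_all_iff.mpr fun k => ae_all_iff.mpr fun M =>
      ae_finite_setOf_approx_of_large _ (lt_add_of_pos_right _ (by positivity)) (by positivity)
  have hae : ∀ᵐ x : ℝ, ¬ IsVWA (Fin.cons x (fun i => b i * x) : Fin (m + 1) → ℝ) := by
    filter_upwards [hfin, (Set.countable_singleton (0 : ℝ)).ae_notMem volume] with x hx hx0
    rintro ⟨v, hv, hinf⟩
    push_cast at hv
    obtain ⟨k, hk⟩ := exists_nat_one_div_lt (sub_pos.mpr hv)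
    obtain ⟨M, hM⟩ := exists_nat_ge (max |x| |x|⁻¹)
    have hxpos : 0 < |x| := abs_pos.mpr hx0
    have hxM : |x| ≤ (M : ℝ) + 1 := by linarith [le_max_left |x| |x|⁻¹]
    have hxM' : 1 ≤ ((M : ℝ) + 1) * |x| := by
      rw [← inv_le_iff_one_le_mul₀ hxpos]
      linarith [le_max_right |x| |x|⁻¹]
    have hkpos : (0 : ℝ) < 1 / ((k : ℝ) + 1) := by positivity
    obtain ⟨w, hw, hwv⟩ := exists_between (lt_add_of_pos_right ((m : ℝ) + 1) hkpos)
    have hsmall := finite_setOf_approx_of_small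
      (fun q : Fin (m + 1) → ℤ => (q 0 : ℝ) + ∑ i : Fin m, b i * (q i.succ : ℝ))
      (hm0.trans hw) hwv hxM hxM'
      (finite_setOf_abs_linear_form_le (hm0.trans hw) (hb w hw))
    refine hinf (((hx k M).union hsmall).subset ?_)
    rintro q ⟨p, hp⟩
    rw [hsum, norm_intCast_pi] at hp
    have hp' := hp.trans (norm_int_pi_rpow_neg_le_rpow_neg q
      (by positivity : (0 : ℝ) < (m : ℝ) + 1 + 1 / ((k : ℝ) + 1)) (by linarith))
    rcases le_or_gt 1 (2 * ((M : ℝ) + 1) *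
      |(q 0 : ℝ) + ∑ i : Fin m, b i * (q i.succ : ℝ)|) with h | h
    · exact Or.inl ⟨h, hxM, p, hp'⟩
    · exact Or.inr ⟨h, p, hp'⟩
  simpa [IsExtremal, ae_iff] using hae
end

section
/- Let n ≥ 2, let b ∈ ℝ^{n-1} satisfy b ∉ W_n^+(1,n-1), and let v > n. For Q > 0 let A(b,v,Q) = {x ∈ [0,1) : there exist p ∈ ℤ and q ∈ ℤ^n with Q ≤ ‖q‖ < 2Q such that |p + (b̃·q) x| < Q^{-v}}, where b̃ = (1, b_1, ..., b_{n-1}) and b̃·q = q_0 + b_1 q_1 + ... + b_{n-1} q_{n-1}. Then there exists a constant C = C(b,v) > 0 such that for every Q > 1 the Lebesgue measure of A(b,v,Q) is less than C Q^{(n-v)/2}. -/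
open MeasureTheory

/-- Points of `[0,1)` that a nonzero integer translate of `x ↦ L * x` maps close to zero. -/
lemma volume_exists_ne_zero_abs_add_mul_lt_le (L ε : ℝ) (hε : ε ≤ 1 / 2) (hε0 : 0 ≤ ε) :
    volume {x ∈ Set.Ico (0 : ℝ) 1 | ∃ p : ℤ, p ≠ 0 ∧ |(p : ℝ) + L * x| < ε} ≤
      ENNReal.ofReal (12 * ε) := by
  have key : ∀ x ∈ Set.Ico (0 : ℝ) 1, ∀ p : ℤ, p ≠ 0 → |(p : ℝ) + L * x| < ε →
      1 / 2 ≤ |L| ∧ |(p : ℝ)| ≤ 2 * |L| := by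
    intro x hx p hp h
    have h1 : (1 : ℝ) ≤ |(p : ℝ)| := by exact_mod_cast Int.one_le_abs hp
    have h2 : |L * x| ≤ |L| := by
      rw [abs_mul, abs_of_nonneg hx.1]
      exact mul_le_of_le_one_right (abs_nonneg _) hx.2.le
    have h3 : |(p : ℝ)| ≤ |(p : ℝ) + L * x| + |L * x| := by
      simpa using abs_sub (p + L * x) (L * x)
    constructor <;> linarith
  by_cases hL : 1 / 2 ≤ |L|
  · have hL0 : 0 < |L| := by linarith
    have hLne : L ≠ 0 := abs_pos.mp hL0
    set N : ℤ := ⌊2 * |L|⌋ with hN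
    have hN0 : 0 ≤ N := Int.floor_nonneg.mpr (by positivity)
    have hNle : (N : ℝ) ≤ 2 * |L| := Int.floor_le _
    calc _ ≤ volume (⋃ p ∈ Finset.Icc (-N) N, Metric.ball (-(p : ℝ) / L) (ε / |L|)) := by
          refine measure_mono ?_
          rintro x ⟨hx, p, hp, h⟩
          obtain ⟨-, h2⟩ := key x hx p hp h
          have hpN : |p| ≤ N := Int.le_floor.mpr (by push_cast; exact h2)
          simp only [Set.mem_iUnion, Finset.mem_Icc]
          refine ⟨p, abs_le.mp hpN, ?_⟩
          rw [Metric.mem_ball, Real.dist_eq, lt_div_iff₀ hL0, ← abs_mul]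
          have hx' : (x - -(p : ℝ) / L) * L = p + L * x := by
            rw [sub_mul, div_mul_cancel₀ _ hLne]
            ring
          rwa [hx']
      _ ≤ ∑ p ∈ Finset.Icc (-N) N, volume (Metric.ball (-(p : ℝ) / L) (ε / |L|)) :=
          measure_biUnion_finset_le _ _
      _ = ENNReal.ofReal ((2 * N + 1) * (2 * (ε / |L|))) := by
          have hc : ((Finset.Icc (-N) N).card : ℝ) = 2 * N + 1 := by
            have : ((Finset.Icc (-N) N).card : ℤ) = 2 * N + 1 := by
              rw [Int.card_Icc]; omega
            exact_mod_cast this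
          rw [← hc, ENNReal.ofReal_mul (by positivity)]
          simp [Real.volume_ball]
      _ ≤ _ := by
          refine ENNReal.ofReal_le_ofReal ?_
          have h6 : (2 * N + 1 : ℝ) ≤ 6 * |L| := by linarith
          calc (2 * N + 1 : ℝ) * (2 * (ε / |L|)) ≤ 6 * |L| * (2 * (ε / |L|)) := by gcongr
            _ = 12 * ε := by field_simp; ring
  · refine le_of_eq_of_le ?_ zero_le
    convert measure_empty (μ := volume)
    refine Set.eq_empty_of_forall_notMem ?_
    rintro x ⟨hx, p, hp, h⟩
    exact hL (key x hx p hp h).1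

/-- If `‖b·q + p‖ ≤ ‖q‖^{-u}` has finitely many solutions `q`, with `u > 0`, then a constant
multiple of `‖q‖^{-u}` bounds `|b·q + p|` from below for all `q ≠ 0`. -/
lemma exists_pos_mul_rpow_le_of_finite {m : ℕ} (b : Fin m → ℝ) {u : ℝ} (hu : 0 < u)
    (hb : {q : Fin m → ℤ | ∃ p : ℤ, |(∑ i, b i * (q i : ℝ)) + (p : ℝ)| ≤
      ‖(fun i => (q i : ℝ) : Fin m → ℝ)‖ ^ (-u)}.Finite) :
    ∃ c : ℝ, 0 < c ∧ c ≤ 1 ∧ ∀ q : Fin m → ℤ, q ≠ 0 → ∀ p : ℤ,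
      c * ‖(fun i => (q i : ℝ) : Fin m → ℝ)‖ ^ (-u) ≤ |(∑ i, b i * (q i : ℝ)) + (p : ℝ)| := by
  have hne : ∀ q : Fin m → ℤ, q ≠ 0 → ∀ p : ℤ, (∑ i, b i * (q i : ℝ)) + (p : ℝ) ≠ 0 := by
    intro q hq p h0
    have hinj : Function.Injective (fun k : ℤ => k • q) := smul_left_injective ℤ hq
    refine Set.infinite_of_injective_forall_mem hinj (fun k => ?_) hb
    refine ⟨k * p, ?_⟩
    have : (∑ i, b i * (((k • q) i : ℤ) : ℝ)) + ((k * p : ℤ) : ℝ) = 0 := by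
      have : (∑ i, b i * (((k • q) i : ℤ) : ℝ)) = k * ∑ i, b i * (q i : ℝ) := by
        rw [Finset.mul_sum]
        refine Finset.sum_congr rfl fun i _ => ?_
        simp only [Pi.smul_apply, smul_eq_mul]
        push_cast
        ring
      rw [this]
      push_cast
      rw [← mul_add, h0, mul_zero]
    rw [this, abs_zero]
    positivity
  have hnorm : ∀ q : Fin m → ℤ, q ≠ 0 → 1 ≤ ‖(fun i => (q i : ℝ) : Fin m → ℝ)‖ := by
    intro q hq
    obtain ⟨i, hi⟩ := Function.ne_iff.mp hq
    have h1 : (1 : ℝ) ≤ |(q i : ℝ)| := by exact_mod_cast Int.one_le_abs hi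
    exact h1.trans (norm_le_pi_norm (fun i => (q i : ℝ) : Fin m → ℝ) i)
  have hev : ∀ᶠ c : ℝ in nhdsWithin 0 (Set.Ioi 0), ∀ q ∈ {q : Fin m → ℤ | ∃ p : ℤ,
      |(∑ i, b i * (q i : ℝ)) + (p : ℝ)| ≤ ‖(fun i => (q i : ℝ) : Fin m → ℝ)‖ ^ (-u)},
      q ≠ 0 → ∀ p : ℤ, c ≤ |(∑ i, b i * (q i : ℝ)) + (p : ℝ)| := by
    rw [Filter.eventually_all_finite hb]
    intro q _
    by_cases hq : q = 0
    · simp [hq]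
    set t := ∑ i, b i * (q i : ℝ) with ht
    have hpos : 0 < |t - round t| := by
      have := hne q hq (-round t)
      rw [abs_pos]
      push_cast at this
      rwa [← ht, ← sub_eq_add_neg] at this
    filter_upwards [Ioo_mem_nhdsGT hpos] with c hc _ p
    have := round_le t (-p)
    push_cast at this
    rw [sub_neg_eq_add] at this
    exact hc.2.le.trans this
  obtain ⟨c, hc, hc01⟩ := (hev.and (Ioo_mem_nhdsGT one_pos)).exists
  refine ⟨c, hc01.1, hc01.2.le, fun q hq p => ?_⟩
  by_cases hS : q ∈ {q : Fin m → ℤ | ∃ p : ℤ,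
      |(∑ i, b i * (q i : ℝ)) + (p : ℝ)| ≤ ‖(fun i => (q i : ℝ) : Fin m → ℝ)‖ ^ (-u)}
  · refine (mul_le_of_le_one_right hc01.1.le ?_).trans (hc q hS hq p)
    exact Real.rpow_le_one_of_one_le_of_nonpos (hnorm q hq) (by linarith)
  · have hlt : ‖(fun i => (q i : ℝ) : Fin m → ℝ)‖ ^ (-u) <
        |(∑ i, b i * (q i : ℝ)) + (p : ℝ)| := by
      by_contra! h
      exact hS ⟨p, h⟩
    exact (mul_le_of_le_one_left (by positivity) hc01.2.le).trans hlt.le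

/-- The integer points of sup norm less than `2 * Q` lie in a finite set of at most `(5 * Q) ^ n`
elements. -/
lemma exists_finset_norm_lt_card_le (n : ℕ) {Q : ℝ} (hQ : 1 ≤ Q) :
    ∃ F : Finset (Fin n → ℤ), (F.card : ℝ) ≤ (5 * Q) ^ n ∧
      ∀ q : Fin n → ℤ, ‖(fun i => (q i : ℝ) : Fin n → ℝ)‖ < 2 * Q → q ∈ F := by
  set N : ℤ := ⌊2 * Q⌋ with hN
  have hN0 : 0 ≤ N := Int.floor_nonneg.mpr (by positivity)
  have hNle : (N : ℝ) ≤ 2 * Q := Int.floor_le _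
  refine ⟨Fintype.piFinset fun _ => Finset.Icc (-N) N, ?_, fun q hq => ?_⟩
  · have hc : ((Finset.Icc (-N) N).card : ℝ) = 2 * N + 1 := by
      have : ((Finset.Icc (-N) N).card : ℤ) = 2 * N + 1 := by
        rw [Int.card_Icc]; omega
      exact_mod_cast this
    rw [Fintype.card_piFinset_const, Nat.cast_pow, hc]
    have : (0 : ℝ) ≤ N := by exact_mod_cast hN0
    gcongr
    linarith
  · rw [Fintype.mem_piFinset]
    intro i
    rw [Finset.mem_Icc, ← abs_le]
    refine Int.le_floor.mpr ?_
    push_cast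
    exact (norm_le_pi_norm (fun i => (q i : ℝ) : Fin n → ℝ) i).trans hq.le

/-- **Lemma 4.8.** Let `n = m + 1 ≥ 2`, let `b ∈ ℝ^{n-1}` satisfy `b ∉ W_n^+(1,n-1)` and
let `v > n`. For `Q > 0` let `A(b,v,Q)` be the set of `x ∈ [0,1)` for which
`|p + (b̃·q)x| < Q^{-v}` for some `p ∈ ℤ` and `q ∈ ℤ^n` with `Q ≤ ‖q‖ < 2Q`, where
`b̃ = (1,b)`. Then there is a constant `C = C(b,v) > 0` such that for every `Q > 1`,
`|A(b,v,Q)| < C Q^{(n-v)/2}`. -/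
theorem measure_A_bvQ_lt (m : ℕ) (hm : 1 ≤ m) (b : Fin m → ℝ)
    (hb : ∀ u : ℝ, ((m : ℝ) + 1) < u →
      {q : Fin m → ℤ | ∃ p : ℤ,
        |(∑ i, b i * (q i : ℝ)) + (p : ℝ)| ≤
          ‖(fun i => (q i : ℝ) : Fin m → ℝ)‖ ^ (-u)}.Finite)
    (v : ℝ) (hv : ((m : ℝ) + 1) < v) :
    ∃ C : ℝ, 0 < C ∧ ∀ Q : ℝ, 1 < Q →
      volume {x ∈ Set.Ico (0 : ℝ) 1 | ∃ p : ℤ, ∃ q : Fin (m + 1) → ℤ,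
          Q ≤ ‖(fun i => (q i : ℝ) : Fin (m + 1) → ℝ)‖ ∧
          ‖(fun i => (q i : ℝ) : Fin (m + 1) → ℝ)‖ < 2 * Q ∧
          |(p : ℝ) + (∑ i, (Fin.cons 1 b : Fin (m + 1) → ℝ) i * (q i : ℝ)) * x| < Q ^ (-v)} <
        ENNReal.ofReal (C * Q ^ (((m : ℝ) + 1 - v) / 2)) := by
  set s : ℝ := (v - (m + 1)) / 2 with hs
  have hs0 : 0 < s := by rw [hs]; linarith
  have hexp : ((m : ℝ) + 1 - v) / 2 = -s := by rw [hs]; ring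
  have hm0 : (1 : ℝ) ≤ m := by exact_mod_cast hm
  set u : ℝ := v - s with hu
  have hmu : (m : ℝ) + 1 < u := by rw [hu, hs]; linarith
  have hu0 : 0 < u := by linarith
  obtain ⟨c, hc0, hc1, hc⟩ := exists_pos_mul_rpow_le_of_finite b hu0 (hb u hmu)
  rw [hexp]
  refine ⟨2 ^ u / c + 12 * 5 ^ (m + 1) + 2 ^ s + 1, by positivity, fun Q hQ => ?_⟩
  have hQ0 : 0 < Q := by linarith
  have hQs : 0 < Q ^ (-s) := Real.rpow_pos_of_pos hQ0 _
  rcases lt_or_ge Q 2 with hQ2 | hQ2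
  · refine (measure_mono (Set.sep_subset _ _)).trans_lt ?_
    rw [Real.volume_Ico, sub_zero, ENNReal.ofReal_lt_ofReal_iff (by positivity)]
    calc (1 : ℝ) = 2 ^ s * 2 ^ (-s) := by rw [← Real.rpow_add two_pos]; simp
      _ ≤ 2 ^ s * Q ^ (-s) := by
        gcongr ?_ * ?_
        exact Real.rpow_le_rpow_of_nonpos hQ0 hQ2.le (by linarith)
      _ < _ := by
        gcongr
        have : 0 < (2 : ℝ) ^ u / c + 12 * 5 ^ (m + 1) := by positivity
        linarith
  have hε : Q ^ (-v) ≤ 1 / 2 := by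
    calc Q ^ (-v) ≤ Q ^ (-1 : ℝ) := Real.rpow_le_rpow_of_exponent_le hQ.le (by linarith)
      _ = Q⁻¹ := Real.rpow_neg_one Q
      _ ≤ _ := by rw [one_div]; gcongr
  have hε0 : 0 ≤ Q ^ (-v) := by positivity
  set L : (Fin (m + 1) → ℤ) → ℝ :=
    fun q => ∑ i, (Fin.cons 1 b : Fin (m + 1) → ℝ) i * (q i : ℝ) with hL
  have hLlow : ∀ q : Fin (m + 1) → ℤ, Q ≤ ‖(fun i => (q i : ℝ) : Fin (m + 1) → ℝ)‖ →
      ‖(fun i => (q i : ℝ) : Fin (m + 1) → ℝ)‖ < 2 * Q → c * (2 * Q) ^ (-u) ≤ |L q| := by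
    intro q hq1 hq2
    have hLq : L q = (∑ i, b i * ((Fin.tail q) i : ℝ)) + (q 0 : ℝ) := by
      simp only [hL, Fin.sum_univ_succ, Fin.cons_zero, Fin.cons_succ, one_mul, Fin.tail]
      ring
    by_cases hq : Fin.tail q = 0
    · have hq0 : q 0 ≠ 0 := by
        intro h0
        have : q = 0 := by
          ext i
          refine Fin.cases h0 (fun j => congrFun hq j) i
        simp only [this, Pi.zero_apply, Int.cast_zero] at hq1
        rw [show (fun _ : Fin (m + 1) => (0 : ℝ)) = 0 from rfl, norm_zero] at hq1
        linarith
      have h1 : (1 : ℝ) ≤ |(q 0 : ℝ)| := by exact_mod_cast Int.one_le_abs hq0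
      have h2 : (2 * Q) ^ (-u) ≤ 1 :=
        Real.rpow_le_one_of_one_le_of_nonpos (by linarith) (by linarith)
      rw [hLq, hq]
      simp only [Pi.zero_apply, Int.cast_zero, mul_zero, Finset.sum_const_zero, zero_add]
      exact (mul_le_one₀ hc1 (by positivity) h2).trans h1
    · rw [hLq]
      refine le_trans ?_ (hc _ hq (q 0))
      have hpos : 0 < ‖(fun i => ((Fin.tail q) i : ℝ) : Fin m → ℝ)‖ := by
        rw [norm_pos_iff]
        intro h
        refine hq (funext fun i => ?_)
        have := congrFun h i
        simp only [Pi.zero_apply, Int.cast_eq_zero] at this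
        exact this
      gcongr ?_ * ?_
      refine Real.rpow_le_rpow_of_nonpos hpos (le_trans ?_ hq2.le) (by linarith)
      exact (pi_norm_le_iff_of_nonneg (norm_nonneg _)).mpr fun i =>
        norm_le_pi_norm (fun i => (q i : ℝ) : Fin (m + 1) → ℝ) i.succ
  obtain ⟨F, hFcard, hF⟩ := exists_finset_norm_lt_card_le (m + 1) hQ.le
  set T : (Fin (m + 1) → ℤ) → Set ℝ := fun q =>
    {x ∈ Set.Ico (0 : ℝ) 1 | ∃ p : ℤ, p ≠ 0 ∧ |(p : ℝ) + L q * x| < Q ^ (-v)} with hT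
  calc _ ≤ volume (Set.Ico 0 (2 ^ u / c * Q ^ (-s)) ∪ ⋃ q ∈ F, T q) := by
        refine measure_mono ?_
        rintro x ⟨hx, p, q, hq1, hq2, h⟩
        by_cases hp : p = 0
        · refine Or.inl ⟨hx.1, ?_⟩
          have h1 : |L q| * x < Q ^ (-v) := by
            simpa [hp, abs_mul, abs_of_nonneg hx.1, hL] using h
          have h2 : c * (2 * Q) ^ (-u) * x < Q ^ (-v) :=
            (mul_le_mul_of_nonneg_right (hLlow q hq1 hq2) hx.1).trans_lt h1
          have hpos : 0 < c * (2 * Q) ^ (-u) := by positivity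
          rw [mul_comm, ← lt_div_iff₀ hpos] at h2
          refine h2.trans_eq ?_
          rw [Real.mul_rpow two_pos.le hQ0.le, Real.rpow_neg two_pos.le,
            show -v = -s + -u by rw [hu]; ring, Real.rpow_add hQ0]
          have := Real.rpow_pos_of_pos hQ0 (-u)
          field_simp
        · refine Or.inr ?_
          simp only [Set.mem_iUnion]
          exact ⟨q, hF q hq2, hx, p, hp, h⟩
    _ ≤ volume (Set.Ico 0 (2 ^ u / c * Q ^ (-s))) + ∑ q ∈ F, volume (T q) :=
        (measure_union_le _ _).trans (by gcongr; exact measure_biUnion_finset_le _ _)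
    _ ≤ ENNReal.ofReal (2 ^ u / c * Q ^ (-s)) +
          ∑ q ∈ F, ENNReal.ofReal (12 * Q ^ (-v)) := by
        rw [Real.volume_Ico, sub_zero]
        gcongr with q _
        exact volume_exists_ne_zero_abs_add_mul_lt_le (L q) _ hε hε0
    _ = ENNReal.ofReal (2 ^ u / c * Q ^ (-s) + F.card * (12 * Q ^ (-v))) := by
        rw [Finset.sum_const, nsmul_eq_mul, ENNReal.ofReal_add (by positivity) (by positivity),
          ENNReal.ofReal_mul (p := (F.card : ℝ)) (by positivity), ENNReal.ofReal_natCast]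
    _ < _ := by
        rw [ENNReal.ofReal_lt_ofReal_iff (by positivity)]
        have h1 : (F.card : ℝ) * (12 * Q ^ (-v)) ≤ 12 * 5 ^ (m + 1) * Q ^ (-s) := by
          calc (F.card : ℝ) * (12 * Q ^ (-v)) ≤ (5 * Q) ^ (m + 1) * (12 * Q ^ (-v)) := by gcongr
            _ = 12 * 5 ^ (m + 1) * (Q ^ ((m : ℝ) + 1) * Q ^ (-v)) := by
                rw [mul_pow, ← Real.rpow_natCast Q (m + 1)]
                push_cast
                ring
            _ ≤ _ := by
                rw [← Real.rpow_add hQ0]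
                gcongr
                · exact hQ.le
                · rw [hs]; linarith
        have h2 : 0 < (2 : ℝ) ^ s * Q ^ (-s) := by positivity
        linarith
end
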